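/- arXiv:1503.04380 — 3 statements merged into one kernel-verified Lean document; each statement's English description precedes it below -/
import Mathlib

section
/- Let T be a triangular set in K[x_1,...,x_n]. Then the radical of sat(T) equals the intersection of finitely many ideals sat(T_1),...,sat(T_t), where each T_i is a regular triangular set having the same parameter set as T and each sat(T_i) is a prime ideal. In particular, sat(T) is an unmixed ideal (all of its associated primes have the same dimension). -/
open MvPolynomial

namespace Tri

/-- The initial of `f` with respect to the variable `i`: the leading coefficient of `f`
viewed as a univariate polynomial in `x_i`, expressed as a polynomial in the remaining
variables (an element of the same ring). -/
noncomputable def initial {K : Type*} [CommSemiring K] {σ : Type*} [DecidableEq σ]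
    (f : MvPolynomial σ K) (i : σ) : MvPolynomial σ K :=
  ∑ m ∈ f.support.filter (fun m => m i = MvPolynomial.degreeOf i f),
    MvPolynomial.monomial (Finsupp.erase i m) (MvPolynomial.coeff m f)

/-- `x_i` is the leading variable of `f`: it occurs in `f` and is the greatest variable
occurring in `f`. -/
def IsLeadingVar {K : Type*} [CommSemiring K] {n : ℕ} (f : MvPolynomial (Fin n) K)
    (i : Fin n) : Prop :=
  0 < MvPolynomial.degreeOf i f ∧ ∀ j, 0 < MvPolynomial.degreeOf j f → j ≤ i

/-- `T` (with leading variables `lvs`) is a triangular set: the polynomials of `T` are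
nonconstant with pairwise distinct, increasing leading variables. -/
def IsTriangular {K : Type*} [CommSemiring K] {n r : ℕ} (T : Fin r → MvPolynomial (Fin n) K)
    (lvs : Fin r → Fin n) : Prop :=
  StrictMono lvs ∧ ∀ j, IsLeadingVar (T j) (lvs j)

/-- `p` lies in `K[u]` where `u` is the parameter set of a triangular set with leading
variables `lvs`, i.e. no variable of `p` is a leading variable. -/
def inParams {K : Type*} [CommSemiring K] {n r : ℕ} (lvs : Fin r → Fin n)
    (p : MvPolynomial (Fin n) K) : Prop :=
  ∀ i ∈ p.vars, i ∉ Set.range lvs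

/-- `T` is a regular triangular set: it is triangular, and for each `i` the ideal
`(T_1, …, T_{i-1}, ini(T_i))` has nonzero intersection with `K[u]`. -/
def IsRegular {K : Type*} [CommRing K] {n r : ℕ} (T : Fin r → MvPolynomial (Fin n) K)
    (lvs : Fin r → Fin n) : Prop :=
  IsTriangular T lvs ∧
    ∀ i : Fin r, ∃ p ∈ Ideal.span (T '' {j | j < i} ∪ {initial (T i) (lvs i)}),
      p ≠ 0 ∧ inParams lvs p

/-- The product of the initials of a triangular set. -/
noncomputable def initProd {K : Type*} [CommSemiring K] {n r : ℕ}
    (T : Fin r → MvPolynomial (Fin n) K) (lvs : Fin r → Fin n) : MvPolynomial (Fin n) K :=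
  ∏ j, initial (T j) (lvs j)

/-- The saturation `{f | ∃ d, a ^ d * f ∈ J}` of an ideal `J` by an element `a`. -/
def saturationBy {R : Type*} [CommRing R] (J : Ideal R) (a : R) : Ideal R where
  carrier := {f | ∃ d : ℕ, a ^ d * f ∈ J}
  zero_mem' := ⟨0, by simpa using J.zero_mem⟩
  add_mem' := by
    rintro f g ⟨d1, h1⟩ ⟨d2, h2⟩
    refine ⟨d1 + d2, ?_⟩
    have h : a ^ (d1 + d2) * (f + g)
        = a ^ d2 * (a ^ d1 * f) + a ^ d1 * (a ^ d2 * g) := by ring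
    rw [h]
    exact J.add_mem (J.mul_mem_left _ h1) (J.mul_mem_left _ h2)
  smul_mem' := by
    rintro c f ⟨d, h⟩
    exact ⟨d, by rw [smul_eq_mul, mul_left_comm]; exact J.mul_mem_left c h⟩

/-- The saturation ideal `sat(T) = {f | ∃ d, I_T ^ d * f ∈ (T)}` of a triangular set. -/
noncomputable def satIdeal {K : Type*} [CommRing K] {n r : ℕ}
    (T : Fin r → MvPolynomial (Fin n) K) (lvs : Fin r → Fin n) :
    Ideal (MvPolynomial (Fin n) K) :=
  saturationBy (Ideal.span (Set.range T)) (initProd T lvs)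

/-- The zero set `Zero(S/D)` in `E^n` of a system `S` of polynomials together with an
inequation `D ≠ 0`. -/
def zeroSet {K : Type*} [CommSemiring K] {n : ℕ} (E : Type*) [CommSemiring E] [Algebra K E]
    (S : Set (MvPolynomial (Fin n) K)) (D : MvPolynomial (Fin n) K) : Set (Fin n → E) :=
  {x | (∀ f ∈ S, MvPolynomial.aeval x f = 0) ∧ MvPolynomial.aeval x D ≠ 0}

/-- The zero set `Zero(S)` in `E^n` of a system `S` of polynomials. -/
def zeroSet0 {K : Type*} [CommSemiring K] {n : ℕ} (E : Type*) [CommSemiring E] [Algebra K E]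
    (S : Set (MvPolynomial (Fin n) K)) : Set (Fin n → E) :=
  {x | ∀ f ∈ S, MvPolynomial.aeval x f = 0}

/-- The zero set `Zero(I)` in `E^n` of an ideal `I`. -/
def zeroSetI {K : Type*} [CommSemiring K] {n : ℕ} (E : Type*) [CommSemiring E] [Algebra K E]
    (I : Ideal (MvPolynomial (Fin n) K)) : Set (Fin n → E) :=
  {x | ∀ f ∈ I, MvPolynomial.aeval x f = 0}

/-- The Zariski closure in `E^n` of a set `S` (with respect to polynomials over `K`):
the zero set of all polynomials vanishing identically on `S`. -/
def zClosure (K : Type*) [CommSemiring K] {n : ℕ} {E : Type*} [CommSemiring E] [Algebra K E]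
    (S : Set (Fin n → E)) : Set (Fin n → E) :=
  {x | ∀ f : MvPolynomial (Fin n) K, (∀ y ∈ S, MvPolynomial.aeval y f = 0) →
    MvPolynomial.aeval x f = 0}

/-- `P` is not identically zero on any irreducible component of `Zero(I)`; algebraically,
`P` lies in no minimal prime of `I`. -/
def NotIdZeroOnComponents {R : Type*} [CommRing R] (I : Ideal R) (P : R) : Prop :=
  ∀ p ∈ I.minimalPrimes, P ∉ p

/-- An ideal is unmixed if all of its associated primes have the same dimension. -/
def IsUnmixed {R : Type*} [CommRing R] (I : Ideal R) : Prop :=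
  ∀ p ∈ associatedPrimes R (R ⧸ I), ∀ q ∈ associatedPrimes R (R ⧸ I),
    ringKrullDim (R ⧸ p) = ringKrullDim (R ⧸ q)

end Tri

namespace Tri
open Polynomial in
lemma ringKrullDim_eq_of_integral {A B : Type*} [CommRing A] [CommRing B] [IsDomain A] [IsDomain B]
    [Algebra A B]
    [Algebra.IsIntegral A B] (hinj : Function.Injective (algebraMap A B)) :
    ringKrullDim B = ringKrullDim A := by
  apply le_antisymm
  · refine Order.krullDim_le_of_strictMono (fun p => PrimeSpectrum.comap (algebraMap A B) p) ?_
    intro p q hpq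
    exact Ideal.IsIntegral.comap_lt_comap (R := A) (I := p.asIdeal) (J := q.asIdeal) hpq
  · refine iSup_le fun l => ?_
    have : FaithfulSMul A B := (faithfulSMul_iff_algebraMap_injective A B).2 hinj
    obtain ⟨Q, -, hQ, hQc⟩ := Ideal.exists_ideal_over_prime_of_isIntegral (S := B) l.head.asIdeal ⊥
      (by rw [← RingHom.ker_eq_comap_bot, (RingHom.injective_iff_ker_eq_bot _).1 hinj]; exact bot_le)
    have : Q.LiesOver l.head.asIdeal := ⟨hQc.symm⟩
    obtain ⟨L, hL, -⟩ := Ideal.exists_ltSeries_of_hasGoingUp l Q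
    rw [← hL]
    exact le_iSup (fun L : LTSeries (PrimeSpectrum B) => (L.length : WithBot ℕ∞)) L

lemma ringKrullDim_eq_card {K B ι : Type*} [Field K] [CommRing B] [IsDomain B] [Algebra K B]
    [Algebra.FiniteType K B] [Fintype ι] (x : ι → B) (hx : IsTranscendenceBasis K x) :
    ringKrullDim B = Fintype.card ι := by
  obtain ⟨s, g, hg, hintg⟩ := exists_integral_inj_algHom_of_fg K B
  letI : Algebra (MvPolynomial (Fin s) K) B := g.toRingHom.toAlgebra
  haveI : IsScalarTower K (MvPolynomial (Fin s) K) B :=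
    IsScalarTower.of_algebraMap_eq fun k => (g.commutes k).symm
  haveI : Algebra.IsIntegral (MvPolynomial (Fin s) K) B := ⟨hintg⟩
  have hinj : Function.Injective (algebraMap (MvPolynomial (Fin s) K) B) := hg
  rw [ringKrullDim_eq_of_integral hinj, MvPolynomial.ringKrullDim_of_isNoetherianRing,
    ringKrullDim_eq_zero_of_field]
  have : FaithfulSMul (MvPolynomial (Fin s) K) B := (faithfulSMul_iff_algebraMap_injective _ _).2 hinj
  have hb := (IsTranscendenceBasis.mvPolynomial (Fin s) K).algebraMap_comp (A := B)
  have := hx.lift_cardinalMk_eq hb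
  simp at this
  rw [this]; simp
end Tri

set_option linter.unusedSectionVars false
namespace Tri
section uni
variable {σ K : Type*} [DecidableEq σ] [Field K]

/-- View a polynomial as univariate in the variable `i`. -/
noncomputable def toUni (i : σ) : MvPolynomial σ K →ₐ[K] Polynomial (MvPolynomial σ K) :=
  MvPolynomial.aeval (fun j => if j = i then Polynomial.X else Polynomial.C (X j))

lemma toUni_eq_C (i : σ) (f : MvPolynomial σ K) (h : degreeOf i f = 0) :
    toUni i f = Polynomial.C f := by
  have hv : i ∉ f.vars := by
    rw [mem_vars_iff_degreeOf_ne_zero]; simpa using h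
  have := MvPolynomial.hom_congr_vars (f₁ := (toUni (K := K) i).toRingHom)
    (f₂ := (Polynomial.C : MvPolynomial σ K →+* _)) (p₁ := f) (p₂ := f) ?_ ?_ rfl
  · exact this
  · ext k : 1
    exact (toUni (K := K) i).commutes k
  · intro j hj _
    have : j ≠ i := fun h => hv (h ▸ hj)
    simp [toUni, this]

lemma toUni_X_self (i : σ) : toUni (K := K) i (X i) = Polynomial.X := by simp [toUni]

lemma eval_toUni (i : σ) (f : MvPolynomial σ K) : (toUni i f).eval (X i) = f := by
  have : ((Polynomial.aeval (R := MvPolynomial σ K) (X i : MvPolynomial σ K)).restrictScalars K).comp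
      (toUni i) = AlgHom.id K _ := by
    ext j : 1
    by_cases h : j = i <;> simp [toUni, h]
  exact DFunLike.congr_fun this f

lemma degreeOf_monomial_erase (i : σ) (m : σ →₀ ℕ) (c : K) : degreeOf i (monomial (m.erase i) c) = 0 := by
  by_cases hc : c = 0
  · simp [hc]
  · rw [degreeOf_monomial_eq _ _ hc]; simp

lemma toUni_monomial (i : σ) (m : σ →₀ ℕ) (c : K) :
    toUni i (monomial m c) = Polynomial.C (monomial (m.erase i) c) * Polynomial.X ^ (m i) := by
  have : monomial m c = monomial (m.erase i) c * X i ^ (m i) := by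
    rw [X_pow_eq_monomial, monomial_mul, mul_one, Finsupp.erase_add_single]
  rw [this, map_mul, map_pow, toUni_X_self, toUni_eq_C _ _ (degreeOf_monomial_erase i m c)]

lemma coeff_toUni (i : σ) (f : MvPolynomial σ K) (k : ℕ) :
    (toUni i f).coeff k = ∑ m ∈ f.support.filter (fun m => m i = k),
      monomial (m.erase i) (coeff m f) := by
  conv_lhs => rw [f.as_sum, map_sum, Polynomial.finsetSum_coeff]
  rw [Finset.sum_filter]
  refine Finset.sum_congr rfl fun m _ => ?_
  rw [toUni_monomial, Polynomial.coeff_C_mul_X_pow]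
  simp [eq_comm]

lemma degreeOf_coeff_toUni (i j : σ) (f : MvPolynomial σ K) (k : ℕ) :
    degreeOf j ((toUni i f).coeff k) ≤ degreeOf j f := by
  rw [coeff_toUni]
  refine (degreeOf_sum_le _ _ _).trans (Finset.sup_le fun m hm => ?_)
  rw [degreeOf_monomial_eq _ _ (by simpa using (Finset.mem_filter.1 hm).1)]
  refine le_trans ?_ (monomial_le_degreeOf j (Finset.mem_filter.1 hm).1)
  by_cases h : j = i
  · simp [h]
  · simp [Finsupp.erase_ne h]

lemma degreeOf_coeff_toUni_self (i : σ) (f : MvPolynomial σ K) (k : ℕ) :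
    degreeOf i ((toUni i f).coeff k) = 0 := by
  rw [coeff_toUni, ← Nat.le_zero]
  refine (degreeOf_sum_le _ _ _).trans (Finset.sup_le fun m hm => ?_)
  rw [degreeOf_monomial_erase]

lemma toUni_inj (i : σ) (f : MvPolynomial σ K) (h : toUni i f = 0) : f = 0 := by
  rw [← eval_toUni i f, h]; simp

/-- Recover from a univariate polynomial whose coefficients do not involve `i`. -/
lemma toUni_eval (i : σ) (s : Polynomial (MvPolynomial σ K)) (h : ∀ k, degreeOf i (s.coeff k) = 0) :
    toUni i (s.eval (X i)) = s := by
  rw [Polynomial.eval_eq_sum, Polynomial.sum, map_sum]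
  conv_rhs => rw [s.as_sum_support_C_mul_X_pow]
  refine Finset.sum_congr rfl fun k _ => ?_
  rw [map_mul, map_pow, toUni_X_self, toUni_eq_C _ _ (h k)]

lemma coeff_toUni_degreeOf (i : σ) (f : MvPolynomial σ K) :
    (toUni i f).coeff (degreeOf i f) = initial f i := coeff_toUni _ _ _

lemma natDegree_toUni_le (i : σ) (f : MvPolynomial σ K) :
    (toUni i f).natDegree ≤ degreeOf i f := by
  rw [Polynomial.natDegree_le_iff_coeff_eq_zero]
  intro k hk
  rw [coeff_toUni, Finset.filter_false_of_mem, Finset.sum_empty]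
  intro m hm h
  have := monomial_le_degreeOf i hm
  omega

lemma degreeOf_le_natDegree_toUni (i : σ) (f : MvPolynomial σ K) :
    degreeOf i f ≤ (toUni i f).natDegree := by
  conv_lhs => rw [← eval_toUni i f, Polynomial.eval_eq_sum_range]
  refine (degreeOf_sum_le _ _ _).trans (Finset.sup_le fun k hk => ?_)
  refine (degreeOf_mul_le _ _ _).trans ?_
  rw [degreeOf_coeff_toUni_self, zero_add]
  refine (degreeOf_pow_le _ _ _).trans ?_
  rw [degreeOf_X]
  simp at hk ⊢; omega

lemma natDegree_toUni (i : σ) (f : MvPolynomial σ K) :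
    (toUni i f).natDegree = degreeOf i f :=
  le_antisymm (natDegree_toUni_le i f) (degreeOf_le_natDegree_toUni i f)

lemma leadingCoeff_toUni (i : σ) (f : MvPolynomial σ K) :
    (toUni i f).leadingCoeff = initial f i := by
  rw [Polynomial.leadingCoeff, natDegree_toUni, coeff_toUni_degreeOf]

lemma degreeOf_initial_self (i : σ) (f : MvPolynomial σ K) : degreeOf i (initial f i) = 0 := by
  rw [← coeff_toUni_degreeOf]; exact degreeOf_coeff_toUni_self _ _ _

lemma degreeOf_initial_le (i j : σ) (f : MvPolynomial σ K) :
    degreeOf j (initial f i) ≤ degreeOf j f := by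
  rw [← coeff_toUni_degreeOf]; exact degreeOf_coeff_toUni _ _ _ _

/-- evaluating a univariate polynomial: degree in another variable. -/
lemma degreeOf_eval_le (i j : σ) (hij : j ≠ i) (s : Polynomial (MvPolynomial σ K)) (d : ℕ)
    (h : ∀ k, degreeOf j (s.coeff k) ≤ d) : degreeOf j (s.eval (X i)) ≤ d := by
  rw [Polynomial.eval_eq_sum_range]
  refine (degreeOf_sum_le _ _ _).trans (Finset.sup_le fun k hk => ?_)
  refine (degreeOf_mul_le _ _ _).trans ?_
  have : degreeOf j ((X i : MvPolynomial σ K) ^ k) = 0 := by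
    rw [← Nat.le_zero]
    refine (degreeOf_pow_le _ _ _).trans ?_
    rw [degreeOf_X_of_ne hij]; simp
  rw [this]; simpa using h k

/-- pseudo-division -/
lemma pseudo_div (i : σ) (g : MvPolynomial σ K) (hg : 0 < degreeOf i g) (N : ℕ) :
    ∀ f : MvPolynomial σ K, degreeOf i f < N → ∃ (d : ℕ) (q r : MvPolynomial σ K),
      initial g i ^ d * f = q * g + r ∧ degreeOf i r < degreeOf i g ∧
      ∀ j, degreeOf j g = 0 → degreeOf j r ≤ degreeOf j f := by
  induction N with
  | zero => intro f hf; omega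
  | succ N ih =>
    intro f hf
    by_cases hfg : degreeOf i f < degreeOf i g
    · exact ⟨0, 0, f, by simp, hfg, fun _ _ => le_rfl⟩
    push Not at hfg
    set f' := initial g i * f - initial f i * X i ^ (degreeOf i f - degreeOf i g) * g with hf'
    have huni : toUni i f' = Polynomial.C (initial g i) * toUni i f
        - Polynomial.C (initial f i) * Polynomial.X ^ (degreeOf i f - degreeOf i g) * toUni i g := by
      rw [hf']
      simp [toUni_X_self, toUni_eq_C _ _ (degreeOf_initial_self i g),
        toUni_eq_C _ _ (degreeOf_initial_self i f)]
    have hlt : degreeOf i f' < degreeOf i f := by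
      rw [← natDegree_toUni]
      have hle : (toUni i f').natDegree ≤ degreeOf i f - 1 := by
        rw [Polynomial.natDegree_le_iff_coeff_eq_zero]
        intro k hk
        rw [huni, Polynomial.coeff_sub, Polynomial.coeff_C_mul, mul_assoc, Polynomial.coeff_C_mul,
          mul_comm (Polynomial.X ^ _), Polynomial.coeff_mul_X_pow', if_pos (by omega)]
        rcases Nat.lt_or_ge (degreeOf i f) k with h | h
        · rw [Polynomial.coeff_eq_zero_of_natDegree_lt (n := k),
            Polynomial.coeff_eq_zero_of_natDegree_lt]
          · simp
          · rw [natDegree_toUni]; omega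
          · rw [natDegree_toUni]; omega
        · have hk' : k = degreeOf i f := by omega
          have h2 : k - (degreeOf i f - degreeOf i g) = degreeOf i g := by omega
          rw [h2, hk', coeff_toUni_degreeOf, coeff_toUni_degreeOf]; ring
      omega
    obtain ⟨d, q, r, h1, h2, h3⟩ := ih f' (by omega)
    refine ⟨d + 1, q + initial g i ^ d * (initial f i * X i ^ (degreeOf i f - degreeOf i g)), r,
      ?_, h2, fun j hj => (h3 j hj).trans ?_⟩
    · rw [hf'] at h1
      linear_combination h1
    · have hji : j ≠ i := by rintro rfl; omega
      rw [hf']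
      refine (degreeOf_sub_le _ _ _).trans (max_le ?_ ?_)
      · refine (degreeOf_mul_le _ _ _).trans ?_
        have := degreeOf_initial_le i j g
        omega
      · refine (degreeOf_mul_le _ _ _).trans ?_
        rw [hj, add_zero]
        refine (degreeOf_mul_le _ _ _).trans ?_
        have h0 : degreeOf j ((X i : MvPolynomial σ K) ^ (degreeOf i f - degreeOf i g)) = 0 := by
          rw [← Nat.le_zero]
          refine (degreeOf_pow_le _ _ _).trans ?_
          rw [degreeOf_X_of_ne hji]; simp
        have := degreeOf_initial_le i j f
        omega
end uni

/-- multiplication by a polynomial with leading coefficient `h` -/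
lemma exists_pow_kill {A : Type*} [CommRing A] (t : Polynomial A) (d : ℕ) (hd : t.natDegree ≤ d)
    (m : ℕ) : ∀ s : Polynomial A, (∀ k, m ≤ k → s.coeff k = 0) →
      (∀ k, d ≤ k → (s * t).coeff k = 0) →
      ∃ N : ℕ, Polynomial.C (t.coeff d ^ N) * s = 0 := by
  induction m with
  | zero => exact fun s hs _ => ⟨0, by ext k; simp [hs k]⟩
  | succ m ih =>
    intro s hs hst
    have htop : s.coeff m * t.coeff d = 0 := by
      rw [← Polynomial.coeff_mul_add_eq_of_natDegree_le (df := m) (dg := d) _ hd]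
      · exact hst _ (by omega)
      · rw [Polynomial.natDegree_le_iff_coeff_eq_zero]
        intro k hk; exact hs k hk
    obtain ⟨N, hN⟩ := ih (Polynomial.C (t.coeff d) * s) (by
      intro k hk
      rw [Polynomial.coeff_C_mul]
      rcases Nat.eq_or_lt_of_le hk with rfl | h
      · rw [mul_comm]; exact htop
      · rw [hs k h, mul_zero]) (by
      intro k hk
      rw [mul_assoc, Polynomial.coeff_C_mul, hst k hk, mul_zero])
    refine ⟨N + 1, ?_⟩
    rw [pow_succ, Polynomial.C_mul, mul_assoc]; exact hN
end Tri

namespace Tri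
section sat
variable {K : Type*} [Field K] {n r : ℕ}

/-- the ideal generated by the first `i` elements -/
noncomputable def spanLT (T : Fin r → MvPolynomial (Fin n) K) (i : ℕ) : Ideal (MvPolynomial (Fin n) K) :=
  Ideal.span (T '' {j | j.val < i})

/-- the product of the first `i` initials -/
noncomputable def prodLT (T : Fin r → MvPolynomial (Fin n) K) (lvs : Fin r → Fin n) (i : ℕ) :
    MvPolynomial (Fin n) K :=
  ∏ j ∈ Finset.univ.filter (fun j : Fin r => j.val < i), initial (T j) (lvs j)

lemma spanLT_succ (T : Fin r → MvPolynomial (Fin n) K) (k : Fin r) :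
    spanLT T (k.val + 1) = spanLT T k.val ⊔ Ideal.span {T k} := by
  rw [spanLT, spanLT, ← Ideal.span_union]
  congr 1
  ext f
  simp only [Set.mem_image, Set.mem_ofPred_eq, Set.mem_union, Set.mem_singleton_iff]
  constructor
  · rintro ⟨j, hj, rfl⟩
    rcases Nat.lt_succ_iff_lt_or_eq.1 hj with h | h
    · exact Or.inl ⟨j, h, rfl⟩
    · right; rw [Fin.ext h]
  · rintro (⟨j, hj, rfl⟩ | rfl)
    · exact ⟨j, by omega, rfl⟩
    · exact ⟨k, by omega, rfl⟩

lemma prodLT_succ (T : Fin r → MvPolynomial (Fin n) K) (lvs : Fin r → Fin n) (k : Fin r) :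
    prodLT T lvs (k.val + 1) = prodLT T lvs k.val * initial (T k) (lvs k) := by
  rw [prodLT, prodLT, mul_comm, ← Finset.prod_insert (f := fun j => initial (T j) (lvs j)) (by simp)]
  congr 1
  ext j
  simp only [Finset.mem_filter, Finset.mem_univ, true_and, Finset.mem_insert, Fin.ext_iff]
  omega

lemma spanLT_top (T : Fin r → MvPolynomial (Fin n) K) : spanLT T r = Ideal.span (Set.range T) := by
  simp [spanLT, ← Set.image_univ]

lemma prodLT_top (T : Fin r → MvPolynomial (Fin n) K) (lvs : Fin r → Fin n) :
    prodLT T lvs r = initProd T lvs := by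
  simp [prodLT, initProd]

lemma mem_spanLT_succ {T : Fin r → MvPolynomial (Fin n) K} {k : Fin r} {f : MvPolynomial (Fin n) K} :
    f ∈ spanLT T (k.val + 1) ↔ ∃ q, f - q * T k ∈ spanLT T k.val := by
  rw [spanLT_succ, Submodule.mem_sup]
  constructor
  · rintro ⟨w, hw, z, hz, rfl⟩
    obtain ⟨q, rfl⟩ := Ideal.mem_span_singleton'.1 hz
    exact ⟨q, by simpa using hw⟩
  · rintro ⟨q, hq⟩
    exact ⟨_, hq, _, Ideal.mem_span_singleton'.2 ⟨q, rfl⟩, by ring⟩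

lemma coeff_toUni_mem_span {σ : Type*} [DecidableEq σ] (y : σ) (S : Set (MvPolynomial σ K))
    (hS : ∀ s ∈ S, degreeOf y s = 0) (w : MvPolynomial σ K) (hw : w ∈ Ideal.span S) :
    ∀ k, (toUni y w).coeff k ∈ Ideal.span S := by
  induction hw using Submodule.span_induction with
  | mem s hs =>
    intro k
    rw [toUni_eq_C _ _ (hS s hs), Polynomial.coeff_C]
    split_ifs
    · exact Ideal.subset_span hs
    · exact zero_mem _
  | zero => simp
  | add a b _ _ ha hb =>
    intro k
    rw [map_add, Polynomial.coeff_add]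
    exact add_mem (ha k) (hb k)
  | smul c a _ ha =>
    intro k
    rw [smul_eq_mul, map_mul, Polynomial.coeff_mul]
    exact sum_mem fun z _ => Ideal.mul_mem_left _ _ (ha _)

lemma degreeOf_prodLT (T : Fin r → MvPolynomial (Fin n) K) (lvs : Fin r → Fin n) (k : Fin r)
    (h : ∀ j, j < k → degreeOf (lvs k) (T j) = 0) : degreeOf (lvs k) (prodLT T lvs k.val) = 0 := by
  rw [← Nat.le_zero, prodLT]
  refine (degreeOf_prod_le _ _ _).trans ?_
  rw [Nat.le_zero, Finset.sum_eq_zero]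
  intro j hj
  have := degreeOf_initial_le (lvs j) (lvs k) (T j)
  rw [h j (by simpa using hj)] at this
  omega

lemma IsTriangular.degreeOf_eq_zero {T : Fin r → MvPolynomial (Fin n) K} {lvs : Fin r → Fin n}
    (hT : IsTriangular T lvs) {j k : Fin r} (h : j < k) : degreeOf (lvs k) (T j) = 0 := by
  by_contra h0
  exact absurd ((hT.2 j).2 _ (Nat.pos_of_ne_zero h0)) (not_le.2 (hT.1 h))

lemma degreeOf_mul_zero {σ : Type*} {y : σ} {a b : MvPolynomial σ K} (ha : degreeOf y a = 0)
    (hb : degreeOf y b = 0) : degreeOf y (a * b) = 0 := by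
  have := degreeOf_mul_le y a b
  omega

lemma degreeOf_pow_zero {σ : Type*} {y : σ} {a : MvPolynomial σ K} (ha : degreeOf y a = 0)
    (e : ℕ) : degreeOf y (a ^ e) = 0 := by
  have := degreeOf_pow_le y a e
  simpa [ha] using this

lemma torsion_free {T : Fin r → MvPolynomial (Fin n) K} {lvs : Fin r → Fin n}
    (hT : IsTriangular T lvs) (p : MvPolynomial (Fin n) K) (hp : p ≠ 0) (hpu : inParams lvs p)
    (i : ℕ) (hi : i ≤ r) : ∀ (f : MvPolynomial (Fin n) K) (e : ℕ),
      prodLT T lvs i ^ e * (p * f) ∈ spanLT T i → ∃ e', prodLT T lvs i ^ e' * f ∈ spanLT T i := by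
  induction i with
  | zero =>
    intro f e h
    refine ⟨0, ?_⟩
    have h0 : spanLT T 0 = ⊥ := by simp [spanLT]
    have h1 : prodLT T lvs 0 = 1 := by simp [prodLT]
    rw [h0, h1] at h
    simp [hp] at h
    simp [h]
  | succ i ih =>
    intro f e hf
    obtain ⟨k, rfl⟩ : ∃ k : Fin r, k.val = i := ⟨⟨i, hi⟩, rfl⟩
    specialize ih (by omega)
    rw [prodLT_succ] at hf ⊢
    set a := prodLT T lvs k.val with ha
    set h := initial (T k) (lvs k) with hh
    set J := spanLT T k.val with hJ
    set y := lvs k with hy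
    obtain ⟨q0, hq0⟩ := mem_spanLT_succ.1 hf
    obtain ⟨d, q', g, hdiv, hdeg, -⟩ := pseudo_div y (T k) (hT.2 k).1 _ f (Nat.lt_succ_self _)
    have hay : degreeOf y a = 0 := degreeOf_prodLT T lvs k fun j hj => hT.degreeOf_eq_zero hj
    have hhy : degreeOf y h = 0 := degreeOf_initial_self _ _
    have hpy : degreeOf y p = 0 := by
      by_contra h0
      exact hpu y (mem_vars_iff_degreeOf_ne_zero.2 h0) ⟨k, rfl⟩
    set c := (a * h) ^ e * p with hc
    have hcy : degreeOf y c = 0 := degreeOf_mul_zero (degreeOf_pow_zero (degreeOf_mul_zero hay hhy) e) hpy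
    set q := h ^ d * q0 - c * q' with hq
    have hw : c * g - q * T k ∈ J := by
      have : c * g - q * T k = h ^ d * ((a * h) ^ e * (p * f) - q0 * T k) := by
        rw [hq, hc]
        linear_combination -(a * h) ^ e * p * hdiv
      rw [this]
      exact Ideal.mul_mem_left _ _ hq0
    have hco := coeff_toUni_mem_span y _ (by
      rintro _ ⟨j, hj, rfl⟩
      exact hT.degreeOf_eq_zero (k := k) hj) _ hw
    have hcoq : ∀ m, degreeOf y (T k) ≤ m → (toUni y q * toUni y (T k)).coeff m ∈ J := by
      intro m hm
      have h1 := hco m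
      rw [map_sub, map_mul _ c g, map_mul _ q, toUni_eq_C _ _ hcy, Polynomial.coeff_sub, Polynomial.coeff_C_mul,
        Polynomial.coeff_eq_zero_of_natDegree_lt (n := m) (p := toUni y g)
          (by rw [natDegree_toUni]; omega), mul_zero, zero_sub] at h1
      exact (neg_mem_iff).1 h1
    obtain ⟨N, hN⟩ := exists_pow_kill ((toUni y (T k)).map (Ideal.Quotient.mk J)) (degreeOf y (T k))
      (Polynomial.natDegree_map_le.trans (natDegree_toUni_le _ _)) ((toUni y q).natDegree + 1)
      ((toUni y q).map (Ideal.Quotient.mk J))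
      (by
        intro m hm
        rw [Polynomial.coeff_map, Polynomial.coeff_eq_zero_of_natDegree_lt (by omega), map_zero])
      (by
        intro m hm
        rw [← Polynomial.map_mul, Polynomial.coeff_map, Ideal.Quotient.eq_zero_iff_mem]
        exact hcoq m hm)
    have hNq : h ^ N * q ∈ J := by
      have h1 : ∀ m, h ^ N * (toUni y q).coeff m ∈ J := by
        intro m
        have := congrArg (fun z => Polynomial.coeff z m) hN
        simp only [Polynomial.coeff_C_mul, Polynomial.coeff_map, Polynomial.coeff_zero,
          coeff_toUni_degreeOf, ← map_pow, ← map_mul] at this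
        exact Ideal.Quotient.eq_zero_iff_mem.1 this
      rw [← eval_toUni y q, Polynomial.eval_eq_sum_range, Finset.mul_sum]
      refine sum_mem fun m _ => ?_
      rw [← mul_assoc]
      exact Ideal.mul_mem_right _ _ (h1 m)
    have hg : a ^ e * (p * (h ^ (e + N) * g)) ∈ J := by
      have : a ^ e * (p * (h ^ (e + N) * g)) = h ^ N * (c * g - q * T k) + h ^ N * q * T k := by
        rw [hc]; ring
      rw [this]
      exact add_mem (Ideal.mul_mem_left _ _ hw) (Ideal.mul_mem_right _ _ hNq)
    obtain ⟨e', hee⟩ := ih _ e hg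
    refine ⟨e' + (e + N) + d, mem_spanLT_succ.2
      ⟨a ^ (e + N + d) * h ^ e' * (a ^ e' * h ^ (e + N)) * q', ?_⟩⟩
    have : (a * h) ^ (e' + (e + N) + d) * f
        - a ^ (e + N + d) * h ^ e' * (a ^ e' * h ^ (e + N)) * q' * T k
        = a ^ (e + N + d) * h ^ e' * (a ^ e' * (h ^ (e + N) * g)) := by
      have e1 : (a * h) ^ (e' + (e + N) + d) * f
        = a ^ (e + N + d) * h ^ e' * (a ^ e' * h ^ (e + N)) * (h ^ d * f) := by ring
      rw [e1, hdiv]; ring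
    rw [this]
    exact Ideal.mul_mem_left _ _ hee

/-- Primes containing `T`, no initial, and meeting `K[u]` trivially. -/
structure Good (T : Fin r → MvPolynomial (Fin n) K) (lvs : Fin r → Fin n)
    (P : Ideal (MvPolynomial (Fin n) K)) : Prop where
  prime : P.IsPrime
  mem : ∀ j, T j ∈ P
  ini : ∀ j, initial (T j) (lvs j) ∉ P
  par : ∀ p, inParams lvs p → p ∈ P → p = 0

lemma good_of_assoc {T : Fin r → MvPolynomial (Fin n) K} {lvs : Fin r → Fin n}
    (hT : IsTriangular T lvs) (P : Ideal (MvPolynomial (Fin n) K))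
    (hP : P ∈ associatedPrimes (MvPolynomial (Fin n) K) (MvPolynomial (Fin n) K ⧸ satIdeal T lvs)) :
    Good T lvs P := by
  obtain ⟨hPp, z, hz⟩ := isAssociatedPrime_iff.1 (AssociatedPrimes.mem_iff.1 hP)
  obtain ⟨f, rfl⟩ := Ideal.Quotient.mk_surjective z
  have hmem : ∀ p, p ∈ P ↔ p * f ∈ satIdeal T lvs := by
    intro p
    rw [hz, Submodule.mem_colon_singleton, Submodule.mem_bot, ← Ideal.Quotient.eq_zero_iff_mem]
    rfl
  have hf : f ∉ satIdeal T lvs := fun h => hPp.ne_top (by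
    rw [Ideal.eq_top_iff_one, hmem, one_mul]; exact h)
  have hTs : ∀ j, T j ∈ satIdeal T lvs := fun j =>
    ⟨0, by rw [pow_zero, one_mul]; exact Ideal.subset_span ⟨j, rfl⟩⟩
  refine ⟨hPp, fun j => (hmem _).2 (Ideal.mul_mem_right _ _ (hTs j)), fun j hj => ?_,
    fun p hp hpP => ?_⟩
  · have h1 : initProd T lvs ∈ P := P.mem_of_dvd (Finset.dvd_prod_of_mem _ (Finset.mem_univ j)) hj
    obtain ⟨d, hd⟩ := (hmem _).1 h1
    exact hf ⟨d + 1, by rw [pow_succ, mul_assoc]; exact hd⟩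
  · by_contra h0
    obtain ⟨d, hd⟩ := (hmem _).1 hpP
    rw [← prodLT_top, ← spanLT_top] at hd
    obtain ⟨e, he⟩ := torsion_free hT p h0 hp r le_rfl f d hd
    rw [prodLT_top, spanLT_top] at he
    exact hf ⟨e, he⟩
end sat
end Tri

namespace Tri
section prime
variable {K : Type*} [Field K] {n r : ℕ}

/-- image of the variable in the quotient -/
noncomputable def xq (P : Ideal (MvPolynomial (Fin n) K)) (i : Fin n) : MvPolynomial (Fin n) K ⧸ P :=
  Ideal.Quotient.mkₐ K P (X i)

lemma map_supported (P : Ideal (MvPolynomial (Fin n) K)) (S : Set (Fin n)) :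
    (supported K S).map (Ideal.Quotient.mkₐ K P) = Algebra.adjoin K (xq P '' S) := by
  rw [supported, AlgHom.map_adjoin, ← Set.image_comp]
  rfl

lemma mk_mem_adjoin (P : Ideal (MvPolynomial (Fin n) K)) (S : Set (Fin n))
    (f : MvPolynomial (Fin n) K) (hf : ∀ j, degreeOf j f ≠ 0 → j ∈ S) :
    Ideal.Quotient.mk P f ∈ Algebra.adjoin K (xq P '' S) := by
  rw [← map_supported]
  refine ⟨f, mem_supported.2 fun j hj => hf j (mem_vars_iff_degreeOf_ne_zero.1 hj), rfl⟩

lemma alg_of_rel (P : Ideal (MvPolynomial (Fin n) K)) (S : Set (Fin n))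
    (i : Fin n) (g : MvPolynomial (Fin n) K) (hg : g ∈ P) (k : ℕ) (hk : (toUni i g).coeff k ∉ P)
    (hS : ∀ j, j ≠ i → degreeOf j g ≠ 0 → j ∈ S) :
    IsAlgebraic (Algebra.adjoin K (xq P '' S)) (xq P i) := by
  have hl : (toUni i g).map (Ideal.Quotient.mk P) ∈
      Polynomial.lifts (algebraMap (Algebra.adjoin K (xq P '' S)) (MvPolynomial (Fin n) K ⧸ P)) := by
    rw [Polynomial.lifts_iff_coeff_lifts]
    intro m
    rw [Polynomial.coeff_map]
    refine ⟨⟨_, mk_mem_adjoin P S _ fun j hj => hS j ?_ ?_⟩, rfl⟩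
    · rintro rfl
      exact hj (degreeOf_coeff_toUni_self _ _ _)
    · have := degreeOf_coeff_toUni i j g m
      omega
  obtain ⟨q, hq⟩ := (Polynomial.mem_lifts _).1 hl
  refine ⟨q, ?_, ?_⟩
  · rintro rfl
    have := congrArg (fun z => Polynomial.coeff z k) hq
    simp only [Polynomial.map_zero, Polynomial.coeff_zero, Polynomial.coeff_map] at this
    exact hk (Ideal.Quotient.eq_zero_iff_mem.1 this.symm)
  · rw [Polynomial.aeval_def, Polynomial.eval₂_eq_eval_map, hq]
    have : xq P i = Ideal.Quotient.mk P (X i) := rfl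
    rw [this, Polynomial.eval_map, Polynomial.eval₂_at_apply, eval_toUni]
    exact Ideal.Quotient.eq_zero_iff_mem.2 hg

variable {T : Fin r → MvPolynomial (Fin n) K} {lvs : Fin r → Fin n}
  {P : Ideal (MvPolynomial (Fin n) K)}

lemma alg_mono [P.IsPrime] {S S' : Set (Fin n)} (h : S ⊆ S') {b : MvPolynomial (Fin n) K ⧸ P}
    (hb : IsAlgebraic (Algebra.adjoin K (xq P '' S)) b) :
    IsAlgebraic (Algebra.adjoin K (xq P '' S')) b :=
  hb.adjoin_of_forall_isAlgebraic fun _ hx => absurd (Set.image_mono h hx.1) hx.2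

lemma alg_params (hT : IsTriangular T lvs) (hP : Good T lvs P) (k : Fin n) :
    IsAlgebraic (Algebra.adjoin K (xq P '' {j | j ≤ k ∧ j ∉ Set.range lvs})) (xq P k) := by
  have := hP.prime
  induction k using WellFoundedLT.induction with
  | ind k ih =>
  by_cases hk : k ∈ Set.range lvs
  · obtain ⟨i, rfl⟩ := hk
    have h1 : IsAlgebraic (Algebra.adjoin K (xq P '' {j | j < lvs i})) (xq P (lvs i)) := by
      refine alg_of_rel P _ _ (T i) (hP.mem i) (degreeOf (lvs i) (T i)) ?_ ?_
      · rw [coeff_toUni_degreeOf]; exact hP.ini i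
      · intro j hj hd
        exact lt_of_le_of_ne ((hT.2 i).2 j (Nat.pos_of_ne_zero hd)) hj
    refine h1.adjoin_of_forall_isAlgebraic ?_
    rintro _ ⟨⟨j, hj, rfl⟩, -⟩
    refine alg_mono (S := {l | l ≤ j ∧ l ∉ Set.range lvs}) ?_ (ih j hj)
    intro l hl
    exact ⟨hl.1.trans (le_of_lt hj), hl.2⟩
  · have hmem : xq P k ∈ xq P '' {j | j ≤ k ∧ j ∉ Set.range lvs} := ⟨k, ⟨le_rfl, hk⟩, rfl⟩
    exact isAlgebraic_algebraMap (⟨xq P k, Algebra.subset_adjoin hmem⟩ :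
      Algebra.adjoin K (xq P '' {j | j ≤ k ∧ j ∉ Set.range lvs}))

lemma inParams_iff {p : MvPolynomial (Fin n) K} :
    inParams lvs p ↔ p ∈ supported K (Set.range lvs)ᶜ := by
  rw [mem_supported]; rfl

lemma algIndep (hP : Good T lvs P) :
    AlgebraicIndependent K (fun u : {j // j ∉ Set.range lvs} => xq P u.1) := by
  rw [algebraicIndependent_iff]
  intro p hp
  have h1 : aeval (fun u : {j // j ∉ Set.range lvs} => xq P u.1) p
      = Ideal.Quotient.mkₐ K P (rename Subtype.val p) := by
    have : aeval (fun u : {j // j ∉ Set.range lvs} => xq P u.1)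
      = (Ideal.Quotient.mkₐ K P).comp (rename Subtype.val) := by
      ext u
      simp [xq]
    rw [this]; rfl
  rw [h1] at hp
  have h2 := hP.par (rename Subtype.val p) ?_ (Ideal.Quotient.eq_zero_iff_mem.1 hp)
  · exact rename_injective _ Subtype.val_injective (by rw [h2, map_zero])
  · intro i hi
    classical
    have := vars_rename _ _ hi
    obtain ⟨u, -, rfl⟩ := Finset.mem_image.1 this
    exact u.2

lemma no_rel (hT : IsTriangular T lvs) (hP : Good T lvs P) (k : Fin n) (hk : k ∉ Set.range lvs)
    (g : MvPolynomial (Fin n) K) (hg : g ∈ P) (hv : ∀ j, degreeOf j g ≠ 0 → j ≤ k) (m : ℕ) :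
    (toUni k g).coeff m ∈ P := by
  have := hP.prime
  by_contra h
  have h1 := alg_of_rel P {j | j < k} k g hg m h fun j hj hd => lt_of_le_of_ne (hv j hd) hj
  have h2 : IsAlgebraic (Algebra.adjoin K (xq P '' {j | j < k ∧ j ∉ Set.range lvs})) (xq P k) := by
    refine h1.adjoin_of_forall_isAlgebraic ?_
    rintro _ ⟨⟨j, hj, rfl⟩, -⟩
    refine alg_mono (S := {l | l ≤ j ∧ l ∉ Set.range lvs}) ?_ (alg_params hT hP j)
    intro l hl
    exact ⟨lt_of_le_of_lt hl.1 hj, hl.2⟩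
  have h3 := (algIndep hP).transcendental_adjoin (s := {u | u.1 < k}) (i := ⟨k, hk⟩) (by simp)
  apply h3
  have h4 : (fun u : {j // j ∉ Set.range lvs} => xq P u.1) '' {u | u.1 < k}
      = xq P '' {j | j < k ∧ j ∉ Set.range lvs} := by
    ext b
    constructor
    · rintro ⟨u, hu, rfl⟩
      exact ⟨u.1, ⟨hu, u.2⟩, rfl⟩
    · rintro ⟨j, ⟨hj, hj'⟩, rfl⟩
      exact ⟨⟨j, hj'⟩, hj, rfl⟩
  rw [h4]
  exact h2

lemma range_eq : Set.range (fun u : {j // j ∉ Set.range lvs} => xq P u.1)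
    = xq P '' (Set.range lvs)ᶜ := by
  ext b
  constructor
  · rintro ⟨u, rfl⟩
    exact ⟨u.1, u.2, rfl⟩
  · rintro ⟨j, hj, rfl⟩
    exact ⟨⟨j, hj⟩, rfl⟩

lemma alg_all (hT : IsTriangular T lvs) (hP : Good T lvs P) (b : MvPolynomial (Fin n) K ⧸ P) :
    IsAlgebraic (Algebra.adjoin K (xq P '' (Set.range lvs)ᶜ)) b := by
  have := hP.prime
  obtain ⟨f, rfl⟩ := Ideal.Quotient.mk_surjective b
  induction f using MvPolynomial.induction_on with
  | C c => exact isAlgebraic_algebraMap (algebraMap K (Algebra.adjoin K (xq P '' (Set.range lvs)ᶜ)) c)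
  | add p q hp hq => rw [map_add]; exact hp.add hq
  | mul_X p i hp =>
    rw [map_mul]
    exact hp.mul (alg_mono (fun l hl => hl.2) (alg_params hT hP i))

lemma dim_eq (hT : IsTriangular T lvs) (hP : Good T lvs P) :
    ringKrullDim (MvPolynomial (Fin n) K ⧸ P) = Nat.card {j // j ∉ Set.range lvs} := by
  have := hP.prime
  have : Fintype {j // j ∉ Set.range lvs} := Fintype.ofFinite _
  rw [ringKrullDim_eq_card (K := K) (fun u : {j // j ∉ Set.range lvs} => xq P u.1),
    Nat.card_eq_fintype_card]
  rw [(algIndep hP).isTranscendenceBasis_iff_isAlgebraic, range_eq]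
  exact ⟨alg_all hT hP⟩

/-- minimality of a characteristic set -/
def IsMin (G : Fin r → MvPolynomial (Fin n) K) (lvs : Fin r → Fin n)
    (P : Ideal (MvPolynomial (Fin n) K)) : Prop :=
  ∀ i, ∀ g ∈ P, IsLeadingVar g (lvs i) → initial g (lvs i) ∉ P →
    degreeOf (lvs i) (G i) ≤ degreeOf (lvs i) g

lemma exists_min (hT : IsTriangular T lvs) (hP : Good T lvs P) :
    ∃ G : Fin r → MvPolynomial (Fin n) K, IsTriangular G lvs ∧ Good G lvs P ∧ IsMin G lvs P := by
  have key : ∀ i, ∃ g ∈ P, IsLeadingVar g (lvs i) ∧ initial g (lvs i) ∉ P ∧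
      ∀ g' ∈ P, IsLeadingVar g' (lvs i) → initial g' (lvs i) ∉ P →
        degreeOf (lvs i) g ≤ degreeOf (lvs i) g' := by
    intro i
    classical
    have hex : ∃ d, ∃ g ∈ P, IsLeadingVar g (lvs i) ∧ initial g (lvs i) ∉ P ∧
        degreeOf (lvs i) g = d := ⟨_, T i, hP.mem i, hT.2 i, hP.ini i, rfl⟩
    obtain ⟨g, hg, h1, h2, h3⟩ := Nat.find_spec hex
    refine ⟨g, hg, h1, h2, fun g' hg' h1' h2' => ?_⟩
    rw [h3]
    exact Nat.find_min' hex ⟨g', hg', h1', h2', rfl⟩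
  choose G h1 h2 h3 h4 using key
  exact ⟨G, ⟨hT.1, h2⟩, ⟨hP.prime, h1, h3, hP.par⟩, h4⟩

lemma reduced_zero (hT : IsTriangular T lvs) (hP : Good T lvs P) (hm : IsMin T lvs P) (k : ℕ) :
    ∀ g ∈ P, (∀ j : Fin n, degreeOf j g ≠ 0 → j.val < k) →
      (∀ i, degreeOf (lvs i) g < degreeOf (lvs i) (T i)) → g = 0 := by
  induction k with
  | zero =>
    intro g hg hv _
    refine hP.par g (fun i hi => ?_) hg
    exact absurd (hv i (mem_vars_iff_degreeOf_ne_zero.1 hi)) (by omega)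
  | succ k ih =>
    intro g hg hv hred
    by_cases hkn : n ≤ k
    · exact ih g hg (fun j _ => by omega) hred
    push Not at hkn
    set v : Fin n := ⟨k, hkn⟩ with hvdef
    suffices hco : ∀ m, (toUni v g).coeff m ∈ P by
      apply toUni_inj v
      ext1 m
      rw [Polynomial.coeff_zero]
      refine ih _ (hco m) (fun j hj => ?_) (fun i => ?_)
      · have hjv : j ≠ v := by
          rintro rfl
          exact hj (degreeOf_coeff_toUni_self _ _ _)
        have h1 := degreeOf_coeff_toUni v j g m
        have h2 := hv j (by omega)
        have h3 : j.val ≠ k := fun h => hjv (Fin.ext h)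
        omega
      · exact (degreeOf_coeff_toUni v _ g m).trans_lt (hred i)
    by_cases hvr : v ∈ Set.range lvs
    swap
    · exact no_rel hT hP v hvr g hg fun j hj => Nat.lt_succ_iff.1 (hv j hj)
    obtain ⟨i, hi⟩ := hvr
    by_contra! hne
    classical
    have hbd : ∀ m, (toUni v g).coeff m ∉ P → m ≤ degreeOf v g := by
      intro m hm'
      by_contra hlt
      refine hm' ?_
      rw [Polynomial.coeff_eq_zero_of_natDegree_lt (by rw [natDegree_toUni]; omega)]
      exact zero_mem _
    obtain ⟨m0, hm0⟩ := hne
    set m := Nat.findGreatest (fun m => (toUni v g).coeff m ∉ P) (degreeOf v g) with hmdef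
    have hmP : (toUni v g).coeff m ∉ P := Nat.findGreatest_spec (P := fun m => (toUni v g).coeff m ∉ P) (hbd m0 hm0) hm0
    have hgt : ∀ l, m < l → (toUni v g).coeff l ∈ P := by
      intro l hl
      by_contra hl'
      exact absurd (Nat.le_findGreatest (P := fun m => (toUni v g).coeff m ∉ P) (hbd l hl') hl') (by omega)
    set s : Polynomial (MvPolynomial (Fin n) K) :=
      ∑ l ∈ Finset.range (m + 1), Polynomial.monomial l ((toUni v g).coeff l) with hs
    have hsc : ∀ l, s.coeff l = if l ≤ m then (toUni v g).coeff l else 0 := by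
      intro l
      rw [hs, Polynomial.finsetSum_coeff]
      simp [Polynomial.coeff_monomial, Nat.lt_succ_iff]
    set g' := s.eval (X v) with hg'
    have hu : toUni v g' = s := by
      refine toUni_eval v s fun l => ?_
      rw [hsc]
      split_ifs
      · exact degreeOf_coeff_toUni_self _ _ _
      · simp
    have hg'P : g' ∈ P := by
      have hsub : g - g' ∈ P := by
        have : g - g' = (toUni v g - s).eval (X v) := by
          rw [Polynomial.eval_sub, eval_toUni]
        rw [this, Polynomial.eval_eq_sum_range]
        refine sum_mem fun l _ => Ideal.mul_mem_right _ _ ?_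
        rw [Polynomial.coeff_sub, hsc]
        split_ifs with h
        · simp
        · rw [sub_zero]; exact hgt l (by omega)
      have := sub_mem hg hsub
      simpa using this
    have hdeg : degreeOf v g' = m := by
      rw [← natDegree_toUni, hu]
      apply Polynomial.natDegree_eq_of_le_of_coeff_ne_zero
      · rw [Polynomial.natDegree_le_iff_coeff_eq_zero]
        intro l hl
        rw [hsc, if_neg (by omega)]
      · rw [hsc, if_pos le_rfl]
        intro h0
        exact hmP (h0 ▸ zero_mem _)
    have hini : initial g' v = (toUni v g).coeff m := by
      rw [← coeff_toUni_degreeOf, hdeg, hu, hsc, if_pos le_rfl]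
    have hmle : m ≤ degreeOf v g := hbd m hmP
    by_cases hm00 : m = 0
    · apply hmP
      have : g' = (toUni v g).coeff m := by
        rw [hg', hs, hm00]; simp
      rw [← this]; exact hg'P
    have hlead : IsLeadingVar g' (lvs i) := by
      rw [hi]
      refine ⟨by omega, fun j hj => ?_⟩
      by_cases hjv : j = v
      · exact hjv.le
      have : degreeOf j g' ≤ degreeOf j g := by
        refine degreeOf_eval_le v j hjv s _ fun l => ?_
        rw [hsc]
        split_ifs
        · exact degreeOf_coeff_toUni _ _ _ _
        · simp
      exact Nat.lt_succ_iff.1 (hv j (by omega))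
    have h1 := hm i g' hg'P hlead (by rw [hi, hini]; exact hmP)
    have h2 := hred i
    rw [hi] at h1 h2
    omega

lemma reduce (hT : IsTriangular T lvs) (hP : Good T lvs P) (hm : IsMin T lvs P) (i : ℕ) (hi : i ≤ r) :
    ∀ f ∈ P, (∀ j : Fin r, i ≤ j.val → degreeOf (lvs j) f < degreeOf (lvs j) (T j)) →
      ∃ d, prodLT T lvs i ^ d * f ∈ spanLT T i := by
  induction i with
  | zero =>
    intro f hf hred
    have := reduced_zero hT hP hm n f hf (fun j _ => j.2) (fun j => hred j (Nat.zero_le _))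
    exact ⟨0, by simp [this]⟩
  | succ i ih =>
    intro f hf hred
    obtain ⟨k, rfl⟩ : ∃ k : Fin r, k.val = i := ⟨⟨i, hi⟩, rfl⟩
    obtain ⟨d, q, g, hdiv, hdeg, hle⟩ := pseudo_div (lvs k) (T k) (hT.2 k).1 _ f (Nat.lt_succ_self _)
    have hgP : g ∈ P := by
      have : g = initial (T k) (lvs k) ^ d * f - q * T k := by rw [hdiv]; ring
      rw [this]
      exact sub_mem (Ideal.mul_mem_left _ _ hf) (Ideal.mul_mem_left _ _ (hP.mem k))
    obtain ⟨e, he⟩ := ih (by omega) g hgP (by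
      intro j hj
      rcases Nat.eq_or_lt_of_le hj with h | h
      · rw [← Fin.ext h]; exact hdeg
      · exact (hle _ (hT.degreeOf_eq_zero h)).trans_lt (hred j h))
    refine ⟨e + d, ?_⟩
    rw [prodLT_succ]
    set a := prodLT T lvs k.val
    set h := initial (T k) (lvs k)
    refine mem_spanLT_succ.2 ⟨a ^ (e + d) * h ^ e * q, ?_⟩
    have : (a * h) ^ (e + d) * f - a ^ (e + d) * h ^ e * q * T k = a ^ d * h ^ e * (a ^ e * g) := by
      have e1 : (a * h) ^ (e + d) * f = a ^ (e + d) * h ^ e * (h ^ d * f) := by ring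
      rw [e1, hdiv]; ring
    rw [this]
    exact Ideal.mul_mem_left _ _ he

lemma sat_eq (hT : IsTriangular T lvs) (hP : Good T lvs P) (hm : IsMin T lvs P) :
    satIdeal T lvs = P := by
  have := hP.prime
  apply le_antisymm
  · rintro f ⟨d, hd⟩
    have h1 : initProd T lvs ^ d * f ∈ P :=
      (Ideal.span_le.2 (by rintro _ ⟨j, rfl⟩; exact hP.mem j)) hd
    refine (this.mem_or_mem h1).resolve_left fun h2 => ?_
    have h3 := this.mem_of_pow_mem _ h2
    rw [initProd, Ideal.IsPrime.prod_mem_iff] at h3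
    obtain ⟨j, -, hj⟩ := h3
    exact hP.ini j hj
  · intro f hf
    obtain ⟨d, hd⟩ := reduce hT hP hm r le_rfl f hf (fun j hj => by omega)
    rw [prodLT_top, spanLT_top] at hd
    exact ⟨d, hd⟩

lemma isRegular (hT : IsTriangular T lvs) (hP : Good T lvs P) (hm : IsMin T lvs P) :
    IsRegular T lvs := by
  have hprime := hP.prime
  refine ⟨hT, fun i => ?_⟩
  induction i using WellFoundedLT.induction with
  | ind i ih =>
  set h := initial (T i) (lvs i) with hh
  have hspan : Ideal.span (T '' {j | j < i} ∪ {h}) = spanLT T i.val ⊔ Ideal.span {h} := by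
    rw [Ideal.span_union]; rfl
  -- the algebraic relation
  set S : Set (Fin n) := {v | ∀ j, i ≤ j → v ≠ lvs j} with hS
  have hSdeg : ∀ w ∈ supported K S, ∀ j, i ≤ j → degreeOf (lvs j) w = 0 := by
    intro w hw j hj
    by_contra h0
    exact mem_supported.1 hw (mem_vars_iff_degreeOf_ne_zero.2 h0) j hj rfl
  have hhS : h ∈ supported K S := by
    rw [mem_supported]
    rintro v hv j hj rfl
    have h0 := mem_vars_iff_degreeOf_ne_zero.1 hv
    rcases eq_or_lt_of_le hj with rfl | hlt
    · exact h0 (degreeOf_initial_self _ _)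
    · have := degreeOf_initial_le (lvs i) (lvs j) (T i)
      rw [hT.degreeOf_eq_zero hlt] at this
      exact h0 (Nat.le_zero.1 this)
  have hparS : supported K (Set.range lvs)ᶜ ≤ supported K S := by
    apply supported_mono
    rintro v hv j _ rfl
    exact hv ⟨j, rfl⟩
  have hne : Ideal.Quotient.mk P h ≠ 0 := fun h0 => hP.ini i (Ideal.Quotient.eq_zero_iff_mem.1 h0)
  obtain ⟨t, ht, c, hc, htc⟩ := (alg_all hT hP (Ideal.Quotient.mk P h)).exists_nonzero_eq_adjoin_mul
    (mem_nonZeroDivisors_of_ne_zero hne)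
  have hlift : ∃ w ∈ supported K S, Ideal.Quotient.mk P w = t := by
    clear htc
    induction ht using Algebra.adjoin_induction with
    | mem b hb =>
      rw [Set.mem_singleton_iff] at hb
      exact ⟨h, hhS, hb.symm⟩
    | algebraMap b =>
      obtain ⟨b, hb⟩ := b
      rw [← map_supported] at hb
      obtain ⟨w, hw, rfl⟩ := hb
      exact ⟨w, hparS hw, rfl⟩
    | add a b _ _ ha hb =>
      obtain ⟨w, hw, rfl⟩ := ha
      obtain ⟨w', hw', rfl⟩ := hb
      exact ⟨w + w', add_mem hw hw', map_add _ _ _⟩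
    | mul a b _ _ ha hb =>
      obtain ⟨w, hw, rfl⟩ := ha
      obtain ⟨w', hw', rfl⟩ := hb
      exact ⟨w * w', mul_mem hw hw', map_mul _ _ _⟩
  obtain ⟨w, hw, rfl⟩ := hlift
  obtain ⟨c, hcm⟩ := c
  have hcm' := hcm
  rw [← map_supported] at hcm'
  obtain ⟨c', hc', rfl⟩ := hcm'
  have hc0 : c' ≠ 0 := by
    rintro rfl
    exact hc (Subtype.ext (map_zero _))
  have hFP : h * w - c' ∈ P := by
    rw [← Ideal.Quotient.eq_zero_iff_mem, map_sub, map_mul, htc]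
    exact sub_self _
  have hFS : h * w - c' ∈ supported K S := sub_mem (mul_mem hhS hw) (hparS hc')
  obtain ⟨d, hd⟩ := reduce hT hP hm i.val i.2.le _ hFP (fun j hj => by
    rw [hSdeg _ hFS j hj]; exact (hT.2 j).1)
  -- product of the previous parameter polynomials
  choose! p hp1 hp2 hp3 using ih
  set π := ∏ j ∈ Finset.univ.filter (fun j : Fin r => j.val < i.val), p j with hπ
  have hπ0 : π ≠ 0 := Finset.prod_ne_zero_iff.2 fun j hj => hp2 j (by simpa using hj)
  have hπS : π ∈ supported K (Set.range lvs)ᶜ :=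
    prod_mem fun j hj => inParams_iff.1 (hp3 j (by simpa using hj))
  have hdvd : Ideal.Quotient.mk (spanLT T i.val) (prodLT T lvs i.val) ∣
      Ideal.Quotient.mk (spanLT T i.val) π := by
    rw [prodLT, hπ, map_prod, map_prod]
    refine Finset.prod_dvd_prod_of_dvd _ _ fun j hj => ?_
    have hji : j < i := by simpa using hj
    have := hp1 j hji
    rw [Ideal.span_union, Submodule.mem_sup] at this
    obtain ⟨a, ha, b, hb, hab⟩ := this
    obtain ⟨q, rfl⟩ := Ideal.mem_span_singleton'.1 hb
    have ha' : a ∈ spanLT T i.val :=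
      Ideal.span_mono (Set.image_mono fun l (hl : l < j) => (hl.trans hji : l.val < i.val)) ha
    refine ⟨Ideal.Quotient.mk _ q, ?_⟩
    rw [← hab, map_add, Ideal.Quotient.eq_zero_iff_mem.2 ha', zero_add, map_mul, mul_comm]
  have hmem : π ^ d * (h * w - c') ∈ spanLT T i.val := by
    obtain ⟨z, hz⟩ := hdvd
    rw [← Ideal.Quotient.eq_zero_iff_mem, map_mul, map_pow, hz, mul_pow, mul_right_comm, ← map_pow,
      ← map_mul, Ideal.Quotient.eq_zero_iff_mem.2 hd, zero_mul]
  refine ⟨π ^ d * c', ?_, mul_ne_zero (pow_ne_zero _ hπ0) hc0,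
    inParams_iff.2 (mul_mem (pow_mem hπS d) hc')⟩
  rw [hspan]
  have : π ^ d * c' = -(π ^ d * (h * w - c')) + π ^ d * w * h := by ring
  rw [this]
  exact add_mem (Ideal.mem_sup_left (neg_mem hmem))
    (Ideal.mem_sup_right (Ideal.mul_mem_left _ _ (Ideal.mem_span_singleton_self h)))
end prime
end Tri

open Tri in
/-- For a triangular set `T` in `K[x_1,…,x_n]`, the radical of `sat(T)` is a finite
intersection of ideals `sat(T_i)` where each `T_i` is a regular triangular set with the
same parameter set as `T` and each `sat(T_i)` is prime; in particular `sat(T)` is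
unmixed. -/
theorem radical_satIdeal_eq_iInf_and_unmixed
    {K : Type*} [Field K] [CharZero K] {n r : ℕ}
    (T : Fin r → MvPolynomial (Fin n) K) (lvs : Fin r → Fin n)
    (hT : IsTriangular T lvs) :
    (∃ (t : ℕ) (G : Fin t → Fin r → MvPolynomial (Fin n) K),
      (∀ i, IsRegular (G i) lvs) ∧
      (∀ i, (satIdeal (G i) lvs).IsPrime) ∧
      (satIdeal T lvs).radical = ⨅ i, satIdeal (G i) lvs) ∧
    IsUnmixed (satIdeal T lvs) := by
  have hass : ∀ P ∈ (satIdeal T lvs).minimalPrimes, Good T lvs P := by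
    intro P hP
    refine good_of_assoc hT P ?_
    apply Module.associatedPrimes.minimalPrimes_annihilator_subset_associatedPrimes
    rwa [Ideal.annihilator_quotient]
  refine ⟨?_, fun p hp q hq => by
    rw [dim_eq hT (good_of_assoc hT p hp), dim_eq hT (good_of_assoc hT q hq)]⟩
  have hfin : Finite (satIdeal T lvs).minimalPrimes :=
    (Ideal.finite_minimalPrimes_of_isNoetherianRing _ _).to_subtype
  have key : ∀ P : (satIdeal T lvs).minimalPrimes, ∃ G : Fin r → MvPolynomial (Fin n) K,
      IsRegular G lvs ∧ satIdeal G lvs = P.1 := by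
    intro P
    obtain ⟨G, h1, h2, h3⟩ := exists_min hT (hass P.1 P.2)
    exact ⟨G, isRegular h1 h2 h3, sat_eq h1 h2 h3⟩
  choose G hG1 hG2 using key
  let e := Finite.equivFin (satIdeal T lvs).minimalPrimes
  refine ⟨_, fun i => G (e.symm i), fun i => hG1 _, fun i => ?_, ?_⟩
  · rw [hG2]; exact (hass _ (e.symm i).2).prime
  · simp only [hG2]
    rw [← Ideal.sInf_minimalPrimes, sInf_eq_iInf']
    exact (e.symm.iInf_comp (g := fun P : (satIdeal T lvs).minimalPrimes => P.1)).symm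
end

section
/- Let g_0,...,g_m be homogeneous polynomials in Y, Y_0, Y_1 over a field of characteristic 0 having only finitely many common projective zeros, let g_{m} be the generic linear form Y_0U_0 + YU + Y_1U_1 in new indeterminates U_0,U,U_1, let γ_i = deg g_i with γ_0 ≥ γ_1 ≥ ... ≥ γ_m, set D = γ_0 + Σ_{1 ≤ l ≤ min{2,m−1}} (γ_l − 1), and let A be the Macaulay matrix of the map (f_0,...,f_m) ↦ f_0g_0 + ... + f_mg_m from homogeneous forms of degrees D−γ_l to forms of degree D. Then the rank of A is C(D+2,2), and for any nonsingular C(D+2,2)×C(D+2,2) submatrix Δ of A containing rank(A^{(num)}) columns from the submatrix A^{(num)} whose entries do not involve U,U_0,U_1, one has det(Δ) = c·∏_{i=1}^{D_1} (ξ_{i,0}U_0 + ξ_iU + ξ_{i,1}U_1) where c is a constant, each (ξ_{i,0}:ξ_i:ξ_{i,1}) is a common projective zero of g_0,...,g_{m−1}, and the number of occurrences of each linear factor equals the multiplicity of the corresponding solution. -/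
namespace Macaulay

/-- The ring `K[U, U_0, U_1]` of polynomials in the three generic coefficients. -/
abbrev UR (K : Type*) [CommSemiring K] := MvPolynomial (Fin 3) K

/-- The ring `K[U, U_0, U_1][Y, Y_0, Y_1]`. -/
abbrev YR (K : Type*) [CommSemiring K] := MvPolynomial (Fin 3) (UR K)

/-- The monomials of degree `D` in three variables. -/
abbrev Mon (D : ℕ) := {v : Fin 3 → Fin (D + 1) // (v 0 : ℕ) + (v 1 : ℕ) + (v 2 : ℕ) = D}

/-- The exponent vector of a monomial. -/
noncomputable def toExp {D : ℕ} (v : Fin 3 → Fin (D + 1)) : Fin 3 →₀ ℕ :=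
  Finsupp.equivFunOnFinite.symm fun t => (v t : ℕ)

/-- The system `g_0, …, g_{m-1}, g_m` over `K[U, U_0, U_1]`, where `g_0, …, g_{m-1}` have
coefficients in `K` and `g_m = Y·U + Y_0·U_0 + Y_1·U_1` is the generic linear form. -/
noncomputable def bigG {K : Type*} [CommSemiring K] (m : ℕ) (g : Fin m → MvPolynomial (Fin 3) K) :
    Fin (m + 1) → YR K := fun i =>
  if h : (i : ℕ) < m then MvPolynomial.map MvPolynomial.C (g ⟨i, h⟩)
  else ∑ t : Fin 3, MvPolynomial.C (MvPolynomial.X t) * MvPolynomial.X t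

/-- The Macaulay matrix of the map `(f_0, …, f_m) ↦ f_0 g_0 + ⋯ + f_m g_m` in the
monomial bases: rows are indexed by the monomials of degree `D`, columns by pairs of an
index `l` and a monomial of degree `D - γ_l`, and the entry is the corresponding
coefficient of (column monomial)·`g_l`. -/
noncomputable def macaulayMatrix {K : Type*} [CommRing K] (m : ℕ)
    (g : Fin m → MvPolynomial (Fin 3) K) (γ : ℕ → ℕ) (D : ℕ) :
    Matrix (Mon D) (Σ l : Fin (m + 1), Mon (D - γ (l : ℕ))) (UR K) :=
  fun ν c =>
    MvPolynomial.coeff (toExp ν.1)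
      (MvPolynomial.monomial (toExp c.2.1) (1 : UR K) * bigG m g c.1)

/-- Count of the elements of a multiset satisfying a (not necessarily decidable)
predicate. -/
noncomputable def mcountP {α : Type*} (p : α → Prop) (s : Multiset α) : ℕ := by
  classical exact s.countP p

/-- The multiplicity of a projective point `ξ` as a zero of the homogeneous system
generating `J`: dehomogenize with respect to a coordinate which is nonzero at `ξ` and take
the colength of the resulting ideal localized at the point, computed as the stable value
of `dim_E E[Y,Y_0,Y_1]/(J' + 𝔪^N)` where `𝔪` is the maximal ideal of the (normalized)
point. -/
noncomputable def projMult (E : Type*) [Field E] (J : Ideal (MvPolynomial (Fin 3) E))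
    (ξ : Fin 3 → E) : ℕ := by
  classical
  exact if h : ∃ j, ξ j ≠ 0 then
    let j := h.choose
    let a : Fin 3 → E := fun t => ξ t / ξ j
    let dh : MvPolynomial (Fin 3) E →ₐ[E] MvPolynomial (Fin 3) E :=
      MvPolynomial.aeval fun t => if t = j then 1 else MvPolynomial.X t
    let J' : Ideal (MvPolynomial (Fin 3) E) :=
      Ideal.map dh J ⊔ Ideal.span {MvPolynomial.X j - MvPolynomial.C 1}
    let mI : Ideal (MvPolynomial (Fin 3) E) :=
      Ideal.span (Set.range fun t => MvPolynomial.X t - MvPolynomial.C (a t))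
    ⨆ N : ℕ, Module.finrank E (MvPolynomial (Fin 3) E ⧸ (J' ⊔ mI ^ N))
  else 0

end Macaulay

namespace MacAux
open MvPolynomial

lemma hom_scale {σ E B : Type*} [CommRing E] [CommRing B] [Algebra E B]
    (f : MvPolynomial σ E) (n : ℕ) (hf : f.IsHomogeneous n) (c : B) (x : σ → B) :
    aeval (fun i => c * x i) f = c ^ n * aeval x f := by
  rw [f.as_sum]
  simp only [map_sum, Finset.mul_sum, aeval_monomial]
  refine Finset.sum_congr rfl fun d hd => ?_
  have h := hf.degree_eq_sum_deg_support hd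
  rw [Finsupp.prod, Finsupp.prod, h]
  simp only [mul_pow, Finset.prod_mul_distrib, Finset.prod_pow_eq_pow_sum]
  ring

section binary
variable {E : Type*} [Field E]

/-- dehomogenization of a binary form -/
noncomputable def dh (p : MvPolynomial (Fin 2) E) : Polynomial E :=
  aeval ![Polynomial.X, 1] p

lemma dh_natDegree (p : MvPolynomial (Fin 2) E) (a : ℕ) (hp : p.IsHomogeneous a) :
    (dh p).natDegree ≤ a := by
  unfold dh
  rw [p.as_sum, map_sum]
  refine Polynomial.natDegree_sum_le_of_forall_le _ _ fun d hd => ?_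
  have h := hp.degree_eq_sum_deg_support hd
  rw [aeval_monomial]
  have h0 : d 0 ≤ a := by
    rw [h]
    by_cases hh : 0 ∈ d.support
    · exact Finset.single_le_sum (f := fun i => d i) (fun _ _ => Nat.zero_le _) hh
    · simp at hh; simp [hh]
  have : (d.prod fun i k => (![Polynomial.X, 1] : Fin 2 → Polynomial E) i ^ k) = Polynomial.X ^ d 0 := by
    rw [Finsupp.prod_fintype]
    · simp [Fin.prod_univ_two]
    · simp
  rw [this, ← Polynomial.C_eq_algebraMap]
  exact (Polynomial.natDegree_C_mul_X_pow_le _ _).trans h0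

lemma dh_hom (p : MvPolynomial (Fin 2) E) (a : ℕ) (hp : p.IsHomogeneous a) :
    (dh p).homogenize a = p := Polynomial.homogenize_eq_of_isHomogeneous hp rfl

lemma eval_dh (p : MvPolynomial (Fin 2) E) (r : E) :
    (dh p).eval r = eval ![r, 1] p := by
  unfold dh
  rw [← Polynomial.coe_aeval_eq_eval, ← AlgHom.comp_apply, ← MvPolynomial.coe_aeval_eq_eval]
  change _ = MvPolynomial.aeval (R := E) _ p
  congr 1
  ext i
  fin_cases i <;> simp

lemma eval_one_zero (p : MvPolynomial (Fin 2) E) (a : ℕ) (hp : p.IsHomogeneous a) :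
    eval ![1, 0] p = (dh p).coeff a := by
  conv_lhs => rw [← dh_hom p a hp]
  have key : ∀ P : Polynomial E, eval ![1, 0] (P.homogenize a) = P.coeff a := by
    intro P
    rw [Polynomial.homogenize, map_sum]
    rw [Finset.sum_eq_single (a, 0)]
    · rw [eval_monomial, Finsupp.prod_fintype]
      · simp [Fin.prod_univ_two]
      · simp
    · rintro ⟨k, l⟩ hkl hne
      rw [eval_monomial, Finsupp.prod_fintype]
      · have : l ≠ 0 := by
          rintro rfl
          simp at hkl
          exact hne (by simp [hkl])
        simp [Fin.prod_univ_two, this]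
      · simp
    · intro h
      simp at h
  exact key _

/-- every zero of a binary form is proportional to `(1,0)` or `(r,1)` -/
lemma zero_cases (w : Fin 2 → E) :
    (w = w 0 • ![1, 0]) ∨ (w 1 ≠ 0 ∧ w = w 1 • ![w 0 / w 1, 1]) := by
  by_cases h : w 1 = 0
  · left
    ext i; fin_cases i <;> simp [h]
  · right
    refine ⟨h, ?_⟩
    ext i; fin_cases i <;> simp; field_simp

lemma eval_smul (p : MvPolynomial (Fin 2) E) (a : ℕ) (hp : p.IsHomogeneous a) (c : E)
    (w : Fin 2 → E) : eval (c • w) p = c ^ a * eval w p := by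
  have := hom_scale p a hp c w
  change eval (fun i => c * w i) p = _
  simpa [aeval_eq_eval] using this

lemma binary_zero [IsAlgClosed E] (p : MvPolynomial (Fin 2) E) (a : ℕ) (ha : 1 ≤ a)
    (hp : p.IsHomogeneous a) : ∃ w : Fin 2 → E, w ≠ 0 ∧ eval w p = 0 := by
  by_cases h : eval ![1, 0] p = 0
  · exact ⟨![1, 0], fun h => by simpa using congrFun h 0, h⟩
  · rw [eval_one_zero p a hp] at h
    have hd : (dh p).degree ≠ 0 := by
      have := Polynomial.le_degree_of_ne_zero h
      intro h0
      rw [h0] at this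
      have := Nat.cast_le.mp (show ((a : ℕ) : WithBot ℕ) ≤ (0 : ℕ) from this)
      omega
    obtain ⟨r, hr⟩ := IsAlgClosed.exists_root (dh p) hd
    refine ⟨![r, 1], fun h => by simpa using congrFun h 1, ?_⟩
    rw [← eval_dh]; exact hr

lemma finite_zeros (p : MvPolynomial (Fin 2) E) (a : ℕ) (hp : p.IsHomogeneous a) (h0 : p ≠ 0) :
    ∃ Z : Finset (Fin 2 → E), (∀ w ∈ Z, w ≠ 0) ∧
      ∀ w, w ≠ 0 → eval w p = 0 → ∃ v ∈ Z, ∃ c : E, c ≠ 0 ∧ w = c • v := by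
  classical
  refine ⟨insert ![1, 0] ((dh p).roots.toFinset.image fun r => ![r, 1]), ?_, ?_⟩
  · intro w hw
    rw [Finset.mem_insert, Finset.mem_image] at hw
    rcases hw with rfl | ⟨r, _, rfl⟩
    · exact fun h => by simpa using congrFun h 0
    · exact fun h => by simpa using congrFun h 1
  · intro w hw0 hw
    rcases zero_cases w with h | ⟨h1, h⟩
    · refine ⟨![1, 0], by simp, w 0, ?_, h⟩
      intro h'; rw [h', zero_smul] at h; exact hw0 h
    · refine ⟨![w 0 / w 1, 1], ?_, w 1, h1, h⟩
      rw [Finset.mem_insert, Finset.mem_image]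
      right
      refine ⟨w 0 / w 1, ?_, rfl⟩
      rw [Multiset.mem_toFinset, Polynomial.mem_roots]
      · rw [Polynomial.IsRoot, eval_dh]
        rw [h, eval_smul p a hp] at hw
        exact (mul_eq_zero.mp hw).resolve_left (pow_ne_zero _ h1)
      · intro hd
        apply h0
        rw [← dh_hom p a hp, hd]; simp

lemma binary_span_aux [IsAlgClosed E] (p q : MvPolynomial (Fin 2) E) (a b : ℕ)
    (hp : p.IsHomogeneous a) (hq : q.IsHomogeneous b)
    (hpq : ∀ w : Fin 2 → E, w ≠ 0 → eval w p = 0 → eval w q ≠ 0)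
    (h1 : eval ![1, 0] p ≠ 0) (ha : 1 ≤ a)
    (d : ℕ) (hd : a + b ≤ d + 1) (f : MvPolynomial (Fin 2) E) (hf : f.IsHomogeneous d) :
    f ∈ Ideal.span {p, q} := by
  have hc : IsCoprime (dh p) (dh q) := by
    rw [Polynomial.isCoprime_iff_aeval_ne_zero_of_isAlgClosed (k := E) (K := E)]
    intro r
    simp only [Polynomial.coe_aeval_eq_eval, eval_dh]
    by_contra! h
    exact hpq ![r, 1] (fun h => by simpa using congrFun h 1) h.1 h.2
  rw [eval_one_zero p a hp] at h1
  have hP0 : dh p ≠ 0 := by intro h; rw [h] at h1; simp at h1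
  have hda : (dh p).natDegree = a :=
    le_antisymm (dh_natDegree p a hp) (Polynomial.le_natDegree_of_ne_zero h1)
  obtain ⟨u, v, huv⟩ := hc
  -- F = F u P + F v Q ; reduce (F v) mod P
  set F := dh f with hF
  set V := (F * v) % dh p with hV
  set U := F * u + (F * v) / dh p * dh q with hU
  have hdm := EuclideanDomain.div_add_mod (F * v) (dh p)
  have hsum : U * dh p + V * dh q = F := by
    have : F = F * (u * dh p + v * dh q) := by rw [huv, mul_one]
    conv_rhs => rw [this]
    rw [hU, hV]
    linear_combination (dh q) * hdm
  have hVd : V.natDegree + 1 ≤ a := by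
    by_cases hV0 : V = 0
    · rw [hV0]; simpa using ha
    · have := Polynomial.natDegree_lt_natDegree hV0 (EuclideanDomain.mod_lt (F * v) hP0)
      rw [hda] at this
      exact this
  have hVQ : (V * dh q).natDegree ≤ d := by
    refine Polynomial.natDegree_mul_le.trans ?_
    have := dh_natDegree q b hq
    omega
  have hUP : (U * dh p).natDegree ≤ d := by
    have : U * dh p = F - V * dh q := by rw [← hsum]; ring
    rw [this]
    refine (Polynomial.natDegree_sub_le _ _).trans (max_le (dh_natDegree f d hf) hVQ)
  have hfd : f = Polynomial.homogenize (U * dh p) d + Polynomial.homogenize (V * dh q) d := by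
    rw [← Polynomial.homogenize_add, hsum, dh_hom f d hf]
  have h2 : Polynomial.homogenize (V * dh q) d = Polynomial.homogenize V (d - b) * q := by
    have : d = (d - b) + b := by omega
    conv_lhs => rw [this]
    rw [Polynomial.homogenize_mul _ _ (by omega) (dh_natDegree q b hq), dh_hom q b hq]
  have h3 : ∃ r, Polynomial.homogenize (U * dh p) d = r * p := by
    by_cases hU0 : U = 0
    · exact ⟨0, by simp [hU0]⟩
    · rw [Polynomial.natDegree_mul hU0 hP0, hda] at hUP
      have : d = (d - a) + a := by omega
      refine ⟨Polynomial.homogenize U (d - a), ?_⟩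
      conv_lhs => rw [this]
      rw [Polynomial.homogenize_mul _ _ (by omega) (dh_natDegree p a hp), dh_hom p a hp]
  obtain ⟨r, hr⟩ := h3
  rw [hfd, hr, h2, Ideal.mem_span_pair]
  exact ⟨_, _, rfl⟩

lemma binary_span [IsAlgClosed E] (p q : MvPolynomial (Fin 2) E) (a b : ℕ)
    (hp : p.IsHomogeneous a) (hq : q.IsHomogeneous b)
    (hpq : ∀ w : Fin 2 → E, w ≠ 0 → eval w p = 0 → eval w q ≠ 0)
    (ha : 1 ≤ a) (hb : 1 ≤ b)
    (d : ℕ) (hd : a + b ≤ d + 1) (f : MvPolynomial (Fin 2) E) (hf : f.IsHomogeneous d) :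
    f ∈ Ideal.span {p, q} := by
  by_cases h : eval ![1, 0] p = 0
  · rw [Set.pair_comm]
    refine binary_span_aux q p b a hq hp (fun w hw h1 h2 => hpq w hw h2 h1) ?_ hb d (by omega) f hf
    exact hpq _ (fun h => by simpa using congrFun h 0) h
  · exact binary_span_aux p q a b hp hq hpq h ha d hd f hf

lemma binary_relPrime [IsAlgClosed E] (p q : MvPolynomial (Fin 2) E) (a b : ℕ)
    (hp : p.IsHomogeneous a) (hq : q.IsHomogeneous b)
    (hpq : ∀ w : Fin 2 → E, w ≠ 0 → eval w p = 0 → eval w q ≠ 0)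
    (ha : 1 ≤ a) (hb : 1 ≤ b) : IsRelPrime p q := by
  intro c hcp hcq
  have key : ∀ i, c ∣ X i ^ (a + b) := by
    intro i
    have := binary_span p q a b hp hq hpq ha hb (a + b) (by omega) (X i ^ (a + b))
      (isHomogeneous_X_pow i _)
    rw [Ideal.mem_span_pair] at this
    obtain ⟨r, s, h⟩ := this
    rw [← h]
    exact dvd_add (hcp.mul_left _) (hcq.mul_left _)
  have hrel : IsRelPrime (X 0 : MvPolynomial (Fin 2) E) (X 1) := by
    refine ((MvPolynomial.X_prime (i := 0)).irreducible.isRelPrime_iff_not_dvd).mpr ?_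
    rw [MvPolynomial.X_dvd_X]
    simp
  exact (hrel.pow (m := a + b) (n := a + b)) (key 0) (key 1)

end binary
end MacAux


namespace MacAux
open MvPolynomial

section core
variable {E : Type*} [Field E]

noncomputable def lin (u : Fin 3 → E) : MvPolynomial (Fin 3) E := ∑ t, C (u t) * X t

lemma lin_hom (u : Fin 3 → E) : (lin u).IsHomogeneous 1 :=
  IsHomogeneous.sum _ _ _ fun t _ => isHomogeneous_C_mul_X (u t) t

noncomputable def piL (u : Fin 3 → E) : MvPolynomial (Fin 3) E →ₐ[E] MvPolynomial (Fin 2) E :=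
  aeval ![-(C (u 1 / u 0) * X 0 + C (u 2 / u 0) * X 1), X 0, X 1]

noncomputable def iot : MvPolynomial (Fin 2) E →ₐ[E] MvPolynomial (Fin 3) E :=
  aeval ![X 1, X 2]

lemma piL_iot (u : Fin 3 → E) (f) : piL u (iot f) = f := by
  rw [← AlgHom.comp_apply]
  have : (piL u).comp iot = AlgHom.id E _ := by
    ext i
    fin_cases i <;> simp [piL, iot]
  rw [this]; rfl

lemma piL_lin (u : Fin 3 → E) (hu : u 0 ≠ 0) : piL u (lin u) = 0 := by
  simp only [lin, piL, Fin.sum_univ_three, map_add, map_mul, aeval_X, algHom_C,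
    MvPolynomial.algebraMap_eq]
  simp only [Matrix.cons_val]
  have h1 : u 0 * (u 1 / u 0) = u 1 := by field_simp
  have h2 : u 0 * (u 2 / u 0) = u 2 := by field_simp
  have h1 : (C (u 0) * C (u 1 / u 0) : MvPolynomial (Fin 2) E) = C (u 1) := by rw [← C_mul, h1]
  have h2 : (C (u 0) * C (u 2 / u 0) : MvPolynomial (Fin 2) E) = C (u 2) := by rw [← C_mul, h2]
  linear_combination (- X 0) * h1 - X 1 * h2

lemma iot_piL (u : Fin 3 → E) (hu : u 0 ≠ 0) (f) :
    f - iot (piL u f) ∈ Ideal.span {lin u} := by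
  rw [← Ideal.Quotient.eq]
  have : (Ideal.Quotient.mkₐ E (Ideal.span {lin u})) =
      (Ideal.Quotient.mkₐ E (Ideal.span {lin u})).comp (iot.comp (piL u)) := by
    apply MvPolynomial.algHom_ext
    intro i
    rw [AlgHom.comp_apply, AlgHom.comp_apply, Ideal.Quotient.mkₐ_eq_mk, Ideal.Quotient.eq]
    fin_cases i
    · rw [Ideal.mem_span_singleton]
      refine ⟨C (u 0)⁻¹, ?_⟩
      simp [lin, piL, iot, Fin.sum_univ_three, -map_inv₀]
      have h0 : (C (u 0)⁻¹ * C (u 0) : MvPolynomial (Fin 3) E) = 1 := by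
        rw [← C_mul, inv_mul_cancel₀ hu, C_1]
      have h1 : (C (u 1 / u 0) : MvPolynomial (Fin 3) E) = C (u 0)⁻¹ * C (u 1) := by
        rw [← C_mul]; congr 1; field_simp
      have h2 : (C (u 2 / u 0) : MvPolynomial (Fin 3) E) = C (u 0)⁻¹ * C (u 2) := by
        rw [← C_mul]; congr 1; field_simp
      rw [h1, h2]
      linear_combination (- X 0) * h0
    · simp [piL, iot]
    · simp [piL, iot]
  exact congrArg (fun φ => φ f) this

lemma mem_of_piL (u : Fin 3 → E) (hu : u 0 ≠ 0) (f) (h : piL u f = 0) : ∃ q, f = lin u * q := by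
  have := iot_piL u hu f
  rw [h, map_zero, sub_zero, Ideal.mem_span_singleton] at this
  exact this

lemma piL_hom (u : Fin 3 → E) (f) (n : ℕ) (h : f.IsHomogeneous n) : (piL u f).IsHomogeneous n := by
  have := h.aeval (S := E) (τ := Fin 2) (n := 1) ![-(C (u 1 / u 0) * X 0 + C (u 2 / u 0) * X 1), X 0, X 1] (by
    intro i
    fin_cases i
    · exact ((isHomogeneous_C_mul_X _ _).add (isHomogeneous_C_mul_X _ _)).neg
    · exact isHomogeneous_X _ _
    · exact isHomogeneous_X _ _)
  rw [one_mul] at this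
  unfold piL
  exact this

lemma eval_piL (u : Fin 3 → E) (f) (w : Fin 2 → E) : eval w (piL u f) =
    eval ![-(u 1 / u 0 * w 0 + u 2 / u 0 * w 1), w 0, w 1] f := by
  rw [← MvPolynomial.coe_aeval_eq_eval, ← MvPolynomial.coe_aeval_eq_eval]
  change (MvPolynomial.aeval (R := E) w) _ = MvPolynomial.aeval (R := E) _ _
  rw [← AlgHom.comp_apply]
  congr 1
  ext i
  fin_cases i <;> simp [piL]

lemma homComp_mul_right (a b : MvPolynomial (Fin 3) E) (i n : ℕ) (hb : b.IsHomogeneous i) :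
    homogeneousComponent n (a * b) = if i ≤ n then homogeneousComponent (n - i) a * b else 0 := by
  let := MvPolynomial.gradedAlgebra (σ := Fin 3) (R := E)
  have := DirectSum.coe_decompose_mul_of_right_mem (homogeneousSubmodule (Fin 3) E) (a := a) n hb
  have e : ∀ (x : MvPolynomial (Fin 3) E) (n : ℕ),
      ((DirectSum.decompose (homogeneousSubmodule (Fin 3) E) x n : _) : MvPolynomial (Fin 3) E) =
        homogeneousComponent n x := decomposition.decompose'_apply
  rw [e, e] at this
  exact this

lemma homog_repr {m : ℕ} (g : Fin m → MvPolynomial (Fin 3) E) (γ : Fin m → ℕ)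
    (hg : ∀ i, (g i).IsHomogeneous (γ i)) (f) (n : ℕ) (hf : f.IsHomogeneous n)
    (hI : f ∈ Ideal.span (Set.range g)) :
    ∃ a : Fin m → MvPolynomial (Fin 3) E, f = ∑ i, a i * g i ∧
      (∀ i, γ i ≤ n → (a i).IsHomogeneous (n - γ i)) ∧ ∀ i, ¬ γ i ≤ n → a i = 0 := by
  rw [Ideal.mem_span_range_iff_exists_fun] at hI
  obtain ⟨c, hc⟩ := hI
  refine ⟨fun i => if γ i ≤ n then homogeneousComponent (n - γ i) (c i) else 0, ?_, ?_, ?_⟩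
  · rw [← homogeneousComponent_eq_self hf]
    conv_lhs => rw [← hc, map_sum]
    refine Finset.sum_congr rfl fun i _ => ?_
    rw [homComp_mul_right _ _ _ _ (hg i)]
    simp only [ite_mul, zero_mul]
  · intro i hi
    simp only [hi, if_true]
    exact homogeneousComponent_isHomogeneous _ _
  · intro i hi
    simp [hi]

variable [IsAlgClosed E]

/-- `(h₀, h₁, L)` fill all large degrees. -/
lemma core_a (u : Fin 3 → E) (hu : u 0 ≠ 0) (h0 h1 : MvPolynomial (Fin 3) E) (a b : ℕ)
    (H0 : h0.IsHomogeneous a) (H1 : h1.IsHomogeneous b) (ha : 1 ≤ a) (hb : 1 ≤ b)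
    (hz : ∀ w : Fin 2 → E, w ≠ 0 → eval w (piL u h0) = 0 → eval w (piL u h1) ≠ 0)
    (d : ℕ) (hd : a + b ≤ d + 1) (f : MvPolynomial (Fin 3) E) (hf : f.IsHomogeneous d) :
    ∃ q, f - lin u * q ∈ Ideal.span {h0, h1} := by
  have := binary_span _ _ a b (piL_hom u _ _ H0) (piL_hom u _ _ H1) hz ha hb d hd _
    (piL_hom u _ _ hf)
  rw [Ideal.mem_span_pair] at this
  obtain ⟨r, s, h⟩ := this
  obtain ⟨q, hq⟩ := mem_of_piL u hu (f - (iot r * h0 + iot s * h1)) (by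
    simp only [map_sub, map_add, map_mul, piL_iot]
    rw [h, sub_self])
  refine ⟨q, ?_⟩
  rw [← hq, sub_sub_cancel, Ideal.mem_span_pair]
  exact ⟨_, _, rfl⟩

lemma core_b0 (u : Fin 3 → E) (hu : u 0 ≠ 0) (h0 h1 : MvPolynomial (Fin 3) E) (a b : ℕ)
    (H0 : h0.IsHomogeneous a) (H1 : h1.IsHomogeneous b) (ha : 1 ≤ a) (hb : 1 ≤ b)
    (hz : ∀ w : Fin 2 → E, w ≠ 0 → eval w (piL u h0) = 0 → eval w (piL u h1) ≠ 0)
    (hne : piL u h1 ≠ 0)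
    (f : MvPolynomial (Fin 3) E) (hf : lin u * f ∈ Ideal.span {h0, h1}) :
    f ∈ Ideal.span {h0, h1} := by
  have hL : lin u ≠ 0 := by
    intro h
    have := congrArg (eval ![1, 0, 0]) h
    simp [lin, Fin.sum_univ_three] at this
    exact hu this
  have hrel := binary_relPrime _ _ a b (piL_hom u _ _ H0) (piL_hom u _ _ H1) hz ha hb
  rw [Ideal.mem_span_pair] at hf ⊢
  obtain ⟨α, β, h⟩ := hf
  have h' := congrArg (piL u) h
  simp only [map_add, map_mul, piL_lin u hu, zero_mul] at h'
  have hdvd : piL u h1 ∣ piL u α := by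
    apply hrel.symm.dvd_of_dvd_mul_right
    exact ⟨- piL u β, by linear_combination h'⟩
  obtain ⟨c, hc⟩ := hdvd
  have hβ : piL u β = - c * piL u h0 := by
    apply mul_left_cancel₀ hne
    rw [hc] at h'
    linear_combination h'
  obtain ⟨α', hα'⟩ := mem_of_piL u hu (α - h1 * iot c) (by simp [piL_iot, hc])
  obtain ⟨β', hβ'⟩ := mem_of_piL u hu (β + h0 * iot c) (by simp [piL_iot, hβ]; ring)
  refine ⟨α', β', ?_⟩
  apply mul_left_cancel₀ hL
  rw [← h]
  linear_combination (-h0) * hα' - h1 * hβ'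

lemma core_b {k : ℕ} (u : Fin 3 → E) (hu : u 0 ≠ 0) (g : Fin (k + 2) → MvPolynomial (Fin 3) E)
    (γ : Fin (k + 2) → ℕ) (hγ : ∀ i, 1 ≤ γ i)
    (hg : ∀ i, (g i).IsHomogeneous (γ i))
    (hz : ∀ w : Fin 2 → E, w ≠ 0 → eval w (piL u (g 0)) = 0 → eval w (piL u (g 1)) ≠ 0)
    (hne : piL u (g 1) ≠ 0) (d : ℕ)
    (hd : ∀ i : Fin (k + 2), i ≠ 0 → i ≠ 1 → γ 0 + γ 1 + γ i ≤ d + 2)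
    (f : MvPolynomial (Fin 3) E) (hf : f.IsHomogeneous d)
    (hI : lin u * f ∈ Ideal.span (Set.range g)) : f ∈ Ideal.span (Set.range g) := by
  have hLf : (lin u * f).IsHomogeneous (1 + d) := (lin_hom u).mul hf
  obtain ⟨a, hsum, hh, hz0⟩ := homog_repr g γ hg _ _ hLf hI
  have key : ∀ i : Fin (k + 2), ∃ q, a i * g i - lin u * (q * g i) ∈ Ideal.span {g 0, g 1} := by
    intro i
    by_cases h0 : i = 0
    · refine ⟨0, ?_⟩
      subst h0
      simp only [zero_mul, mul_zero, sub_zero]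
      exact Ideal.mul_mem_left _ _ (Ideal.subset_span (by simp))
    by_cases h1 : i = 1
    · refine ⟨0, ?_⟩
      subst h1
      simp only [zero_mul, mul_zero, sub_zero]
      exact Ideal.mul_mem_left _ _ (Ideal.subset_span (by simp))
    have hdi := hd i h0 h1
    have hγ0 := hγ 0
    have hγ1 := hγ 1
    obtain ⟨q, hq⟩ := core_a u hu (g 0) (g 1) _ _ (hg 0) (hg 1) (hγ 0) (hγ 1) hz (1 + d - γ i)
      (by omega) (a i) (hh i (by omega))
    refine ⟨q, ?_⟩
    have := Ideal.mul_mem_right (g i) _ hq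
    rw [sub_mul, mul_assoc] at this
    exact this
  choose q hq using key
  have hle : Ideal.span {g 0, g 1} ≤ Ideal.span (Set.range g) := by
    apply Ideal.span_mono
    rintro x (rfl | rfl) <;> exact ⟨_, rfl⟩
  have h1 : lin u * (f - ∑ i, q i * g i) ∈ Ideal.span {g 0, g 1} := by
    rw [mul_sub, hsum, Finset.mul_sum, ← Finset.sum_sub_distrib]
    exact Ideal.sum_mem _ fun i _ => hq i
  have h2 := hle (core_b0 u hu (g 0) (g 1) _ _ (hg 0) (hg 1) (hγ 0) (hγ 1) hz hne _ h1)
  have h3 : ∑ i, q i * g i ∈ Ideal.span (Set.range g) :=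
    Ideal.sum_mem _ fun i _ => Ideal.mul_mem_left _ _ (Ideal.subset_span ⟨i, rfl⟩)
  have := Ideal.add_mem _ h2 h3
  rwa [sub_add_cancel] at this

end core
end MacAux


namespace MacAux
open MvPolynomial

section modify
variable {E : Type*} [Field E]

lemma avoid [Infinite E] {ι : Type*} (Z : Finset ι) (P : ι → Polynomial E)
    (h : ∀ z ∈ Z, P z ≠ 0) : ∃ c : E, ∀ z ∈ Z, (P z).eval c ≠ 0 := by
  have h1 : ∏ z ∈ Z, P z ≠ 0 := Finset.prod_ne_zero_iff.mpr h
  by_contra! hc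
  apply h1
  apply Polynomial.funext
  intro c
  obtain ⟨z, hz, hzc⟩ := hc c
  rw [Polynomial.eval_prod, Polynomial.eval_zero]
  exact Finset.prod_eq_zero hz hzc

variable [IsAlgClosed E]

lemma modify {m : ℕ} (hm : 1 ≤ m) (u : Fin 3 → E) (hu : u 0 ≠ 0)
    (g : Fin m → MvPolynomial (Fin 3) E) (γ : ℕ → ℕ)
    (hg : ∀ i : Fin m, (g i).IsHomogeneous (γ i)) (hγ : ∀ i < m, 1 ≤ γ i)
    (hanti : ∀ i j, i ≤ j → j < m → γ j ≤ γ i)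
    (hz : ∀ ξ : Fin 3 → E, ξ ≠ 0 → (∀ i, eval ξ (g i) = 0) → eval ξ (lin u) ≠ 0) :
    ∃ k, m = k + 2 ∧ ∃ h : Fin (k + 2) → MvPolynomial (Fin 3) E,
      (∀ i, (h i).IsHomogeneous (γ i)) ∧ Ideal.span (Set.range h) = Ideal.span (Set.range g) ∧
      (∀ w : Fin 2 → E, w ≠ 0 → eval w (piL u (h 0)) = 0 → eval w (piL u (h 1)) ≠ 0) ∧
      piL u (h 1) ≠ 0 := by
  have hw : ∀ w : Fin 2 → E, w ≠ 0 → ∃ i, eval w (piL u (g i)) ≠ 0 := by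
    intro w hw0
    by_contra! hc
    simp only [eval_piL] at hc
    refine hz _ ?_ hc ?_
    · intro h
      apply hw0
      ext i
      fin_cases i
      · simpa using congrFun h 1
      · simpa using congrFun h 2
    · rw [← eval_piL, piL_lin u hu, map_zero]
  obtain ⟨n, rfl⟩ : ∃ n, m = n + 1 := ⟨m - 1, by omega⟩
  have hex : ∃ j : Fin (n + 1), j ≠ 0 ∧ piL u (g j) ≠ 0 := by
    by_contra! hc
    obtain ⟨w, hw0, hw1⟩ := binary_zero _ _ (hγ 0 (by omega)) (piL_hom u _ _ (hg 0))
    obtain ⟨i, hi⟩ := hw w hw0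
    by_cases h0 : i = 0
    · rw [h0] at hi; exact hi hw1
    · rw [hc i h0] at hi; simp at hi
  obtain ⟨j, hj0, hj⟩ := hex
  obtain ⟨k, rfl⟩ : ∃ k, n = k + 1 := by
    refine ⟨n - 1, ?_⟩
    have := j.2
    have : (j : ℕ) ≠ 0 := fun h => hj0 (Fin.ext h)
    omega
  refine ⟨k, rfl, ?_⟩
  -- choice of h1
  obtain ⟨h1, h1hom, h1ne, h1mem⟩ : ∃ h1 : MvPolynomial (Fin 3) E, h1.IsHomogeneous (γ 1) ∧
      piL u h1 ≠ 0 ∧ h1 - g 1 ∈ Ideal.span (g '' {i | i ≠ 0 ∧ i ≠ 1}) := by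
    by_cases h : piL u (g 1) = 0
    · have hj1 : j ≠ 1 := by rintro rfl; exact hj h
      have hle : γ j ≤ γ 1 := by
        apply hanti _ _ _ j.2
        have : (j : ℕ) ≠ 0 := fun h => hj0 (Fin.ext h)
        omega
      refine ⟨g 1 + X 1 ^ (γ 1 - γ j) * g j, ?_, ?_, ?_⟩
      · refine (hg 1).add ?_
        have := (isHomogeneous_X_pow (R := E) (1 : Fin 3) (γ 1 - γ j)).mul (hg j)
        rw [Nat.sub_add_cancel hle] at this
        exact this
      · rw [map_add, h, zero_add, map_mul, map_pow]
        refine mul_ne_zero (pow_ne_zero _ ?_) hj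
        simp [piL]
      · rw [add_sub_cancel_left]
        exact Ideal.mul_mem_left _ _ (Ideal.subset_span ⟨j, ⟨hj0, hj1⟩, rfl⟩)
    · exact ⟨g 1, hg 1, h, by rw [sub_self]; exact Ideal.zero_mem _⟩
  -- choice of h0
  obtain ⟨Z, hZ0, hZ⟩ := finite_zeros _ _ (piL_hom u _ _ h1hom) h1ne
  obtain ⟨κ, hκ⟩ := avoid Z (fun w => Polynomial.C (w 0) + Polynomial.C (w 1) * Polynomial.X) (by
    intro w hwZ h
    apply hZ0 w hwZ
    have e0 := congrArg (fun P => Polynomial.coeff P 0) h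
    have e1 := congrArg (fun P => Polynomial.coeff P 1) h
    simp at e0 e1
    ext i; fin_cases i
    · simpa using e0
    · simpa [Polynomial.coeff_C] using e1)
  set ℓ : MvPolynomial (Fin 3) E := X 1 + C κ * X 2 with hℓ
  have hℓhom : ℓ.IsHomogeneous 1 := (isHomogeneous_X _ _).add (isHomogeneous_C_mul_X _ _)
  have hℓev : ∀ w ∈ Z, eval w (piL u ℓ) ≠ 0 := by
    intro w hwZ
    have := hκ w hwZ
    simp only [Polynomial.eval_add, Polynomial.eval_C, Polynomial.eval_mul, Polynomial.eval_X] at this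
    simp [hℓ, piL]
    rwa [mul_comm]
  obtain ⟨c, hc⟩ := avoid Z (fun w => ∑ i : Fin (k + 1 + 1), Polynomial.monomial (i : ℕ)
      (eval w (piL u ℓ) ^ (γ 0 - γ i) * eval w (piL u (g i)))) (by
    intro w hwZ h
    obtain ⟨i, hi⟩ := hw w (hZ0 w hwZ)
    have := congrArg (fun P => Polynomial.coeff P i) h
    simp only [Polynomial.finsetSum_coeff, Polynomial.coeff_monomial, Polynomial.coeff_zero] at this
    rw [Finset.sum_eq_single i] at this
    · simp only [if_true] at this
      exact mul_ne_zero (pow_ne_zero _ (hℓev w hwZ)) hi this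
    · intro b _ hb
      rw [if_neg]
      exact fun h => hb (Fin.ext h)
    · simp)
  set h0 : MvPolynomial (Fin 3) E := ∑ i : Fin (k + 1 + 1), C (c ^ (i : ℕ)) * (ℓ ^ (γ 0 - γ i) * g i)
    with hh0
  have h0hom : h0.IsHomogeneous (γ 0) := by
    apply IsHomogeneous.sum
    intro i _
    have := (hℓhom.pow (γ 0 - γ i)).mul (hg i)
    rw [one_mul, Nat.sub_add_cancel (hanti 0 i (Nat.zero_le _) i.2)] at this
    exact this.C_mul _
  have h0ev : ∀ w ∈ Z, eval w (piL u h0) ≠ 0 := by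
    intro w hwZ
    have := hc w hwZ
    rw [Polynomial.eval_finsetSum] at this
    intro h
    apply this
    rw [← h, hh0, map_sum, map_sum]
    refine Finset.sum_congr rfl fun i _ => ?_
    rw [Polynomial.eval_monomial, map_mul, map_mul, map_mul, map_mul, algHom_C,
      MvPolynomial.algebraMap_eq, eval_C, map_pow, map_pow]
    ring
  have h10 : (1 : Fin (k + 2)) ≠ 0 := by simp
  have hspan2 : Ideal.span (g '' {i | i ≠ 0 ∧ i ≠ 1}) ≤ Ideal.span (Set.range fun i : Fin (k + 2) =>
      if i = 0 then h0 else if i = 1 then h1 else g i) := by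
    rw [Ideal.span_le]
    rintro _ ⟨i, ⟨hi0, hi1⟩, rfl⟩
    exact Ideal.subset_span ⟨i, by simp [hi0, hi1]⟩
  have hspan3 : Ideal.span (g '' {i | i ≠ 0 ∧ i ≠ 1}) ≤ Ideal.span (Set.range g) :=
    Ideal.span_mono (Set.image_subset_range _ _)
  have hg1 : g 1 ∈ Ideal.span (Set.range fun i : Fin (k + 2) =>
      if i = 0 then h0 else if i = 1 then h1 else g i) := by
    have h1' : h1 ∈ Ideal.span (Set.range fun i : Fin (k + 2) =>
      if i = 0 then h0 else if i = 1 then h1 else g i) := Ideal.subset_span ⟨1, by simp⟩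
    have := Ideal.sub_mem _ h1' (hspan2 h1mem)
    rwa [sub_sub_cancel] at this
  have hgs : ∀ i ≠ 0, g i ∈ Ideal.span (Set.range fun i : Fin (k + 2) =>
      if i = 0 then h0 else if i = 1 then h1 else g i) := by
    intro i hi
    by_cases hi1 : i = 1
    · rw [hi1]; exact hg1
    · exact Ideal.subset_span ⟨i, by simp [hi, hi1]⟩
  refine ⟨fun i => if i = 0 then h0 else if i = 1 then h1 else g i, ?_, ?_, ?_, ?_⟩
  · intro i
    by_cases hi0 : i = 0
    · subst hi0; simpa using h0hom
    by_cases hi1 : i = 1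
    · subst hi1; simpa using h1hom
    simp only [hi0, hi1, if_false]; exact hg i
  · apply le_antisymm
    · rw [Ideal.span_le]
      rintro _ ⟨i, rfl⟩
      by_cases hi0 : i = 0
      · subst hi0
        simp only [if_true]
        exact Ideal.sum_mem _ fun i _ => Ideal.mul_mem_left _ _ (Ideal.mul_mem_left _ _
          (Ideal.subset_span ⟨i, rfl⟩))
      by_cases hi1 : i = 1
      · subst hi1
        simp only [h10, if_false, if_true]
        have g1' : g 1 ∈ Ideal.span (Set.range g) := Ideal.subset_span ⟨1, rfl⟩
        have := Ideal.add_mem _ (hspan3 h1mem) g1'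
        rwa [sub_add_cancel] at this
      simp only [hi0, hi1, if_false]
      exact Ideal.subset_span ⟨i, rfl⟩
    · rw [Ideal.span_le]
      rintro _ ⟨i, rfl⟩
      by_cases hi0 : i = 0
      · subst hi0
        have e : g 0 = h0 - ∑ i : Fin (k + 1), C (c ^ ((i.succ : Fin (k + 2)) : ℕ)) *
            (ℓ ^ (γ 0 - γ (i.succ : Fin (k + 2))) * g i.succ) := by
          rw [hh0, Fin.sum_univ_succ]
          simp
        rw [e]
        refine Ideal.sub_mem _ (Ideal.subset_span ⟨0, by simp⟩) ?_
        exact Ideal.sum_mem _ fun i _ => Ideal.mul_mem_left _ _ (Ideal.mul_mem_left _ _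
          (hgs _ (Fin.succ_ne_zero i)))
      · exact hgs i hi0
  · intro w hw0 e0 e1
    simp only [h10, if_false, if_true] at e0 e1
    obtain ⟨v, hv, t, ht, rfl⟩ := hZ w hw0 e1
    rw [eval_smul _ _ (piL_hom u _ _ h0hom)] at e0
    exact h0ev v hv ((mul_eq_zero.mp e0).resolve_left (pow_ne_zero _ ht))
  · simpa only [h10, if_false, if_true] using h1ne

/-- Main algebraic facts. -/
lemma main_ab {m : ℕ} (hm : 1 ≤ m) (u : Fin 3 → E) (hu : u 0 ≠ 0)
    (g : Fin m → MvPolynomial (Fin 3) E) (γ : ℕ → ℕ)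
    (hg : ∀ i : Fin m, (g i).IsHomogeneous (γ i)) (hγ : ∀ i < m, 1 ≤ γ i)
    (hanti : ∀ i j, i ≤ j → j < m → γ j ≤ γ i)
    (hz : ∀ ξ : Fin 3 → E, ξ ≠ 0 → (∀ i, eval ξ (g i) = 0) → eval ξ (lin u) ≠ 0)
    (D : ℕ) (hD : D = γ 0 + ∑ l ∈ Finset.Icc 1 (min 2 (m - 1)), (γ l - 1)) (d : ℕ) (hd : D ≤ d)
    (f : MvPolynomial (Fin 3) E) (hf : f.IsHomogeneous d) :
    (∃ q : MvPolynomial (Fin 3) E, q.IsHomogeneous (d - 1) ∧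
      f - lin u * q ∈ Ideal.span (Set.range g)) ∧
    (lin u * f ∈ Ideal.span (Set.range g) → f ∈ Ideal.span (Set.range g)) := by
  obtain ⟨k, rfl, h, hhom, hspan, hw, hne⟩ := modify hm u hu g γ hg hγ hanti hz
  have hγ0 := hγ 0 (by omega)
  have hγ1 := hγ 1 (by omega)
  have hD1 : γ 0 + γ 1 ≤ D + 1 := by
    rw [hD]
    have : γ 1 - 1 ≤ ∑ l ∈ Finset.Icc 1 (min 2 (k + 2 - 1)), (γ l - 1) :=
      Finset.single_le_sum (f := fun l => γ l - 1) (fun _ _ => Nat.zero_le _)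
        (Finset.mem_Icc.mpr ⟨le_rfl, by omega⟩)
    omega
  have hD2 : ∀ i : Fin (k + 2), i ≠ 0 → i ≠ 1 → γ 0 + γ 1 + γ i ≤ D + 2 := by
    intro i h0 h1
    have h0' : (i : ℕ) ≠ 0 := fun h => h0 (Fin.ext h)
    have h1' : (i : ℕ) ≠ 1 := fun h => h1 (Fin.ext h)
    have hi := i.2
    have hle := hanti 2 i (by omega) hi
    have hγ2 := hγ 2 (by omega)
    have : min 2 (k + 2 - 1) = 2 := by omega
    rw [this] at hD
    have : Finset.Icc 1 2 = {1, 2} := rfl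
    rw [this, Finset.sum_pair (by norm_num)] at hD
    omega
  rw [← hspan]
  constructor
  · obtain ⟨q, hq⟩ := core_a u hu (h 0) (h 1) _ _ (hhom 0) (hhom 1) hγ0 hγ1 hw d
      (by simp only [Fin.val_zero, Fin.val_one]; omega) f hf
    have hle : Ideal.span {h 0, h 1} ≤ Ideal.span (Set.range h) := by
      apply Ideal.span_mono
      rintro x (rfl | rfl) <;> exact ⟨_, rfl⟩
    refine ⟨homogeneousComponent (d - 1) q, homogeneousComponent_isHomogeneous _ _, ?_⟩
    let := MvPolynomial.gradedAlgebra (σ := Fin 3) (R := E)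
    have hI : (Ideal.span (Set.range h)).IsHomogeneous (homogeneousSubmodule (Fin 3) E) := by
      apply Ideal.homogeneous_span
      rintro _ ⟨i, rfl⟩
      exact ⟨_, hhom i⟩
    have := homogeneousComponent_mem_of_mem hI (hle hq) d
    rw [map_sub, homogeneousComponent_eq_self hf, mul_comm, homComp_mul_right _ _ _ _ (lin_hom u),
      if_pos (by omega), mul_comm] at this
    exact this
  · exact core_b u hu h (fun i => γ i) (fun i => hγ _ i.2) hhom hw hne d
      (fun i h0 h1 => (hD2 i h0 h1).trans (by omega)) f hf

end modify
end MacAux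


namespace MacAux
open MvPolynomial

theorem norm_local {E B : Type*} [Field E] [CommRing B] [Algebra E B] [FiniteDimensional E B]
    (z : B) (c : E) (h : IsNilpotent (z - algebraMap E B c)) :
    Algebra.norm E z = c ^ Module.finrank E B := by
  set f : Module.End E B := Algebra.lmul E B z with hf
  have h1 : IsNilpotent (f - c • (1 : Module.End E B)) := by
    have := h.map (Algebra.lmul E B)
    have h0 : f - c • (1 : Module.End E B) = Algebra.lmul E B (z - algebraMap E B c) := by
      ext x
      simp [hf, Algebra.smul_def]
    rw [h0]
    exact this
  have h2 := h1.charpoly_eq_X_pow_finrank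
  rw [LinearMap.charpoly_sub_smul] at h2
  have h3 : f.charpoly = (Polynomial.X - Polynomial.C c) ^ Module.finrank E B := by
    have := congrArg (fun p => p.comp (Polynomial.X - Polynomial.C c)) h2
    simpa [Polynomial.comp_assoc] using this
  rw [Algebra.norm_apply, ← hf, LinearMap.det_eq_sign_charpoly_coeff, h3,
    Polynomial.coeff_zero_eq_eval_zero]
  simp [← mul_pow]

theorem norm_pi {E ι : Type*} [Field E] [Fintype ι] (B : ι → Type*) [∀ i, CommRing (B i)]
    [∀ i, Algebra E (B i)] [∀ i, FiniteDimensional E (B i)] (z : ∀ i, B i) :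
    Algebra.norm E z = ∏ i, Algebra.norm E (z i) := by
  classical
  let b := fun i => Module.finBasis E (B i)
  let Bs := Pi.basis b
  simp_rw [Algebra.norm_apply, ← LinearMap.det_toMatrix Bs]
  have hb : ∀ i, LinearMap.det (Algebra.lmul E (B i) (z i)) =
    (LinearMap.toMatrix (b i) (b i) (Algebra.lmul E (B i) (z i))).det := fun i => by
      rw [LinearMap.det_toMatrix]
  simp_rw [hb]
  let o : LinearOrder ι := LinearOrder.lift' (Fintype.equivFin ι) (Fintype.equivFin ι).injective
  have hent : ∀ i x j y, LinearMap.toMatrix Bs Bs (Algebra.lmul E (∀ i, B i) z) ⟨i, x⟩ ⟨j, y⟩ =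
      (b i).repr (z i * (Pi.single j (b j y) : ∀ i, B i) i) x := by
    intro i x j y
    rw [LinearMap.toMatrix_apply]
    simp [Bs, Pi.basis_apply, Pi.basis_repr]
  have hbt : Matrix.BlockTriangular (LinearMap.toMatrix Bs Bs (Algebra.lmul E (∀ i, B i) z))
      Sigma.fst := by
    rintro ⟨i, x⟩ ⟨j, y⟩ hij
    rw [hent, Pi.single_eq_of_ne (ne_of_gt hij)]
    simp
  refine (Eq.trans (by congr!) hbt.det_fintype).trans ?_
  refine Finset.prod_congr rfl fun k _ => ?_
  rw [← Matrix.det_reindex_self (Equiv.sigmaSubtype k)]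
  congr 1
  ext x y
  rw [Matrix.reindex_apply, Matrix.submatrix_apply, Matrix.toSquareBlock_def, Matrix.of_apply]
  have hh : ∀ x, ((Equiv.sigmaSubtype (β := fun i => Fin (Module.finrank E (B i))) k).symm x).1
    = ⟨k, x⟩ := fun x => rfl
  rw [hh, hh, hent, LinearMap.toMatrix_apply]
  simp

theorem norm_formula {E A : Type*} [Field E] [IsAlgClosed E] [CommRing A] [Algebra E A]
    [FiniteDimensional E A] [Fintype (MaximalSpectrum A)] :
    ∃ χ : MaximalSpectrum A → (A →ₐ[E] E), (∀ M, RingHom.ker (χ M) = M.asIdeal) ∧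
      ∀ z : A, Algebra.norm E z =
        ∏ M, χ M z ^ (⨆ N : ℕ, Module.finrank E (A ⧸ (RingHom.ker (χ M)) ^ N)) := by
  have : IsArtinianRing A := IsArtinianRing.of_finite E A
  have hχ : ∀ M : MaximalSpectrum A, ∃ χ : A →ₐ[E] E, RingHom.ker χ = M.asIdeal := by
    intro M
    have hM := M.isMaximal
    let _ : Field (A ⧸ M.asIdeal) := Ideal.Quotient.field _
    have hb := IsAlgClosed.algebraMap_bijective_of_isIntegral (k := E) (K := A ⧸ M.asIdeal)
    let e := AlgEquiv.ofBijective (Algebra.ofId E (A ⧸ M.asIdeal)) hb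
    refine ⟨e.symm.toAlgHom.comp (Ideal.Quotient.mkₐ E M.asIdeal), ?_⟩
    ext x
    rw [RingHom.mem_ker]
    simp [Ideal.Quotient.eq_zero_iff_mem]
  choose χ hχ using hχ
  refine ⟨χ, hχ, fun z => ?_⟩
  obtain ⟨n0, hn0⟩ : IsNilpotent (nilradical A) := IsArtinianRing.isNilpotent_nilradical
  have hst : ∀ M : MaximalSpectrum A, ∃ n, ∀ k, n ≤ k → M.asIdeal ^ n = M.asIdeal ^ k := by
    intro M
    exact IsArtinian.monotone_stabilizes
      ⟨fun n => OrderDual.toDual (M.asIdeal ^ n), fun a b h => Ideal.pow_le_pow_right h⟩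
  choose s hs using hst
  let N := n0 + ∑ M, s M
  have hN0 : nilradical A ^ N = ⊥ := by
    rw [pow_add, hn0]; simp
  have hsN : ∀ M, s M ≤ N := fun M =>
    (Finset.single_le_sum (f := s) (fun _ _ => Nat.zero_le _) (Finset.mem_univ M)).trans
      (Nat.le_add_left _ _)
  have hsup : ∀ M : MaximalSpectrum A, (⨆ k : ℕ, Module.finrank E (A ⧸ (RingHom.ker (χ M)) ^ k))
      = Module.finrank E (A ⧸ M.asIdeal ^ N) := by
    intro M
    rw [hχ M]
    apply le_antisymm
    · apply ciSup_le
      intro k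
      have hle : M.asIdeal ^ N ≤ M.asIdeal ^ k := by
        rcases le_total k N with h | h
        · exact Ideal.pow_le_pow_right h
        · rw [← hs M N (hsN M), hs M k ((hsN M).trans h)]
      exact LinearMap.finrank_le_finrank_of_surjective
        (f := (Ideal.Quotient.factorₐ E hle).toLinearMap) (Ideal.Quotient.factor_surjective hle)
    · refine le_ciSup (f := fun k : ℕ => Module.finrank E (A ⧸ M.asIdeal ^ k)) ⟨Module.finrank E A, ?_⟩ N
      rintro _ ⟨k, rfl⟩
      exact LinearMap.finrank_le_finrank_of_surjective
        (f := (Ideal.Quotient.mkₐ E (M.asIdeal ^ k)).toLinearMap) Ideal.Quotient.mk_surjective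
  simp_rw [hsup]
  let e1 : A ≃ₐ[E] (A ⧸ nilradical A ^ N) :=
    (AlgEquiv.quotientBot E A).symm.trans (Ideal.quotientEquivAlgOfEq E hN0.symm)
  let e2 : (A ⧸ nilradical A ^ N) ≃ₐ[E] ∀ I : MaximalSpectrum A, A ⧸ I.asIdeal ^ N :=
    (IsArtinianRing.quotNilradicalPowEquivPi A N).restrictScalars E
  let e := e1.trans e2
  have he : ∀ M, e z M = Ideal.Quotient.mk _ z := fun M => rfl
  rw [Algebra.norm_eq_of_algEquiv e z |>.symm, norm_pi]
  refine Finset.prod_congr rfl fun M _ => ?_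
  apply norm_local
  refine ⟨N, ?_⟩
  have : (e z M - algebraMap E _ (χ M z)) = Ideal.Quotient.mk (M.asIdeal ^ N)
      (z - algebraMap E A (χ M z)) := by
    rw [he, map_sub]; rfl
  rw [this, ← map_pow, Ideal.Quotient.eq_zero_iff_mem]
  apply Ideal.pow_mem_pow
  rw [← hχ M, RingHom.mem_ker]
  simp
end MacAux


namespace MacAux
open MvPolynomial

/-- maximal ideal of a point -/
noncomputable def mpt {E : Type*} [Field E] (a : Fin 3 → E) : Ideal (MvPolynomial (Fin 3) E) :=
  Ideal.span (Set.range fun t => X t - C (a t))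

theorem sub_mem_mpt {E : Type*} [Field E] (a : Fin 3 → E) (f : MvPolynomial (Fin 3) E) :
    f - C (eval a f) ∈ mpt a := by
  rw [← Ideal.Quotient.eq_zero_iff_mem, map_sub, sub_eq_zero]
  have : (Ideal.Quotient.mkₐ E (mpt a)) =
      (Algebra.ofId E (MvPolynomial (Fin 3) E ⧸ mpt a)).comp (aeval a : _ →ₐ[E] E) := by
    apply MvPolynomial.algHom_ext
    intro t
    simp only [AlgHom.comp_apply, aeval_X]
    have : Ideal.Quotient.mk (mpt a) (X t) = Ideal.Quotient.mk (mpt a) (C (a t)) := by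
      rw [Ideal.Quotient.eq]
      exact Ideal.subset_span ⟨t, rfl⟩
    exact this
  have h := congrArg (fun φ => φ f) this
  simp only [AlgHom.comp_apply] at h
  rw [MvPolynomial.aeval_eq_eval] at h
  exact h

/-- the ideal with truncation -/
noncomputable def qI {E : Type*} [Field E] (I : Ideal (MvPolynomial (Fin 3) E)) (u a : Fin 3 → E)
    (N : ℕ) : Ideal (MvPolynomial (Fin 3) E) :=
  (I ⊔ Ideal.span {lin u - 1}) ⊔ mpt a ^ N

theorem aeval_mk {E : Type*} [Field E] (J : Ideal (MvPolynomial (Fin 3) E))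
    (f : MvPolynomial (Fin 3) E) :
    aeval (fun t => Ideal.Quotient.mk J (X t)) f = Ideal.Quotient.mk J f := by
  have : (aeval (fun t => Ideal.Quotient.mk J (X t)) : _ →ₐ[E] _) = Ideal.Quotient.mkₐ E J := by
    apply MvPolynomial.algHom_ext
    intro t
    simp
  rw [this]; rfl

theorem exists_phi {E : Type*} [Field E] {m : ℕ} (g : Fin m → MvPolynomial (Fin 3) E) (γ : ℕ → ℕ)
    (hg : ∀ i : Fin m, (g i).IsHomogeneous (γ i)) (u u' a a' : Fin 3 → E) (c : E) (hc : c ≠ 0)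
    (ha : a = c • a') (hu : eval a (lin u) = 1) (N : ℕ) :
    ∃ (φ : (MvPolynomial (Fin 3) E ⧸ qI (Ideal.span (Set.range g)) u a N) →ₐ[E]
        (MvPolynomial (Fin 3) E ⧸ qI (Ideal.span (Set.range g)) u' a' N))
      (w : MvPolynomial (Fin 3) E ⧸ qI (Ideal.span (Set.range g)) u' a' N),
      w * Ideal.Quotient.mk _ (lin u) = 1 ∧
      ∀ t, φ (Ideal.Quotient.mk _ (X t)) = w * Ideal.Quotient.mk _ (X t) := by
  set J := qI (Ideal.span (Set.range g)) u' a' N with hJ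
  have hgJ : ∀ i, Ideal.Quotient.mk J (g i) = 0 := by
    intro i
    rw [Ideal.Quotient.eq_zero_iff_mem]
    exact (le_sup_left.trans le_sup_left : _ ≤ J) (Ideal.subset_span ⟨i, rfl⟩)
  have hmJ : mpt a' ^ N ≤ J := le_sup_right
  have hua : eval a' (lin u) = c⁻¹ := by
    have h := hom_scale (lin u) 1 (lin_hom u) c a'
    rw [aeval_eq_eval, aeval_eq_eval] at h
    have h2 : (fun i => c * a' i) = a := by rw [ha]; rfl
    rw [h2] at h
    simp only [pow_one] at h
    rw [hu] at h
    field_simp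
    linear_combination -h
  have hunit : IsUnit (Ideal.Quotient.mk J (lin u)) := by
    have h1 := sub_mem_mpt a' (lin u)
    have h2 : IsNilpotent (Ideal.Quotient.mk J (lin u - C (eval a' (lin u)))) := by
      refine ⟨N, ?_⟩
      rw [← map_pow, Ideal.Quotient.eq_zero_iff_mem]
      exact hmJ (Ideal.pow_mem_pow h1 N)
    have h3 : IsUnit (Ideal.Quotient.mk J (C (eval a' (lin u)))) := by
      rw [hua]
      exact ((isUnit_iff_ne_zero.2 (inv_ne_zero hc)).map C).map (Ideal.Quotient.mk J)
    have := h2.isUnit_add_left_of_commute h3 (Commute.all _ _)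
    rwa [← map_add, add_sub_cancel] at this
  obtain ⟨w, hw⟩ := hunit.exists_left_inv
  let F : MvPolynomial (Fin 3) E →ₐ[E] (MvPolynomial (Fin 3) E ⧸ J) :=
    aeval (fun t => w * Ideal.Quotient.mk J (X t))
  have hF : ∀ (f : MvPolynomial (Fin 3) E) n, f.IsHomogeneous n →
      F f = w ^ n * Ideal.Quotient.mk J f := by
    intro f n hf
    have := hom_scale f n hf w (fun t => Ideal.Quotient.mk J (X t))
    rw [aeval_mk] at this
    exact this
  have hker : ∀ f ∈ qI (Ideal.span (Set.range g)) u a N, F f = 0 := by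
    suffices h : qI (Ideal.span (Set.range g)) u a N ≤ RingHom.ker F from fun f hf => h hf
    refine sup_le (sup_le ?_ ?_) ?_
    · rw [Ideal.span_le]
      rintro _ ⟨i, rfl⟩
      show F (g i) = 0
      rw [hF _ _ (hg i), hgJ, mul_zero]
    · rw [Ideal.span_le, Set.singleton_subset_iff]
      show F (lin u - 1) = 0
      rw [map_sub, hF _ _ (lin_hom u), pow_one, hw, map_one, sub_self]
    · have h1 : mpt a ≤ ((mpt a').map (Ideal.Quotient.mk J)).comap F := by
        rw [mpt, Ideal.span_le]
        rintro _ ⟨t, rfl⟩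
        rw [SetLike.mem_coe, Ideal.mem_comap]
        have h2 : F (X t - C (a t)) = w * Ideal.Quotient.mk J (X t - C (a t) * lin u) := by
          have h3 : F (C (a t)) = Ideal.Quotient.mk J (C (a t)) := F.commutes (a t)
          rw [map_sub, hF _ _ (isHomogeneous_X _ _), h3, map_sub, map_mul]
          linear_combination (Ideal.Quotient.mk J (C (a t))) * hw
        rw [h2]
        apply Ideal.mul_mem_left
        apply Ideal.mem_map_of_mem
        have h4 := sub_mem_mpt a' (X t - C (a t) * lin u)
        have h5 : eval a' (X t - C (a t) * lin u) = 0 := by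
          simp only [map_sub, map_mul, eval_X, eval_C, hua, ha, Pi.smul_apply, smul_eq_mul]
          field_simp
          ring
        rw [h5, C_0, sub_zero] at h4
        exact h4
      intro f hf
      have h2 : f ∈ (((mpt a').map (Ideal.Quotient.mk J)) ^ N).comap F :=
        Ideal.le_comap_pow F N (Ideal.pow_right_mono h1 N hf)
      rw [← Ideal.map_pow] at h2
      have h3 : (mpt a' ^ N).map (Ideal.Quotient.mk J) = ⊥ := by
        rw [eq_bot_iff]
        refine (Ideal.map_mono hmJ).trans ?_
        rw [Ideal.map_quotient_self]
      rw [h3] at h2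
      exact h2
  refine ⟨Ideal.Quotient.liftₐ _ F hker, w, hw, fun t => ?_⟩
  show F (X t) = _
  simp [F]

theorem finrank_qI {E : Type*} [Field E] {m : ℕ} (g : Fin m → MvPolynomial (Fin 3) E) (γ : ℕ → ℕ)
    (hg : ∀ i : Fin m, (g i).IsHomogeneous (γ i)) (u u' a a' : Fin 3 → E) (c : E) (hc : c ≠ 0)
    (ha : a = c • a') (hu : eval a (lin u) = 1) (hu' : eval a' (lin u') = 1) (N : ℕ) :
    Module.finrank E (MvPolynomial (Fin 3) E ⧸ qI (Ideal.span (Set.range g)) u a N) =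
    Module.finrank E (MvPolynomial (Fin 3) E ⧸ qI (Ideal.span (Set.range g)) u' a' N) := by
  have key : ∀ (u u' : Fin 3 → E) (J J' : Ideal (MvPolynomial (Fin 3) E))
      (φ : (MvPolynomial (Fin 3) E ⧸ J) →ₐ[E] (MvPolynomial (Fin 3) E ⧸ J'))
      (ψ : (MvPolynomial (Fin 3) E ⧸ J') →ₐ[E] (MvPolynomial (Fin 3) E ⧸ J))
      (w : MvPolynomial (Fin 3) E ⧸ J') (w' : MvPolynomial (Fin 3) E ⧸ J)
      (_ : w * Ideal.Quotient.mk _ (lin u) = 1)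
      (_ : ∀ t, φ (Ideal.Quotient.mk _ (X t)) = w * Ideal.Quotient.mk _ (X t))
      (_ : w' * Ideal.Quotient.mk _ (lin u') = 1)
      (_ : ∀ t, ψ (Ideal.Quotient.mk _ (X t)) = w' * Ideal.Quotient.mk _ (X t))
      (_ : Ideal.Quotient.mk J (lin u) = 1),
      ψ.comp φ = AlgHom.id E _ := by
    intro u u' J J' φ ψ w w' hw hφ hw' hψ h1
    apply Ideal.Quotient.algHom_ext
    apply MvPolynomial.algHom_ext
    intro t
    show ψ (φ (Ideal.Quotient.mk _ (X t))) = Ideal.Quotient.mk _ (X t)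
    have h2 : ψ (Ideal.Quotient.mk _ (lin u)) = w' * Ideal.Quotient.mk _ (lin u) := by
      have h3 := hom_scale (lin u) 1 (lin_hom u) w' (fun t => Ideal.Quotient.mk J (X t))
      rw [aeval_mk, pow_one] at h3
      rw [← h3]
      have h4 : ψ.comp (Ideal.Quotient.mkₐ E J') =
          aeval (fun t => w' * Ideal.Quotient.mk J (X t)) := by
        apply MvPolynomial.algHom_ext
        intro t
        rw [aeval_X]
        exact hψ t
      rw [← h4]; rfl
    rw [hφ, map_mul, hψ]
    have h5 : ψ w * w' = 1 := by
      have := congrArg ψ hw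
      rwa [map_mul, h2, h1, mul_one, map_one] at this
    rw [← mul_assoc, h5, one_mul]
  have hone : ∀ (u a : Fin 3 → E), Ideal.Quotient.mk (qI (Ideal.span (Set.range g)) u a N) (lin u) = 1 := by
    intro u a
    have : Ideal.Quotient.mk (qI (Ideal.span (Set.range g)) u a N) (lin u - 1) = 0 := by
      rw [Ideal.Quotient.eq_zero_iff_mem]
      exact (le_sup_right.trans le_sup_left : Ideal.span {lin u - 1} ≤ _)
        (Ideal.subset_span rfl)
    rwa [map_sub, map_one, sub_eq_zero] at this
  obtain ⟨φ, w, hw, hφ⟩ := exists_phi g γ hg u u' a a' c hc ha hu N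
  obtain ⟨ψ, w', hw', hψ⟩ := exists_phi g γ hg u' u a' a c⁻¹ (inv_ne_zero hc)
    (by rw [ha, smul_smul, inv_mul_cancel₀ hc, one_smul]) hu' N
  exact (AlgEquiv.ofAlgHom φ ψ (key u' u _ _ ψ φ w' w hw' hψ hw hφ (hone _ _))
    (key u u' _ _ φ ψ w w' hw hφ hw' hψ (hone _ _))).toLinearEquiv.finrank_eq

theorem projMult_eq {E : Type*} [Field E] {m : ℕ} (g : Fin m → MvPolynomial (Fin 3) E) (γ : ℕ → ℕ)
    (hg : ∀ i : Fin m, (g i).IsHomogeneous (γ i)) (u ξ : Fin 3 → E)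
    (hu : eval ξ (lin u) = 1) :
    Macaulay.projMult E (Ideal.span (Set.range g)) ξ =
      ⨆ N : ℕ, Module.finrank E (MvPolynomial (Fin 3) E ⧸ qI (Ideal.span (Set.range g)) u ξ N) := by
  have h : ∃ j, ξ j ≠ 0 := by
    by_contra! h
    simp [lin, h] at hu
  unfold Macaulay.projMult
  rw [dif_pos h]
  refine iSup_congr fun N => ?_
  have hj := h.choose_spec
  generalize h.choose = j at hj
  have hlin : lin (Pi.single j (1 : E)) = X j := by
    simp [lin, Pi.single_apply, apply_ite]
  rw [finrank_qI g γ hg u (Pi.single j (1 : E)) ξ (fun t => ξ t / ξ j) (ξ j) hj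
    (by ext t; simp; field_simp) hu (by rw [hlin]; simp [hj]) N]
  have hid : Ideal.map (aeval (R := E) (fun t => if t = j then (1 : MvPolynomial (Fin 3) E) else X t))
      (Ideal.span (Set.range g)) ⊔ Ideal.span {X j - C 1} =
      Ideal.span (Set.range g) ⊔ Ideal.span {lin (Pi.single j (1 : E)) - 1} := by
    rw [hlin, C_1]
    have hd : ∀ f : MvPolynomial (Fin 3) E,
        aeval (R := E) (fun t => if t = j then (1 : MvPolynomial (Fin 3) E) else X t) f - f ∈
          (Ideal.span {X j - 1} : Ideal (MvPolynomial (Fin 3) E)) := by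
      intro f
      rw [← Ideal.Quotient.eq]
      have : (Ideal.Quotient.mkₐ E (Ideal.span {X j - 1} : Ideal (MvPolynomial (Fin 3) E))).comp
          (aeval (R := E) (fun t => if t = j then (1 : MvPolynomial (Fin 3) E) else X t)) =
          Ideal.Quotient.mkₐ E _ := by
        apply MvPolynomial.algHom_ext
        intro t
        rw [AlgHom.comp_apply, aeval_X]
        by_cases ht : t = j
        · subst ht
          rw [if_pos rfl]
          symm
          exact Ideal.Quotient.eq.2 (Ideal.subset_span rfl)
        · rw [if_neg ht]
      exact congrArg (fun φ => φ f) this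
    apply le_antisymm
    · refine sup_le ?_ le_sup_right
      rw [Ideal.map_le_iff_le_comap]
      intro f hf
      rw [Ideal.mem_comap]
      have := Ideal.add_mem _ (Ideal.mem_sup_right (hd f)) (Ideal.mem_sup_left hf)
      rwa [sub_add_cancel] at this
    · refine sup_le ?_ le_sup_right
      intro f hf
      have := Ideal.sub_mem _ (Ideal.mem_sup_left (Ideal.mem_map_of_mem
        (aeval (R := E) (fun t => if t = j then (1 : MvPolynomial (Fin 3) E) else X t)) hf))
        (Ideal.mem_sup_right (hd f))
      rwa [sub_sub_cancel] at this
  unfold qI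
  rw [← hid]
  rfl

/-- affine coordinate ring -/
noncomputable abbrev affI {E : Type*} [Field E] (I : Ideal (MvPolynomial (Fin 3) E)) (u : Fin 3 → E) :
    Ideal (MvPolynomial (Fin 3) E) := I ⊔ Ideal.span {lin u - 1}

theorem finrank_ker {E : Type*} [Field E] (I : Ideal (MvPolynomial (Fin 3) E)) (u : Fin 3 → E)
    (χ : (MvPolynomial (Fin 3) E ⧸ affI I u) →ₐ[E] E) (N : ℕ) :
    Module.finrank E ((MvPolynomial (Fin 3) E ⧸ affI I u) ⧸ RingHom.ker χ ^ N) =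
    Module.finrank E (MvPolynomial (Fin 3) E ⧸
      qI I u (fun t => χ (Ideal.Quotient.mk _ (X t))) N) := by
  set a : Fin 3 → E := (fun t => χ (Ideal.Quotient.mk _ (X t))) with ha
  have hχ : ∀ f, χ (Ideal.Quotient.mk _ f) = eval a f := by
    intro f
    have : χ.comp (Ideal.Quotient.mkₐ E (affI I u)) = aeval a := by
      apply MvPolynomial.algHom_ext
      intro t
      rw [aeval_X]
      rfl
    rw [← MvPolynomial.coe_aeval_eq_eval, ← this]
    rfl
  have hk : RingHom.ker χ = (mpt a).map (Ideal.Quotient.mkₐ E (affI I u)) := by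
    apply le_antisymm
    · intro x hx
      obtain ⟨f, rfl⟩ := Ideal.Quotient.mk_surjective x
      rw [RingHom.mem_ker, hχ] at hx
      have := sub_mem_mpt a f
      rw [hx, C_0, sub_zero] at this
      exact Ideal.mem_map_of_mem (Ideal.Quotient.mkₐ E (affI I u)) this
    · rw [Ideal.map_le_iff_le_comap, mpt, Ideal.span_le]
      rintro _ ⟨t, rfl⟩
      show χ (Ideal.Quotient.mk _ _) = 0
      rw [hχ]; simp
  rw [hk, ← Ideal.map_pow]
  exact (DoubleQuot.quotQuotEquivQuotSupₐ E (affI I u) (mpt a ^ N)).toLinearEquiv.finrank_eq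
end MacAux


namespace MacAux
open MvPolynomial

theorem sat_aux {E : Type*} [Field E] {m : ℕ} (g : Fin m → MvPolynomial (Fin 3) E) (γ : ℕ → ℕ)
    (hg : ∀ i : Fin m, (g i).IsHomogeneous (γ i)) (u : Fin 3 → E) (h : MvPolynomial (Fin 3) E)
    (D : ℕ) (hh : h.IsHomogeneous D) (hm : h ∈ affI (Ideal.span (Set.range g)) u) :
    ∃ k : ℕ, lin u ^ k * h ∈ Ideal.span (Set.range g) := by
  set I := Ideal.span (Set.range g) with hI
  let B := MvPolynomial (Fin 3) E ⧸ I
  let l : B := Ideal.Quotient.mk I (lin u)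
  let L := Localization.Away l
  let w : L := IsLocalization.Away.invSelf l
  have hw : algebraMap B L l * w = 1 := IsLocalization.Away.mul_invSelf l
  let F : MvPolynomial (Fin 3) E →ₐ[E] L :=
    aeval (fun t => w * algebraMap B L (Ideal.Quotient.mk I (X t)))
  have hF : ∀ (f : MvPolynomial (Fin 3) E) n, f.IsHomogeneous n →
      F f = w ^ n * algebraMap B L (Ideal.Quotient.mk I f) := by
    intro f n hf
    have h1 := hom_scale f n hf w (fun t => algebraMap B L (Ideal.Quotient.mk I (X t)))
    have h2 : (aeval (fun t => algebraMap B L (Ideal.Quotient.mk I (X t)))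
        : MvPolynomial (Fin 3) E →ₐ[E] L) =
        (IsScalarTower.toAlgHom E B L).comp (Ideal.Quotient.mkₐ E I) := by
      apply MvPolynomial.algHom_ext
      intro t
      rw [aeval_X]
      rfl
    rw [h2] at h1
    exact h1
  have hk : affI I u ≤ RingHom.ker F := by
    refine sup_le ?_ ?_
    · refine Ideal.span_le.2 ?_
      rintro _ ⟨i, rfl⟩
      show F (g i) = 0
      rw [hF _ _ (hg i), Ideal.Quotient.eq_zero_iff_mem.2 (Ideal.subset_span (Set.mem_range_self i)), map_zero,
        mul_zero]
    · rw [Ideal.span_le, Set.singleton_subset_iff]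
      show F (lin u - 1) = 0
      rw [map_sub, hF _ _ (lin_hom u), pow_one, map_one, mul_comm, sub_eq_zero]
      exact hw
  have h0 : F h = 0 := hk hm
  rw [hF h D hh] at h0
  have h1 : algebraMap B L (Ideal.Quotient.mk I h) = 0 := by
    have : algebraMap B L l ^ D * (w ^ D * algebraMap B L (Ideal.Quotient.mk I h)) = 0 := by
      rw [h0, mul_zero]
    rwa [← mul_assoc, ← mul_pow, hw, one_pow, one_mul] at this
  rw [IsLocalization.map_eq_zero_iff (Submonoid.powers l)] at h1
  obtain ⟨⟨_, k, rfl⟩, hk'⟩ := h1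
  refine ⟨k, ?_⟩
  rw [← Ideal.Quotient.eq_zero_iff_mem, map_mul, map_pow]
  exact hk'

section

theorem sat_main
    {E : Type*} [Field E] [IsAlgClosed E] {m : ℕ} (hm : 1 ≤ m) (u : Fin 3 → E)
    (hu : u 0 ≠ 0) (g : Fin m → MvPolynomial (Fin 3) E)
    (γ : ℕ → ℕ) (hg : ∀ i : Fin m, (g i).IsHomogeneous (γ i)) (hγ : ∀ i < m, 1 ≤ γ i)
    (hanti : ∀ i j, i ≤ j → j < m → γ j ≤ γ i)
    (hz : ∀ ξ : Fin 3 → E, ξ ≠ 0 → (∀ i, eval ξ (g i) = 0) → eval ξ (lin u) ≠ 0)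
    (D : ℕ) (hD : D = γ 0 + ∑ l ∈ Finset.Icc 1 (min 2 (m-1)), (γ l - 1))
    (h : MvPolynomial (Fin 3) E) (hh : h.IsHomogeneous D)
    (hmem : h ∈ affI (Ideal.span (Set.range g)) u) : h ∈ Ideal.span (Set.range g) := by
  obtain ⟨k, hk⟩ := sat_aux g γ hg u h D hh hmem
  induction k with
  | zero => simpa using hk
  | succ k ih =>
    apply ih
    have h2 : (lin u ^ k * h).IsHomogeneous (k + D) := by
      simpa using ((lin_hom u).pow k).mul hh
    refine (main_ab hm u hu g γ hg hγ hanti hz D hD (k + D) (Nat.le_add_left _ _) _ h2).2 ?_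
    rwa [← mul_assoc, ← pow_succ']

theorem reduce_hom
    {E : Type*} [Field E] [IsAlgClosed E] {m : ℕ} (hm : 1 ≤ m) (u : Fin 3 → E)
    (hu : u 0 ≠ 0) (g : Fin m → MvPolynomial (Fin 3) E)
    (γ : ℕ → ℕ) (hg : ∀ i : Fin m, (g i).IsHomogeneous (γ i)) (hγ : ∀ i < m, 1 ≤ γ i)
    (hanti : ∀ i j, i ≤ j → j < m → γ j ≤ γ i)
    (hz : ∀ ξ : Fin 3 → E, ξ ≠ 0 → (∀ i, eval ξ (g i) = 0) → eval ξ (lin u) ≠ 0)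
    (D : ℕ) (hD : D = γ 0 + ∑ l ∈ Finset.Icc 1 (min 2 (m-1)), (γ l - 1))
    (d : ℕ) (f : MvPolynomial (Fin 3) E) (hf : f.IsHomogeneous d) :
    ∃ q, q.IsHomogeneous D ∧ f - q ∈ affI (Ideal.span (Set.range g)) u := by
  have hl : lin u - 1 ∈ affI (Ideal.span (Set.range g)) u :=
    Ideal.mem_sup_right (Ideal.subset_span rfl)
  rcases le_total d D with h | h
  · refine ⟨lin u ^ (D - d) * f, ?_, ?_⟩
    · have := ((lin_hom u).pow (D - d)).mul hf
      rwa [one_mul, Nat.sub_add_cancel h] at this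
    · have h1 : Ideal.Quotient.mk (affI (Ideal.span (Set.range g)) u) (lin u) = 1 := by
        rw [← sub_eq_zero, ← map_one (Ideal.Quotient.mk _), ← map_sub,
          Ideal.Quotient.eq_zero_iff_mem]
        exact hl
      rw [← Ideal.Quotient.eq_zero_iff_mem, map_sub, map_mul, map_pow, h1]
      simp
  · obtain ⟨k, rfl⟩ := Nat.exists_eq_add_of_le h
    clear h
    induction k generalizing f with
    | zero => exact ⟨f, hf, by simp⟩
    | succ k ih =>
      obtain ⟨q, hq, hq2⟩ := (main_ab hm u hu g γ hg hγ hanti hz D hD _ (Nat.le_add_right D (k+1))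
        f hf).1
      obtain ⟨r, hr, hr2⟩ := ih q hq
      refine ⟨r, hr, ?_⟩
      have : f - r = (f - lin u * q) + (lin u - 1) * q + (q - r) := by ring
      rw [this]
      exact Ideal.add_mem _ (Ideal.add_mem _ (Ideal.mem_sup_left hq2)
        (Ideal.mul_mem_right _ _ hl)) hr2

theorem reduce_any
    {E : Type*} [Field E] [IsAlgClosed E] {m : ℕ} (hm : 1 ≤ m) (u : Fin 3 → E)
    (hu : u 0 ≠ 0) (g : Fin m → MvPolynomial (Fin 3) E)
    (γ : ℕ → ℕ) (hg : ∀ i : Fin m, (g i).IsHomogeneous (γ i)) (hγ : ∀ i < m, 1 ≤ γ i)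
    (hanti : ∀ i j, i ≤ j → j < m → γ j ≤ γ i)
    (hz : ∀ ξ : Fin 3 → E, ξ ≠ 0 → (∀ i, eval ξ (g i) = 0) → eval ξ (lin u) ≠ 0)
    (D : ℕ) (hD : D = γ 0 + ∑ l ∈ Finset.Icc 1 (min 2 (m-1)), (γ l - 1))
    (f : MvPolynomial (Fin 3) E) :
    ∃ q, q.IsHomogeneous D ∧ f - q ∈ affI (Ideal.span (Set.range g)) u := by
  have h := fun d => reduce_hom hm u hu g γ hg hγ hanti hz D hD d _
    (homogeneousComponent_isHomogeneous d f)
  choose q hq hq2 using h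
  refine ⟨∑ d ∈ Finset.range (f.totalDegree + 1), q d,
    IsHomogeneous.sum _ _ _ fun d _ => hq d, ?_⟩
  have := Ideal.sum_mem (affI (Ideal.span (Set.range g)) u)
    (fun d (_ : d ∈ Finset.range (f.totalDegree + 1)) => hq2 d)
  rwa [Finset.sum_sub_distrib, sum_homogeneousComponent f] at this
end
end MacAux


namespace MacAux
open MvPolynomial Macaulay

theorem degree_fin3 (d : Fin 3 →₀ ℕ) : d.degree = d 0 + d 1 + d 2 := by
  rw [Finsupp.degree_eq_sum, Fin.sum_univ_three]

theorem toExp_apply {D : ℕ} (v : Fin 3 → Fin (D + 1)) (t : Fin 3) : toExp v t = (v t : ℕ) := rfl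

theorem toExp_degree {D : ℕ} (v : Mon D) : (toExp v.1).degree = D := by
  rw [degree_fin3]; exact v.2

theorem toExp_inj {D : ℕ} : Function.Injective (fun v : Mon D => toExp v.1) := by
  intro v w h
  apply Subtype.ext
  funext t
  apply Fin.ext
  exact DFunLike.congr_fun h t

theorem exists_toExp {D : ℕ} (d : Fin 3 →₀ ℕ) (hd : d.degree = D) : ∃ v : Mon D, toExp v.1 = d := by
  rw [degree_fin3] at hd
  refine ⟨⟨fun t => ⟨d t, ?_⟩, hd⟩, ?_⟩
  · fin_cases t <;> simp <;> omega
  · ext t; rfl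

/-- coefficient vector -/
noncomputable def vec {F : Type*} [CommRing F] (D : ℕ) :
    MvPolynomial (Fin 3) F →ₗ[F] (Mon D → F) :=
  LinearMap.pi fun ν => lcoeff F (toExp ν.1)

theorem vec_apply {F : Type*} [CommRing F] (D : ℕ) (f : MvPolynomial (Fin 3) F) (ν : Mon D) :
    vec D f ν = coeff (toExp ν.1) f := rfl

theorem vec_inj {F : Type*} [CommRing F] (D : ℕ) (f h : MvPolynomial (Fin 3) F)
    (hf : f.IsHomogeneous D) (hh : h.IsHomogeneous D) (hv : vec D f = vec D h) : f = h := by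
  ext d
  by_cases hd : d.degree = D
  · obtain ⟨v, rfl⟩ := exists_toExp d hd
    exact congrFun hv v
  · rw [hf.coeff_eq_zero (by exact hd), hh.coeff_eq_zero (by exact hd)]

theorem mon_hom {F : Type*} [CommRing F] {D : ℕ} (ν : Mon D) (a : F) :
    (monomial (toExp ν.1) a).IsHomogeneous D :=
  isHomogeneous_monomial _ (toExp_degree ν)

theorem pol_vec {F : Type*} [CommRing F] (D : ℕ) (f : MvPolynomial (Fin 3) F)
    (hf : f.IsHomogeneous D) : f = ∑ ν : Mon D, coeff (toExp ν.1) f • monomial (toExp ν.1) (1 : F) := by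
  apply vec_inj D f _ hf
  · refine IsHomogeneous.sum _ _ _ fun ν _ => ?_
    rw [smul_monomial]
    exact mon_hom ν _
  · funext ν
    rw [vec_apply, vec_apply, coeff_sum, Finset.sum_eq_single ν]
    · simp
    · intro μ _ hμ
      rw [coeff_smul, coeff_monomial, if_neg (fun h => hμ (toExp_inj h)), smul_zero]
    · simp

theorem card_Mon (D : ℕ) : Fintype.card (Mon D) = Nat.choose (D + 2) 2 := by
  have h1 : Fintype.card (Mon D) = (Finset.finsuppAntidiag (Finset.univ : Finset (Fin 3)) D).card := by
    rw [← Finset.card_univ]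
    refine Finset.card_bij (fun v _ => toExp v.1) ?_ (fun a _ b _ h => toExp_inj h) ?_
    · intro v _
      rw [Finset.mem_finsuppAntidiag]
      refine ⟨?_, Finset.subset_univ _⟩
      rw [Fin.sum_univ_three]; exact v.2
    · intro d hd
      rw [Finset.mem_finsuppAntidiag, Fin.sum_univ_three] at hd
      obtain ⟨v, hv⟩ := exists_toExp d ((degree_fin3 d).trans hd.1)
      exact ⟨v, Finset.mem_univ _, hv⟩
  rw [h1, Finset.card_finsuppAntidiag_nat_eq_choose, Finset.card_univ, Fintype.card_fin]
  have h2 : 3 + D - 1 = D + 2 := by omega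
  rw [h2, ← Nat.choose_symm_add]

section

theorem det_norm
    {E : Type*} [Field E] [IsAlgClosed E] {m : ℕ} (hm : 1 ≤ m) (u : Fin 3 → E)
    (hu : u 0 ≠ 0) (g : Fin m → MvPolynomial (Fin 3) E)
    (γ : ℕ → ℕ) (hg : ∀ i : Fin m, (g i).IsHomogeneous (γ i)) (hγ : ∀ i < m, 1 ≤ γ i)
    (hanti : ∀ i j, i ≤ j → j < m → γ j ≤ γ i)
    (hz : ∀ ξ : Fin 3 → E, ξ ≠ 0 → (∀ i, eval ξ (g i) = 0) → eval ξ (lin u) ≠ 0)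
    (D : ℕ) (hD : D = γ 0 + ∑ l ∈ Finset.Icc 1 (min 2 (m-1)), (γ l - 1))
    (p : Mon D → Prop) (col : (Fin 3 → E) → Mon D → MvPolynomial (Fin 3) E)
    (κ : Mon D → MvPolynomial (Fin 3) E)
    (hhom : ∀ w μ, (col w μ).IsHomogeneous D)
    (hp : ∀ w μ, p μ → col w μ = col u μ)
    (hpI : ∀ μ, p μ → col u μ ∈ Ideal.span (Set.range g))
    (hnp : ∀ w μ, ¬ p μ → col w μ = κ μ * lin w)
    (hspan : ∀ f : MvPolynomial (Fin 3) E, f.IsHomogeneous D → f ∈ Ideal.span (Set.range g) →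
      f ∈ Submodule.span E (col u '' {μ | p μ}))
    (Δ : (Fin 3 → E) → Matrix (Mon D) (Mon D) E)
    (hΔ : ∀ w ν μ, Δ w ν μ = coeff (toExp ν.1) (col w μ))
    (hdet : (Δ u).det ≠ 0) :
    FiniteDimensional E (MvPolynomial (Fin 3) E ⧸ affI (Ideal.span (Set.range g)) u) ∧
    ∀ w, (Δ w).det = (Δ u).det *
      Algebra.norm E (Ideal.Quotient.mk (affI (Ideal.span (Set.range g)) u) (lin w)) := by
  classical
  set I := Ideal.span (Set.range g) with hI
  set mk := Ideal.Quotient.mkₐ E (affI I u) with hmk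
  have hunit : IsUnit (Δ u).det := isUnit_iff_ne_zero.2 hdet
  have hlin : mk (lin u) = 1 := by
    rw [← sub_eq_zero, ← map_one mk, ← map_sub]
    exact Ideal.Quotient.eq_zero_iff_mem.2 (Ideal.mem_sup_right (Ideal.subset_span rfl))
  -- expansion of homogeneous polynomials
  have hexp : ∀ f : MvPolynomial (Fin 3) E, f.IsHomogeneous D →
      f = ∑ μ, ((Δ u)⁻¹.mulVec (vec D f)) μ • col u μ := by
    intro f hf
    apply vec_inj D f _ hf
    · refine IsHomogeneous.sum _ _ _ fun ν _ => ?_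
      rw [smul_eq_C_mul]
      simpa using (isHomogeneous_C (Fin 3) _).mul (hhom u ν)
    · rw [map_sum]
      have h1 : ∀ x : Mon D → E, ∑ μ, vec D (x μ • col u μ) = (Δ u).mulVec x := by
        intro x
        funext ν
        simp only [map_smul, Finset.sum_apply, Pi.smul_apply, vec_apply, smul_eq_mul,
          Matrix.mulVec, dotProduct, hΔ]
        exact Finset.sum_congr rfl fun _ _ => mul_comm _ _
      rw [h1, Matrix.mulVec_mulVec, Matrix.mul_nonsing_inv _ hunit, Matrix.one_mulVec]
  -- uniqueness
  have huniq : ∀ x : Mon D → E, ∑ μ, x μ • col u μ = 0 → x = 0 := by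
    intro x hx
    have h1 : (Δ u).mulVec x = 0 := by
      have := congrArg (vec D) hx
      rw [map_sum, map_zero] at this
      rw [← this]
      funext ν
      simp only [map_smul, Finset.sum_apply, Pi.smul_apply, vec_apply, smul_eq_mul,
        Matrix.mulVec, dotProduct, hΔ]
      exact Finset.sum_congr rfl fun _ _ => mul_comm _ _
    exact Matrix.eq_zero_of_mulVec_eq_zero hdet h1
  have hmkp : ∀ μ, p μ → mk (col u μ) = 0 := fun μ hμ =>
    Ideal.Quotient.eq_zero_iff_mem.2 (Ideal.mem_sup_left (hpI μ hμ))
  have hmkn : ∀ w μ, ¬ p μ → mk (col w μ) = mk (lin w) * mk (κ μ) := fun w μ hμ => by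
    rw [hnp w μ hμ, map_mul, mul_comm]
  have hsum : ∀ x : Mon D → E, mk (∑ μ, x μ • col u μ) =
      ∑ μ : {μ // ¬ p μ}, x μ • mk (κ μ) := by
    intro x
    rw [map_sum, ← Fintype.sum_subtype_add_sum_subtype p]
    rw [Finset.sum_eq_zero, zero_add]
    · refine Finset.sum_congr rfl fun μ _ => ?_
      rw [map_smul, hmkn u μ μ.2, hlin, one_mul]
    · intro μ _
      rw [map_smul, hmkp μ μ.2, smul_zero]
  have hLI : LinearIndependent E (fun μ : {μ // ¬ p μ} => mk (κ μ)) := by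
    rw [Fintype.linearIndependent_iff]
    intro y hy
    let x : Mon D → E := fun μ => if h : p μ then 0 else y ⟨μ, h⟩
    have hx : ∀ μ : {μ // ¬ p μ}, x μ = y μ := fun μ => dif_neg μ.2
    have h1 : mk (∑ μ, x μ • col u μ) = 0 := by
      rw [hsum, ← hy]
      exact Finset.sum_congr rfl fun μ _ => by rw [hx]
    have h2 : (∑ μ, x μ • col u μ).IsHomogeneous D := by
      refine IsHomogeneous.sum _ _ _ fun ν _ => ?_
      rw [smul_eq_C_mul]
      simpa using (isHomogeneous_C (Fin 3) _).mul (hhom u ν)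
    have h3 := hspan _ h2 (sat_main hm u hu g γ hg hγ hanti hz D hD _ h2
      (Ideal.Quotient.eq_zero_iff_mem.1 h1))
    have h4 : ∃ z : Mon D → E, (∀ μ, ¬ p μ → z μ = 0) ∧
        ∑ μ, x μ • col u μ = ∑ μ, z μ • col u μ := by
      rw [Finsupp.mem_span_image_iff_linearCombination] at h3
      obtain ⟨l, hl, hx⟩ := h3
      refine ⟨l, fun μ hμ => ?_, ?_⟩
      · rw [Finsupp.mem_supported] at hl
        by_contra hne
        exact hμ (hl (Finsupp.mem_support_iff.2 hne))
      · rw [← hx, Finsupp.linearCombination_apply, Finsupp.sum_fintype]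
        simp
    obtain ⟨z, hz1, hz2⟩ := h4
    have h5 := huniq (x - z) (by
      simp only [Pi.sub_apply, sub_smul, Finset.sum_sub_distrib, hz2, sub_self])
    intro μ
    have h6 := congrFun h5 μ
    simp only [Pi.sub_apply, Pi.zero_apply, hz1 μ μ.2, sub_zero] at h6
    rw [← hx, h6]
  have hsp : ⊤ ≤ Submodule.span E (Set.range fun μ : {μ // ¬ p μ} => mk (κ μ)) := by
    intro a _
    obtain ⟨f, rfl⟩ := Ideal.Quotient.mkₐ_surjective E (affI I u) a
    obtain ⟨q, hq, hq2⟩ := reduce_any hm u hu g γ hg hγ hanti hz D hD f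
    have h1 : Ideal.Quotient.mkₐ E (affI I u) f = mk q := Ideal.Quotient.eq.2 hq2
    rw [h1, hexp q hq, hsum]
    exact Submodule.sum_mem _ fun μ _ => Submodule.smul_mem _ _ (Submodule.subset_span ⟨μ, rfl⟩)
  let b := Module.Basis.mk hLI hsp
  refine ⟨b.finiteDimensional_of_finite, fun w => ?_⟩
  let P := (Δ u)⁻¹ * Δ w
  have hP : Δ w = Δ u * P := by
    rw [← Matrix.mul_assoc, Matrix.mul_nonsing_inv _ hunit, Matrix.one_mul]
  have hPcol : ∀ μ, col w μ = ∑ ν, P ν μ • col u ν := by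
    intro μ
    have h1 := hexp (col w μ) (hhom w μ)
    have h2 : ∀ ν, ((Δ u)⁻¹.mulVec (vec D (col w μ))) ν = P ν μ := by
      intro ν
      simp only [P, Matrix.mulVec, dotProduct, Matrix.mul_apply, hΔ, vec_apply]
    simp only [h2] at h1
    exact h1
  have hPp : ∀ μ, p μ → ∀ ν, P ν μ = if ν = μ then 1 else 0 := by
    intro μ hμ ν
    have h1 := hPcol μ
    rw [hp w μ hμ] at h1
    have h2 := huniq (fun ν => P ν μ - if ν = μ then 1 else 0) (by
      simp only [sub_smul, Finset.sum_sub_distrib, ← h1]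
      simp)
    exact sub_eq_zero.1 (congrFun h2 ν)
  rw [hP, Matrix.det_mul]
  congr 1
  rw [Matrix.twoBlockTriangular_det P p (fun i hi j hj => by
    rw [hPp j hj, if_neg]; rintro rfl; exact hi hj)]
  have hone : P.toSquareBlockProp p = 1 := by
    ext i j
    rw [Matrix.toSquareBlockProp_def, Matrix.of_apply, hPp j j.2, Matrix.one_apply]
    simp [Subtype.ext_iff]
  rw [hone, Matrix.det_one, one_mul, Algebra.norm_eq_matrix_det b]
  congr 1
  ext ν μ
  rw [Algebra.leftMulMatrix_eq_repr_mul]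
  have hbμ : ∀ μ, b μ = mk (κ μ) := fun μ => by simp [b]
  have h1 : (Ideal.Quotient.mk (affI I u)) (lin w) * b μ = ∑ ν : {μ // ¬ p μ}, P ν μ • b ν := by
    simp only [hbμ]
    rw [← hsum (fun ν => P ν μ), ← hPcol, hmkn w μ μ.2]
    rfl
  rw [h1, b.repr_sum_self]
  rfl
end
end MacAux


namespace MacAux
open MvPolynomial Macaulay

theorem factor_norm {E : Type*} [Field E] [IsAlgClosed E] {m : ℕ} (u : Fin 3 → E)
    (g : Fin m → MvPolynomial (Fin 3) E)
    (γ : ℕ → ℕ) (hg : ∀ i : Fin m, (g i).IsHomogeneous (γ i))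
    (hfd : FiniteDimensional E (MvPolynomial (Fin 3) E ⧸ affI (Ideal.span (Set.range g)) u)) :
    ∃ zs : Multiset (Fin 3 → E),
      (∀ w, Algebra.norm E (Ideal.Quotient.mk (affI (Ideal.span (Set.range g)) u) (lin w)) =
        (zs.map fun ξ => ∑ t, ξ t * w t).prod) ∧
      (∀ ξ ∈ zs, ξ ≠ 0 ∧ ∀ i, eval ξ (g i) = 0) ∧
      (∀ ξ ∈ zs, mcountP (fun w => ∃ t : E, w = t • ξ) zs =
        projMult E (Ideal.span (Set.range g)) ξ) := by
  classical
  set I := Ideal.span (Set.range g) with hI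
  have : IsArtinianRing (MvPolynomial (Fin 3) E ⧸ affI I u) := IsArtinianRing.of_finite E _
  have : Fintype (MaximalSpectrum (MvPolynomial (Fin 3) E ⧸ affI I u)) := Fintype.ofFinite _
  obtain ⟨χ, hχ, hnorm⟩ := norm_formula (E := E) (A := MvPolynomial (Fin 3) E ⧸ affI I u)
  let pt : MaximalSpectrum (MvPolynomial (Fin 3) E ⧸ affI I u) → Fin 3 → E :=
    fun M t => χ M (Ideal.Quotient.mk _ (X t))
  let n : MaximalSpectrum (MvPolynomial (Fin 3) E ⧸ affI I u) → ℕ := fun M =>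
    ⨆ N : ℕ, Module.finrank E ((MvPolynomial (Fin 3) E ⧸ affI I u) ⧸ (RingHom.ker (χ M)) ^ N)
  have hev : ∀ M f, χ M (Ideal.Quotient.mk _ f) = eval (pt M) f := by
    intro M f
    have : (χ M).comp (Ideal.Quotient.mkₐ E (affI I u)) = aeval (pt M) := by
      apply MvPolynomial.algHom_ext
      intro t
      rw [aeval_X]
      rfl
    rw [← MvPolynomial.coe_aeval_eq_eval, ← this]
    rfl
  have hker : ∀ M, ∀ f ∈ affI I u, eval (pt M) f = 0 := by
    intro M f hf
    rw [← hev, Ideal.Quotient.eq_zero_iff_mem.2 hf, map_zero]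
  have h1 : ∀ M, eval (pt M) (lin u) = 1 := by
    intro M
    have := hker M (lin u - 1) (Ideal.mem_sup_right (Ideal.subset_span rfl))
    rw [map_sub, map_one, sub_eq_zero] at this
    exact this
  have hg0 : ∀ M i, eval (pt M) (g i) = 0 := fun M i =>
    hker M _ (Ideal.mem_sup_left (Ideal.subset_span ⟨i, rfl⟩))
  have hne : ∀ M, pt M ≠ 0 := by
    intro M h
    have := h1 M
    rw [h] at this
    simp [lin] at this
  have hinj : ∀ M M' : MaximalSpectrum (MvPolynomial (Fin 3) E ⧸ affI I u),
      (∃ t : E, pt M = t • pt M') → M = M' := by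
    rintro M M' ⟨t, ht⟩
    have h2 : t = 1 := by
      have h3 := hom_scale (lin u) 1 (lin_hom u) t (pt M')
      rw [aeval_eq_eval, aeval_eq_eval] at h3
      have h4 : (fun i => t * pt M' i) = pt M := by rw [ht]; rfl
      rw [h4] at h3
      rw [h1, h1] at h3
      simpa using h3.symm
    rw [h2, one_smul] at ht
    have h3 : χ M = χ M' := by
      apply AlgHom.ext
      intro x
      obtain ⟨f, rfl⟩ := Ideal.Quotient.mk_surjective x
      rw [hev, hev, ht]
    have h4 := hχ M
    rw [h3, hχ M'] at h4
    exact MaximalSpectrum.ext h4.symm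
  have hmem : ∀ ξ, ξ ∈ ∑ M, Multiset.replicate (n M) (pt M) → ∃ M, ξ = pt M := by
    intro ξ hξ
    rw [Multiset.mem_sum] at hξ
    obtain ⟨M, _, hM⟩ := hξ
    exact ⟨M, Multiset.eq_of_mem_replicate hM⟩
  refine ⟨∑ M, Multiset.replicate (n M) (pt M), ?_, ?_, ?_⟩
  · intro w
    rw [hnorm]
    rw [← Multiset.coe_mapAddMonoidHom, map_sum, Multiset.prod_sum]
    refine Finset.prod_congr rfl fun M _ => ?_
    rw [Multiset.coe_mapAddMonoidHom, Multiset.map_replicate, Multiset.prod_replicate, hev]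
    congr 1
    simp [lin, mul_comm]
  · intro ξ hξ
    obtain ⟨M, rfl⟩ := hmem ξ hξ
    exact ⟨hne M, hg0 M⟩
  · intro ξ hξ
    obtain ⟨M, rfl⟩ := hmem ξ hξ
    rw [projMult_eq g γ hg u (pt M) (h1 M)]
    have hn : n M = ⨆ N : ℕ, Module.finrank E (MvPolynomial (Fin 3) E ⧸ qI I u (pt M) N) :=
      iSup_congr fun N => finrank_ker I u (χ M) N
    rw [← hn]
    unfold mcountP
    rw [← Multiset.coe_countPAddMonoidHom, map_sum, Finset.sum_eq_single M]
    · rw [Multiset.coe_countPAddMonoidHom, Multiset.countP_eq_card.2, Multiset.card_replicate]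
      intro a ha
      rw [Multiset.eq_of_mem_replicate ha]
      exact ⟨1, (one_smul _ _).symm⟩
    · intro M' _ hM'
      rw [Multiset.coe_countPAddMonoidHom, Multiset.countP_eq_zero]
      intro a ha h
      rw [Multiset.eq_of_mem_replicate ha] at h
      exact hM' (hinj M' M h)
    · simp
end MacAux


namespace MacAux
open MvPolynomial Macaulay

theorem exists_good {E : Type*} [Field E] [IsAlgClosed E] (s : Finset (Fin 3 → E))
    (P : MvPolynomial (Fin 3) E) (hP : P ≠ 0) :
    ∃ u : Fin 3 → E, u 0 ≠ 0 ∧ eval u P ≠ 0 ∧ ∀ v ∈ s, v ≠ 0 → eval v (lin u) ≠ 0 := by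
  classical
  have : Infinite E := IsAlgClosed.instInfinite
  have hlin : ∀ v : Fin 3 → E, v ≠ 0 → lin v ≠ 0 := by
    intro v hv h
    apply hv
    funext t
    have := congrArg (eval (Pi.single t (1 : E))) h
    simpa [lin, Pi.single_apply] using this
  have hQ : X 0 * P * ∏ v ∈ s.filter (· ≠ 0), lin v ≠ 0 := by
    refine mul_ne_zero (mul_ne_zero (X_ne_zero _) hP) (Finset.prod_ne_zero_iff.2 fun v hv => ?_)
    exact hlin v (Finset.mem_filter.1 hv).2
  obtain ⟨u, hu⟩ : ∃ u, eval u (X 0 * P * ∏ v ∈ s.filter (· ≠ 0), lin v) ≠ 0 := by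
    by_contra! h
    exact hQ (MvPolynomial.funext fun u => by rw [h u, map_zero])
  rw [map_mul, map_mul, map_prod, eval_X] at hu
  refine ⟨u, left_ne_zero_of_mul (left_ne_zero_of_mul hu),
    right_ne_zero_of_mul (left_ne_zero_of_mul hu), fun v hv hv0 => ?_⟩
  have := Finset.prod_ne_zero_iff.1 (right_ne_zero_of_mul hu) v (Finset.mem_filter.2 ⟨hv, hv0⟩)
  simpa [lin, mul_comm] using this

section
variable {K : Type*} [Field K] (E : Type*) [Field E] [Algebra K E]
    (m : ℕ) (g : Fin m → MvPolynomial (Fin 3) K) (γ : ℕ → ℕ) (D : ℕ)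

/-- specialized system -/
noncomputable def GE (w : Fin 3 → E) (i : Fin (m + 1)) : MvPolynomial (Fin 3) E :=
  MvPolynomial.map (aeval w : UR K →ₐ[K] E).toRingHom (bigG m g i)

/-- specialized column -/
noncomputable def colE (w : Fin 3 → E) (c : Σ l : Fin (m + 1), Mon (D - γ (l : ℕ))) :
    MvPolynomial (Fin 3) E :=
  monomial (toExp c.2.1) 1 * GE E m g w c.1

theorem GE_lt (w : Fin 3 → E) (i : Fin (m + 1)) (h : (i : ℕ) < m) :
    GE E m g w i = MvPolynomial.map (algebraMap K E) (g ⟨i, h⟩) := by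
  rw [GE, bigG, dif_pos h, MvPolynomial.map_map]
  congr 1
  congr 1
  ext x
  simp

theorem GE_last (w : Fin 3 → E) : GE E m g w (Fin.last m) = lin w := by
  rw [GE, bigG, dif_neg (by simp)]
  simp [lin]

theorem lt_of_ne_last {i : Fin (m + 1)} (h : i ≠ Fin.last m) : (i : ℕ) < m :=
  Fin.val_lt_last h

theorem entry_spec (w : Fin 3 → E) (ν : Mon D) (c : Σ l : Fin (m + 1), Mon (D - γ (l : ℕ))) :
    aeval w (macaulayMatrix m g γ D ν c) = coeff (toExp ν.1) (colE E m g γ D w c) := by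
  have : colE E m g γ D w c = MvPolynomial.map (aeval w : UR K →ₐ[K] E).toRingHom
      (monomial (toExp c.2.1) (1 : UR K) * bigG m g c.1) := by
    rw [map_mul, map_monomial, map_one]; rfl
  rw [this, coeff_map]
  rfl

theorem entry_num (ν : Mon D) (c : Σ l : Fin (m + 1), Mon (D - γ (l : ℕ)))
    (h : c.1 ≠ Fin.last m) : ∃ k : K, macaulayMatrix m g γ D ν c = C k := by
  refine ⟨coeff (toExp ν.1) (monomial (toExp c.2.1) (1 : K) * g ⟨c.1, lt_of_ne_last m h⟩), ?_⟩
  rw [← coeff_map, map_mul, map_monomial, map_one, macaulayMatrix, bigG,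
    dif_pos (lt_of_ne_last m h)]

variable {E}

theorem lin_hom' (w : Fin 3 → E) : (lin w).IsHomogeneous 1 := lin_hom w

theorem GE_hom (hhom : ∀ i : Fin m, (g i).IsHomogeneous (γ (i : ℕ))) (hγm : γ m = 1)
    (w : Fin 3 → E) (i : Fin (m + 1)) : (GE E m g w i).IsHomogeneous (γ i) := by
  by_cases h : i = Fin.last m
  · subst h
    rw [GE_last, Fin.val_last, hγm]
    exact lin_hom w
  · rw [GE_lt E m g w i (lt_of_ne_last m h)]
    exact (hhom ⟨i, lt_of_ne_last m h⟩).map _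

theorem colE_hom (hhom : ∀ i : Fin m, (g i).IsHomogeneous (γ (i : ℕ))) (hγm : γ m = 1) (hle : ∀ i ≤ m, γ i ≤ D)
    (w : Fin 3 → E) (c : Σ l : Fin (m + 1), Mon (D - γ (l : ℕ))) :
    (colE E m g γ D w c).IsHomogeneous D := by
  have h := (mon_hom c.2 (1 : E)).mul (GE_hom m g γ hhom hγm w c.1)
  rwa [Nat.sub_add_cancel (hle c.1 (Nat.lt_succ_iff.1 c.1.2))] at h

theorem span_block (w : Fin 3 → E) (l : Fin (m + 1)) (a : MvPolynomial (Fin 3) E)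
    (ha : a.IsHomogeneous (D - γ l)) :
    a * GE E m g w l ∈ Submodule.span E (Set.range fun κ : Mon (D - γ (l : ℕ)) =>
      colE E m g γ D w ⟨l, κ⟩) := by
  rw [pol_vec _ a ha, Finset.sum_mul]
  refine Submodule.sum_mem _ fun κ _ => ?_
  rw [smul_mul_assoc]
  exact Submodule.smul_mem _ _ (Submodule.subset_span ⟨κ, rfl⟩)

theorem span_num (hhom : ∀ i : Fin m, (g i).IsHomogeneous (γ (i : ℕ)))
    (u : Fin 3 → E) (f : MvPolynomial (Fin 3) E) (hf : f.IsHomogeneous D)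
    (hI : f ∈ Ideal.span (Set.range fun i : Fin m => MvPolynomial.map (algebraMap K E) (g i))) :
    f ∈ Submodule.span E (colE E m g γ D u '' {c | c.1 ≠ Fin.last m}) := by
  obtain ⟨a, hfa, ha1, ha2⟩ := homog_repr
    (fun i : Fin m => MvPolynomial.map (algebraMap K E) (g i)) (fun i => γ i)
    (fun i => (hhom i).map _) f D hf hI
  rw [hfa]
  refine Submodule.sum_mem _ fun i _ => ?_
  by_cases hi : γ i ≤ D
  · have h1 := span_block m g γ D u i.castSucc (a i) (ha1 i hi)
    rw [GE_lt E m g u i.castSucc i.2] at h1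
    refine Submodule.span_mono ?_ h1
    rintro _ ⟨κ, rfl⟩
    exact ⟨⟨i.castSucc, κ⟩, (Fin.castSucc_lt_last i).ne, rfl⟩
  · rw [ha2 i hi, zero_mul]
    exact Submodule.zero_mem _

theorem span_all (hhom : ∀ i : Fin m, (g i).IsHomogeneous (γ (i : ℕ))) (hγm : γ m = 1) (hle : ∀ i ≤ m, γ i ≤ D)
    [IsAlgClosed E] (hm : 1 ≤ m) (u : Fin 3 → E) (hu : u 0 ≠ 0)
    (hγ : ∀ i < m, 1 ≤ γ i) (hanti : ∀ i j, i ≤ j → j < m → γ j ≤ γ i)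
    (hz : ∀ ξ : Fin 3 → E, ξ ≠ 0 → (∀ i, eval ξ (MvPolynomial.map (algebraMap K E) (g i)) = 0) →
      eval ξ (lin u) ≠ 0)
    (hD : D = γ 0 + ∑ l ∈ Finset.Icc 1 (min 2 (m-1)), (γ l - 1))
    (f : MvPolynomial (Fin 3) E) (hf : f.IsHomogeneous D) :
    f ∈ Submodule.span E (Set.range (colE E m g γ D u)) := by
  obtain ⟨q, hq, hq2⟩ := (main_ab hm u hu (fun i : Fin m => MvPolynomial.map (algebraMap K E) (g i))
    γ (fun i => (hhom i).map _) hγ hanti hz D hD D le_rfl f hf).1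
  have hD1 : 1 ≤ D := hγm ▸ hle m le_rfl
  have h1 : (lin u * q).IsHomogeneous D := by
    have := (lin_hom u).mul hq
    rwa [Nat.add_sub_cancel' hD1] at this
  have h2 := span_num m g γ D hhom u _ (hf.sub h1) hq2
  have hq' : q.IsHomogeneous (D - γ (Fin.last m : Fin (m+1))) := by
    rw [Fin.val_last, hγm]; exact hq
  have h3 := span_block m g γ D u (Fin.last m) q hq'
  rw [GE_last, mul_comm] at h3
  rw [← sub_add_cancel f (lin u * q)]
  refine Submodule.add_mem _ (Submodule.span_mono (Set.image_subset_range _ _) h2)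
    (Submodule.span_mono ?_ h3)
  rintro _ ⟨κ, rfl⟩
  exact ⟨_, rfl⟩

theorem det_spec (e : Mon D → (Σ l : Fin (m + 1), Mon (D - γ (l : ℕ)))) (w : Fin 3 → E) :
    (Matrix.of fun ν μ => coeff (toExp ν.1) (colE E m g γ D w (e μ)) : Matrix (Mon D) (Mon D) E).det
      = eval w (MvPolynomial.map (algebraMap K E)
        (((macaulayMatrix m g γ D).submatrix id e).det)) := by
  rw [eval_map, ← aeval_def, AlgHom.map_det]
  congr 1
  ext ν μ
  simp [entry_spec]

end
end MacAux


namespace MacAux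
open MvPolynomial Macaulay

theorem exists_pol {F : Type*} [CommRing F] (D : ℕ) (v : Mon D → F) :
    ∃ f : MvPolynomial (Fin 3) F, f.IsHomogeneous D ∧ vec D f = v := by
  refine ⟨∑ ν : Mon D, monomial (toExp ν.1) (v ν), ?_, ?_⟩
  · refine IsHomogeneous.sum _ _ _ fun ν _ => ?_
    exact mon_hom ν _
  funext ν
  rw [vec_apply, coeff_sum, Finset.sum_eq_single ν]
  · simp
  · intro μ _ hμ
    rw [coeff_monomial, if_neg (fun h => hμ (toExp_inj h))]
  · simp

theorem exists_minor {E ι : Type*} [Field E] {n : Type*} [Fintype n] [DecidableEq n]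
    (v : ι → n → E) (hv : Submodule.span E (Set.range v) = ⊤) :
    ∃ e : n → ι, (Matrix.of fun i j => v (e j) i : Matrix n n E).det ≠ 0 := by
  obtain ⟨κ, a, _, hsp, hli⟩ := exists_linearIndependent' E v
  let b := Module.Basis.mk hli (by rw [hsp, hv])
  let eq : n ≃ κ := (Pi.basisFun E n).indexEquiv b
  refine ⟨fun i => a (eq i), ?_⟩
  rw [← isUnit_iff_ne_zero, ← Matrix.isUnit_iff_isUnit_det,
    ← Matrix.linearIndependent_cols_iff_isUnit]
  exact hli.comp eq eq.injective

theorem num_span_aux {K F n ι : Type*} [Field K] [Field F] [Algebra K F] [Fintype n]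
    [DecidableEq n] [Fintype ι] (A : Matrix n ι F) (e : n → ι) (p : ι → Prop) [DecidablePred p]
    (hunit : IsUnit (A.submatrix id e))
    (hcard : (Finset.univ.filter fun ν : n => p (e ν)).card =
      (A.submatrix id (fun c : {c // p c} => c.1)).rank)
    (hk : ∀ ν c, p c → ∃ k : K, A ν c = algebraMap K F k) (c : ι) (hc : p c) :
    ∃ a : {μ : n // p (e μ)} → K, ∀ ν,
      A ν c = ∑ μ, algebraMap K F (a μ) * A ν (e μ) := by
  classical
  have hli0 := Matrix.linearIndependent_cols_iff_isUnit.2 hunit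
  let v : {μ : n // p (e μ)} → n → F := fun μ ν => A ν (e μ)
  have hli : LinearIndependent F v := 
    hli0.comp (Subtype.val : {μ : n // p (e μ)} → n) Subtype.val_injective
  have hW : Submodule.span F (Set.range v) =
      Submodule.span F (Set.range (A.submatrix id (fun c : {c // p c} => c.1)).col) := by
    apply Submodule.eq_of_le_of_finrank_eq
    · apply Submodule.span_mono
      rintro _ ⟨μ, rfl⟩
      exact ⟨⟨e μ, μ.2⟩, rfl⟩
    · rw [finrank_span_eq_card hli, Fintype.card_subtype, hcard, Matrix.rank_eq_finrank_span_cols]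
  have hcW : (fun ν => A ν c) ∈
      Submodule.span F (Set.range (A.submatrix id (fun c : {c // p c} => c.1)).col) :=
    Submodule.subset_span ⟨⟨c, hc⟩, rfl⟩
  rw [← hW, Submodule.mem_span_range_iff_exists_fun] at hcW
  obtain ⟨f, hf⟩ := hcW
  obtain ⟨π, hπ⟩ := LinearMap.exists_leftInverse_of_injective (Algebra.linearMap K F)
    (LinearMap.ker_eq_bot.2 (algebraMap K F).injective)
  have hπ' : ∀ x : K, π (algebraMap K F x) = x := fun x => LinearMap.congr_fun hπ x
  refine ⟨fun μ => π (f μ), fun ν => ?_⟩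
  have h1 := congrFun hf ν
  simp only [Finset.sum_apply, Pi.smul_apply, smul_eq_mul, v] at h1
  obtain ⟨k, hk2⟩ := hk ν c hc
  have hk' := fun μ : {μ : n // p (e μ)} => hk ν (e μ) μ.2
  choose k' hk2' using hk'
  simp only [hk2', hk2] at h1 ⊢
  have h2 := congrArg π h1
  rw [map_sum, hπ'] at h2
  rw [← h2, map_sum]
  refine Finset.sum_congr rfl fun μ _ => ?_
  rw [← map_mul, mul_comm (f μ), ← Algebra.smul_def, map_smul, smul_eq_mul, mul_comm]

theorem map_isUnit {R F n ι : Type*} [CommRing R] [Field F] [Algebra R F] [Fintype n]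
    [DecidableEq n] (hinj : Function.Injective (algebraMap R F)) (A : Matrix n ι R) (e : n → ι)
    (h : (A.submatrix id e).det ≠ 0) : IsUnit ((A.map (algebraMap R F)).submatrix id e) := by
  have h1 : (A.map (algebraMap R F)).submatrix id e =
    (algebraMap R F).mapMatrix (A.submatrix id e) := rfl
  rw [Matrix.isUnit_iff_isUnit_det, isUnit_iff_ne_zero, h1, ← RingHom.map_det]
  intro h0
  exact h (hinj (h0.trans (map_zero _).symm))

theorem num_span_aux2 {K R F n ι : Type*} [Field K] [CommRing R] [Field F] [Algebra K F]
    [Algebra K R] [Algebra R F] [IsScalarTower K R F] (hinj : Function.Injective (algebraMap R F))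
    [Fintype n] [DecidableEq n] [Fintype ι] (A : Matrix n ι R) (e : n → ι) (p : ι → Prop)
    [DecidablePred p] (h : (A.submatrix id e).det ≠ 0)
    (hcard : (Finset.univ.filter fun ν : n => p (e ν)).card =
      ((A.submatrix id (fun c : {c // p c} => c.1)).map (algebraMap R F)).rank)
    (hk : ∀ ν c, p c → ∃ k : K, A ν c = algebraMap K R k) (c : ι) (hc : p c) :
    ∃ a : {μ : n // p (e μ)} → K, ∀ ν,
      A ν c = ∑ μ, algebraMap K R (a μ) * A ν (e μ) := by
  obtain ⟨a, ha⟩ := num_span_aux (K := K) (A.map (algebraMap R F)) e p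
    (map_isUnit hinj A e h) hcard (fun ν c hc => by
      obtain ⟨k, hk⟩ := hk ν c hc
      exact ⟨k, by rw [Matrix.map_apply, hk, ← IsScalarTower.algebraMap_apply]⟩) c hc
  refine ⟨a, fun ν => hinj ?_⟩
  have h2 := ha ν
  simp only [Matrix.map_apply] at h2
  rw [h2, map_sum]
  refine Finset.sum_congr rfl fun μ _ => ?_
  rw [map_mul, ← IsScalarTower.algebraMap_apply]

section
variable {K : Type*} [Field K] {E : Type*} [Field E] [Algebra K E]
    (m : ℕ) (g : Fin m → MvPolynomial (Fin 3) K) (γ : ℕ → ℕ) (D : ℕ)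

theorem rank_part (u : Fin 3 → E)
    (h : ∀ f : MvPolynomial (Fin 3) E, f.IsHomogeneous D →
      f ∈ Submodule.span E (Set.range (colE E m g γ D u))) :
    ((macaulayMatrix m g γ D).map
        (algebraMap (UR K) (FractionRing (UR K)))).rank = Nat.choose (D + 2) 2 := by
  obtain ⟨e, he⟩ := exists_minor (fun c => vec D (colE E m g γ D u c)) (by
    rw [eq_top_iff]
    intro v _
    obtain ⟨f, hf, rfl⟩ := exists_pol D v
    have := Submodule.mem_map_of_mem (f := vec D) (h f hf)
    rwa [Submodule.map_span, ← Set.range_comp] at this)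
  have he2 : ((macaulayMatrix m g γ D).submatrix id e).det ≠ 0 := by
    intro h0
    apply he
    have := det_spec m g γ D e u
    rw [h0, map_zero, map_zero] at this
    exact this
  rw [← card_Mon]
  apply le_antisymm (Matrix.rank_le_card_height _)
  have h1 := map_isUnit (IsFractionRing.injective (UR K) (FractionRing (UR K)))
    (macaulayMatrix m g γ D) e he2
  rw [← Matrix.rank_of_isUnit _ h1]
  exact Matrix.rank_submatrix_le _ _ _

theorem num_span (e : Mon D → (Σ l : Fin (m + 1), Mon (D - γ (l : ℕ))))
    (hdet : ((macaulayMatrix m g γ D).submatrix id e).det ≠ 0)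
    (hcard : (Finset.univ.filter fun ν : Mon D => (e ν).1 ≠ Fin.last m).card =
        (((macaulayMatrix m g γ D).submatrix id
            (fun c : {c : Σ l : Fin (m + 1), Mon (D - γ (l : ℕ)) // c.1 ≠ Fin.last m} =>
              c.1)).map (algebraMap (UR K) (FractionRing (UR K)))).rank)
    (c : Σ l : Fin (m + 1), Mon (D - γ (l : ℕ))) (hc : c.1 ≠ Fin.last m) :
    ∃ a : {μ : Mon D // (e μ).1 ≠ Fin.last m} → K, ∀ ν,
      macaulayMatrix m g γ D ν c = ∑ μ, C (a μ) * macaulayMatrix m g γ D ν (e μ) := by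
  classical
  refine num_span_aux2 (K := K) (IsFractionRing.injective (UR K) (FractionRing (UR K)))
    (macaulayMatrix m g γ D) e (fun c => c.1 ≠ Fin.last m) hdet ?_
    (fun ν c hc => entry_num m g γ D ν c hc) c hc
  convert hcard

end

end MacAux

open MacAux MvPolynomial in
open Macaulay in
/-- Grigoriev's lemma on the Macaulay matrix (u-resultant): for homogeneous
`g_0, …, g_{m-1}` in `Y, Y_0, Y_1` with finitely many common projective zeros, together
with the generic linear form `g_m = Y·U + Y_0·U_0 + Y_1·U_1`, with
`D = γ_0 + Σ_{1 ≤ l ≤ min{2, m-1}} (γ_l - 1)`, the Macaulay matrix `A` has rank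
`C(D+2, 2)`, and the determinant of any nonsingular `C(D+2,2) × C(D+2,2)` submatrix `Δ`
containing `rank A^{(num)}` columns from `A^{(num)}` factors over `E` as a constant times
a product of linear forms `ξ_{i,0}U_0 + ξ_iU + ξ_{i,1}U_1`, where the `(ξ_{i,0}:ξ_i:ξ_{i,1})`
are common projective zeros of `g_0, …, g_{m-1}` occurring with their multiplicities. -/
theorem macaulay_det_factorization
    {K : Type*} [Field K] [CharZero K] (E : Type*) [Field E] [IsAlgClosed E] [Algebra K E]
    (m : ℕ) (hm : 1 ≤ m) (g : Fin m → MvPolynomial (Fin 3) K) (γ : ℕ → ℕ)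
    (hhom : ∀ i : Fin m, (g i).IsHomogeneous (γ (i : ℕ)))
    (hγm : γ m = 1)
    (hanti : ∀ i j : ℕ, i ≤ j → j ≤ m → γ j ≤ γ i)
    (hfin : ∃ s : Finset (Fin 3 → E), ∀ w : Fin 3 → E, w ≠ 0 →
      (∀ i, MvPolynomial.aeval w (g i) = 0) → ∃ v ∈ s, ∃ t : E, w = t • v)
    (D : ℕ) (hD : D = γ 0 + ∑ l ∈ Finset.Icc 1 (min 2 (m - 1)), (γ l - 1)) :
    (((macaulayMatrix m g γ D).map
        (algebraMap (UR K) (FractionRing (UR K)))).rank = Nat.choose (D + 2) 2) ∧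
    ∀ e : Mon D → (Σ l : Fin (m + 1), Mon (D - γ (l : ℕ))),
      Function.Injective e →
      ((macaulayMatrix m g γ D).submatrix id e).det ≠ 0 →
      ((Finset.univ.filter fun ν : Mon D => (e ν).1 ≠ Fin.last m).card =
        (((macaulayMatrix m g γ D).submatrix id
            (fun c : {c : Σ l : Fin (m + 1), Mon (D - γ (l : ℕ)) // c.1 ≠ Fin.last m} =>
              c.1)).map (algebraMap (UR K) (FractionRing (UR K)))).rank) →
      ∃ (c0 : E) (zs : Multiset (Fin 3 → E)),
        c0 ≠ 0 ∧
        MvPolynomial.map (algebraMap K E) (((macaulayMatrix m g γ D).submatrix id e).det)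
          = MvPolynomial.C c0 *
              (zs.map fun ξ => ∑ t : Fin 3,
                MvPolynomial.C (ξ t) * MvPolynomial.X t).prod ∧
        (∀ ξ ∈ zs, ξ ≠ (0 : Fin 3 → E) ∧ ∀ i : Fin m, MvPolynomial.aeval ξ (g i) = 0) ∧
        (∀ ξ ∈ zs, mcountP (fun w => ∃ t : E, w = t • ξ) zs =
          projMult E
            (Ideal.span (Set.range fun i : Fin m =>
              MvPolynomial.map (algebraMap K E) (g i))) ξ) := by
  classical
  obtain ⟨s, hs⟩ := hfin
  have hle : ∀ i ≤ m, γ i ≤ D := fun i hi =>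
    (hanti 0 i (Nat.zero_le _) hi).trans (by rw [hD]; exact Nat.le_add_right _ _)
  have hγ : ∀ i < m, 1 ≤ γ i := fun i hi => hγm ▸ hanti i m hi.le le_rfl
  have hanti' : ∀ i j, i ≤ j → j < m → γ j ≤ γ i := fun i j hij hj => hanti i j hij hj.le
  have hg : ∀ i : Fin m, (MvPolynomial.map (algebraMap K E) (g i)).IsHomogeneous (γ i) :=
    fun i => (hhom i).map _
  have haev : ∀ (ξ : Fin 3 → E) i, eval ξ (MvPolynomial.map (algebraMap K E) (g i)) =
      aeval ξ (g i) := fun ξ i => by rw [eval_map, ← aeval_def]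
  have hzu : ∀ u : Fin 3 → E, (∀ v ∈ s, v ≠ 0 → eval v (lin u) ≠ 0) →
      ∀ ξ : Fin 3 → E, ξ ≠ 0 → (∀ i, eval ξ (MvPolynomial.map (algebraMap K E) (g i)) = 0) →
        eval ξ (lin u) ≠ 0 := by
    intro u hu ξ hξ h0
    obtain ⟨v, hv, t, rfl⟩ := hs ξ hξ (fun i => by rw [← haev]; exact h0 i)
    have ht : t ≠ 0 := fun h => hξ (by rw [h, zero_smul])
    have hv0 : v ≠ 0 := fun h => hξ (by rw [h, smul_zero])
    have h3 := hom_scale (lin u) 1 (lin_hom u) t v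
    rw [aeval_eq_eval, aeval_eq_eval, pow_one] at h3
    have h4 : (fun i => t * v i) = t • v := rfl
    rw [h4] at h3
    rw [h3]
    exact mul_ne_zero ht (hu v hv hv0)
  constructor
  · obtain ⟨u, hu0, -, hus⟩ := exists_good s 1 one_ne_zero
    exact rank_part m g γ D u (span_all m g γ D hhom hγm hle hm u hu0 hγ hanti' (hzu u hus) hD)
  · intro e _ hdet hcard
    have hdetE : MvPolynomial.map (algebraMap K E)
        (((macaulayMatrix m g γ D).submatrix id e).det) ≠ 0 := by
      intro h
      exact hdet (MvPolynomial.map_injective _ (algebraMap K E).injective (h.trans (map_zero _).symm))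
    obtain ⟨u, hu0, hud, hus⟩ := exists_good s _ hdetE
    have hz := hzu u hus
    have hnum : ∀ (w : Fin 3 → E) c, c.1 ≠ Fin.last m →
        colE E m g γ D w c = colE E m g γ D u c := by
      intro w c hc
      rw [colE, colE, GE_lt E m g w c.1 (lt_of_ne_last m hc),
        GE_lt E m g u c.1 (lt_of_ne_last m hc)]
    have hsp : ∀ c, c.1 ≠ Fin.last m → colE E m g γ D u c ∈
        Submodule.span E ((fun μ => colE E m g γ D u (e μ)) '' {μ | (e μ).1 ≠ Fin.last m}) := by
      intro c hc
      obtain ⟨a, ha⟩ := num_span m g γ D e hdet hcard c hc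
      have h1 : colE E m g γ D u c =
          ∑ μ : {μ : Mon D // (e μ).1 ≠ Fin.last m},
            algebraMap K E (a μ) • colE E m g γ D u (e μ) := by
        apply vec_inj D _ _ (colE_hom m g γ D hhom hγm hle u c)
        · refine IsHomogeneous.sum _ _ _ fun μ _ => ?_
          rw [smul_eq_C_mul]
          simpa using (isHomogeneous_C (Fin 3) _).mul (colE_hom m g γ D hhom hγm hle u (e μ))
        · funext ν
          rw [map_sum, Finset.sum_apply, vec_apply, ← entry_spec, ha ν, map_sum]
          refine Finset.sum_congr rfl fun μ _ => ?_
          rw [map_mul, entry_spec, map_smul, Pi.smul_apply, vec_apply, smul_eq_mul]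
          congr 1
          exact (aeval u).commutes (a μ)
      rw [h1]
      exact Submodule.sum_mem _ fun μ _ => Submodule.smul_mem _ _
        (Submodule.subset_span ⟨μ, μ.2, rfl⟩)
    obtain ⟨hfd, hdn⟩ := det_norm hm u hu0
      (fun i : Fin m => MvPolynomial.map (algebraMap K E) (g i)) γ hg hγ hanti' hz D hD
      (fun μ => (e μ).1 ≠ Fin.last m)
      (fun w μ => colE E m g γ D w (e μ))
      (fun μ => monomial (toExp (e μ).2.1) 1)
      (fun w μ => colE_hom m g γ D hhom hγm hle w (e μ))
      (fun w μ hμ => hnum w (e μ) hμ)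
      (fun μ hμ => by
        rw [colE, GE_lt E m g u _ (lt_of_ne_last m hμ)]
        exact Ideal.mul_mem_left _ _ (Ideal.subset_span ⟨_, rfl⟩))
      (fun w μ hμ => by
        rw [not_not] at hμ
        have h1 : GE E m g w (e μ).1 = lin w :=
          (congrArg (GE E m g w) hμ).trans (GE_last E m g w)
        rw [colE, h1])
      (fun f hf hfI => by
        have h1 := span_num m g γ D hhom u f hf hfI
        have h2 : Submodule.span E (colE E m g γ D u '' {c | c.1 ≠ Fin.last m}) ≤
            Submodule.span E ((fun μ => colE E m g γ D u (e μ)) '' {μ | (e μ).1 ≠ Fin.last m}) := by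
          rw [Submodule.span_le]
          rintro _ ⟨c, hc, rfl⟩
          exact hsp c hc
        exact h2 h1)
      (fun w => Matrix.of fun ν μ => coeff (toExp ν.1) (colE E m g γ D w (e μ)))
      (fun w ν μ => rfl)
      (by rw [det_spec]; exact hud)
    obtain ⟨zs, hzs1, hzs2, hzs3⟩ := factor_norm u
      (fun i : Fin m => MvPolynomial.map (algebraMap K E) (g i)) γ hg hfd
    refine ⟨_, zs, hud, ?_, fun ξ hξ => ⟨(hzs2 ξ hξ).1, fun i => ?_⟩, hzs3⟩
    · have : Infinite E := IsAlgClosed.instInfinite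
      apply MvPolynomial.funext
      intro w
      have h1 := hdn w
      rw [det_spec, det_spec, hzs1] at h1
      rw [h1, map_mul, eval_C, map_multiset_prod, Multiset.map_map]
      congr 3
      funext ξ
      simp
    · rw [← haev]; exact (hzs2 ξ hξ).2 i
end

section
/- Let A be a regular triangular set of r polynomials in K[x_1,...,x_n]. Then every irreducible component of Zero(sat(A)) has dimension n − r; in particular, if r > k then every irreducible component of Zero(sat(A)) has dimension strictly less than n − k. -/
open MvPolynomial

namespace TriProof

open Tri

theorem height_maximal {K : Type*} [Field K] : ∀ (n : ℕ) (m : Ideal (MvPolynomial (Fin n) K)),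
    m.IsMaximal → m.height = n := by
  intro n
  induction n with
  | zero =>
    intro m hm
    have h := Ideal.height_le_ringKrullDim_of_ne_top hm.ne_top
    rw [MvPolynomial.ringKrullDim_of_isNoetherianRing, ringKrullDim_eq_zero_of_field] at h
    have h2 : ((m.height : ℕ∞) : WithBot ℕ∞) ≤ ((0 : ℕ∞) : WithBot ℕ∞) := by simpa using h
    rw [WithBot.coe_le_coe] at h2
    simpa using h2
  | succ n ih =>
    intro m hm
    let e : MvPolynomial (Fin (n+1)) K ≃+* Polynomial (MvPolynomial (Fin n) K) :=
      (finSuccEquiv K n).toRingEquiv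
    have hmax : (m.map e).IsMaximal := Ideal.map_isMaximal_of_equiv e
    have h1 : (m.map e).height = m.height := e.height_map m
    have hq : ((m.map e).comap (Polynomial.C : MvPolynomial (Fin n) K →+* _)).IsMaximal :=
      Polynomial.isMaximal_comap_C_of_isJacobsonRing _
    have hl : (m.map e).LiesOver ((m.map e).comap Polynomial.C) := ⟨rfl⟩
    have h2 := Polynomial.height_eq_height_add_one ((m.map e).comap Polynomial.C) (m.map e)
    rw [← h1, h2, ih _ hq]
    push_cast
    rfl

theorem notMem_of_minimal {R : Type*} [CommRing R] (J : Ideal R) (a : R) (p : Ideal R)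
    (hp : p ∈ (saturationBy J a).minimalPrimes) : a ∉ p := by
  intro ha
  obtain ⟨y, hy, k, hk⟩ := Ideal.exists_mul_mem_of_mem_minimalPrimes hp ha
  exact hy ⟨k + 1, by rw [pow_succ, mul_assoc]; exact hk⟩

theorem minimal_of_sat {R : Type*} [CommRing R] (J : Ideal R) (a : R) (p : Ideal R)
    (hp : p ∈ (saturationBy J a).minimalPrimes) : p ∈ J.minimalPrimes := by
  have ha := notMem_of_minimal J a p hp
  refine ⟨⟨hp.1.1, fun x hx => hp.1.2 ⟨0, by simpa using hx⟩⟩, ?_⟩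
  rintro q ⟨hq, hJq⟩ hqp
  refine hp.2 ⟨hq, ?_⟩ hqp
  rintro f ⟨d, hd⟩
  rcases hq.mem_or_mem (hJq hd) with h | h
  · exact absurd (hqp (hq.mem_of_pow_mem d h)) ha
  · exact h

theorem exists_maximal {R : Type*} [CommRing R] [IsNoetherianRing R] [IsJacobsonRing R]
    (J p : Ideal R) (hp : p ∈ J.minimalPrimes) :
    ∃ m : Ideal R, m.IsMaximal ∧ p ≤ m ∧ ∀ q ∈ J.minimalPrimes, q ≤ m → q = p := by
  classical
  have hpp : p.IsPrime := hp.1.1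
  let s := ((Ideal.finite_minimalPrimes_of_isNoetherianRing R J).toFinset).erase p
  have hn : ¬ (s.inf id ≤ p) := by
    rw [hpp.inf_le']
    rintro ⟨q, hq, hqp⟩
    simp only [s, Finset.mem_erase, Set.Finite.mem_toFinset] at hq
    exact hq.1 (le_antisymm hqp (hp.2 hq.2.1 hqp))
  obtain ⟨f, hf, hfp⟩ := SetLike.not_le_iff_exists.mp hn
  have hj : f ∉ p.jacobson := by rwa [IsJacobsonRing.out ‹_› hpp.isRadical]
  rw [Ideal.jacobson, Ideal.mem_sInf] at hj
  push Not at hj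
  obtain ⟨m, hm, hfm⟩ := hj
  refine ⟨m, hm.2, hm.1, fun q hq hqm => ?_⟩
  by_contra hne
  apply hfm
  apply hqm
  have : s.inf id ≤ q := Finset.inf_le (f := id) (by simp [s, hne]; exact hq)
  exact this hf

theorem height_map_le {R : Type*} [CommRing R] (J p m : Ideal R) [m.IsPrime] (hJm : J ≤ m)
    (h : ∀ q ∈ J.minimalPrimes, q ≤ m → q = p) :
    (((m.map (Ideal.Quotient.mk J)).height : ℕ∞) : WithBot ℕ∞) ≤ ringKrullDim (R ⧸ p) := by
  have hpr : (m.map (Ideal.Quotient.mk J)).IsPrime := Ideal.isPrime_map_quotientMk_of_isPrime hJm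
  let M : PrimeSpectrum (R ⧸ J) := ⟨_, hpr⟩
  have : (m.map (Ideal.Quotient.mk J)).height = Order.height M :=
    PrimeSpectrum.height_eq_orderHeight M
  rw [this, Order.height_eq_krullDim_Iic, ringKrullDim_quotient]
  have key : ∀ q : Set.Iic M,
      PrimeSpectrum.comap (Ideal.Quotient.mk J) q.1 ∈ PrimeSpectrum.zeroLocus (p : Set R) := by
    rintro ⟨q, hq⟩
    rw [PrimeSpectrum.mem_zeroLocus]
    have hq' : q.asIdeal ≤ m.map (Ideal.Quotient.mk J) := hq
    have h1 : J ≤ q.asIdeal.comap (Ideal.Quotient.mk J) := by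
      intro x hx
      rw [Ideal.mem_comap, Ideal.Quotient.eq_zero_iff_mem.mpr hx]
      exact Ideal.zero_mem _
    obtain ⟨q0, hq0, hle⟩ := Ideal.exists_minimalPrimes_le h1
    have h2 : q.asIdeal.comap (Ideal.Quotient.mk J) ≤ m := by
      refine (Ideal.comap_mono hq').trans ?_
      rw [Ideal.comap_map_of_surjective _ Ideal.Quotient.mk_surjective]
      refine sup_le le_rfl ?_
      rwa [← RingHom.ker_eq_comap_bot, Ideal.mk_ker]
    rw [← h q0 hq0 (hle.trans h2)]
    exact hle
  refine Order.krullDim_le_of_strictMono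
    (fun q => (⟨PrimeSpectrum.comap (Ideal.Quotient.mk J) q.1, key q⟩ :
      PrimeSpectrum.zeroLocus (p : Set R))) ?_
  refine Monotone.strictMono_of_injective ?_ ?_
  · intro a b hab
    exact Ideal.comap_mono hab
  · intro a b hab
    apply Subtype.ext
    exact PrimeSpectrum.comap_injective_of_surjective _ Ideal.Quotient.mk_surjective
      (congrArg Subtype.val hab)

theorem lower {K : Type*} [Field K] {n r : ℕ} (T : Fin r → MvPolynomial (Fin n) K)
    (p : Ideal (MvPolynomial (Fin n) K)) (hp : p ∈ (Ideal.span (Set.range T)).minimalPrimes) :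
    (n : WithBot ℕ∞) ≤ ringKrullDim (MvPolynomial (Fin n) K ⧸ p) + (r : WithBot ℕ∞) := by
  obtain ⟨m, hm, hpm, huniq⟩ := exists_maximal _ p hp
  have hJm : Ideal.span (Set.range T) ≤ m := hp.1.2.trans hpm
  have h1 := Ideal.height_le_height_add_encard_of_subset (Set.range T) (p := m)
    (Ideal.span_le.mp hJm)
  rw [height_maximal n m hm] at h1
  have h2 : (Set.range T).encard ≤ (r : ℕ∞) := by
    rw [← Set.image_univ]
    refine (Set.encard_image_le _ _).trans ?_
    simp
  have h3 := height_map_le _ p m hJm huniq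
  have h4 := h1.trans (add_le_add_right h2 _)
  have h5 : ((n : ℕ∞) : WithBot ℕ∞) ≤ _ := WithBot.coe_le_coe.mpr h4
  rw [WithBot.coe_add] at h5
  exact h5.trans (add_le_add_left h3 _)

theorem dim_range_le {K D : Type*} [Field K] [CommRing D] [IsDomain D] [Algebra K D]
    (B : Subalgebra K D) [IsNoetherianRing B] (x : D) :
    ∃ C : Subalgebra K D, IsNoetherianRing C ∧ B ≤ C ∧ x ∈ C ∧
      ringKrullDim C ≤ ringKrullDim B + 1 ∧
      ((∃ f : Polynomial B, f ≠ 0 ∧ Polynomial.aeval x f = 0) →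
        ringKrullDim C + 1 ≤ ringKrullDim B + 1) := by
  let φ : Polynomial B →ₐ[K] D := (Polynomial.aeval (R := B) x).restrictScalars K
  have hs : Function.Surjective φ.rangeRestrict := φ.rangeRestrict_surjective
  refine ⟨φ.range, isNoetherianRing_of_surjective _ _ φ.rangeRestrict.toRingHom hs, ?_, ?_, ?_, ?_⟩
  · intro b hb
    exact ⟨Polynomial.C ⟨b, hb⟩, by simp [φ]⟩
  · exact ⟨Polynomial.X, by simp [φ]⟩
  · rw [← Polynomial.ringKrullDim_of_isNoetherianRing]
    exact ringKrullDim_le_of_surjective φ.rangeRestrict.toRingHom hs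
  · rintro ⟨f, hf, hf0⟩
    rw [← Polynomial.ringKrullDim_of_isNoetherianRing (R := B)]
    refine ringKrullDim_succ_le_of_surjective φ.rangeRestrict.toRingHom hs
      (mem_nonZeroDivisors_of_ne_zero hf) ?_
    apply Subtype.ext
    exact hf0

theorem exists_poly {K D : Type*} [Field K] [CommRing D] [Algebra K D] {n : ℕ}
    (π : MvPolynomial (Fin n) K →ₐ[K] D) (B : Subalgebra K D) (f : MvPolynomial (Fin n) K)
    (i : Fin n) (hi : IsLeadingVar f i) (hB : ∀ j < i, π (X j) ∈ B) (hf : π f = 0)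
    (hini : π (initial f i) ≠ 0) :
    ∃ g : Polynomial B, g ≠ 0 ∧ Polynomial.aeval (π (X i)) g = 0 := by
  classical
  have hmem : ∀ m ∈ f.support, π (monomial (Finsupp.erase i m) (coeff m f)) ∈ B := by
    intro m hm
    rw [MvPolynomial.monomial_eq, map_mul, Finsupp.prod, map_prod]
    refine B.mul_mem ?_ (B.prod_mem ?_)
    · rw [← MvPolynomial.algebraMap_eq, AlgHom.commutes]
      exact B.algebraMap_mem _
    · intro j hj
      rw [map_pow]
      apply B.pow_mem
      apply hB
      rw [Finsupp.support_erase, Finset.mem_erase] at hj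
      refine lt_of_le_of_ne (hi.2 j ?_) hj.1
      have h1 := MvPolynomial.monomial_le_degreeOf j hm
      have h2 : m j ≠ 0 := Finsupp.mem_support_iff.mp hj.2
      omega
  let g : Polynomial B := ∑ m ∈ f.support.attach,
    Polynomial.monomial (m.1 i) ⟨π (monomial (Finsupp.erase i m.1) (coeff m.1 f)), hmem m.1 m.2⟩
  refine ⟨g, ?_, ?_⟩
  · intro hg
    apply hini
    have h1 : ((g.coeff (degreeOf i f) : B) : D) = 0 := by rw [hg]; simp
    rw [← h1]
    simp only [g, Polynomial.finsetSum_coeff, Polynomial.coeff_monomial, initial, map_sum]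
    rw [Finset.sum_filter, ← Finset.sum_attach, AddSubmonoidClass.coe_finsetSum]
    refine Finset.sum_congr rfl fun m _ => ?_
    split_ifs <;> rfl
  · rw [← hf]
    conv_rhs => rw [f.as_sum, map_sum, ← Finset.sum_attach]
    simp only [g, map_sum, Polynomial.aeval_monomial]
    refine Finset.sum_congr rfl fun m _ => ?_
    change π _ * _ = _
    rw [← map_pow, ← map_mul, X_pow_eq_monomial, monomial_mul, mul_one, Finsupp.erase_add_single]

theorem upper_chain {K D : Type*} [Field K] [CommRing D] [IsDomain D] [Algebra K D] {n r : ℕ}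
    (π : MvPolynomial (Fin n) K →ₐ[K] D)
    (T : Fin r → MvPolynomial (Fin n) K) (lvs : Fin r → Fin n) (hT : IsTriangular T lvs)
    (h0 : ∀ k, π (T k) = 0) (hini : ∀ k, π (initial (T k) (lvs k)) ≠ 0) :
    ∀ i ≤ n, ∃ B : Subalgebra K D, IsNoetherianRing B ∧ (∀ j : Fin n, j.1 < i → π (X j) ∈ B) ∧
      ringKrullDim B + ((Finset.univ.filter (fun k => (lvs k).1 < i)).card : ℕ) ≤ (i : ℕ) := by
  intro i
  induction i with
  | zero =>
    intro _
    have e : (⊥ : Subalgebra K D) ≃ₐ[K] K := Algebra.botEquiv K D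
    refine ⟨⊥, isNoetherianRing_of_ringEquiv K e.symm.toRingEquiv, by simp, ?_⟩
    rw [ringKrullDim_eq_of_ringEquiv e.toRingEquiv, ringKrullDim_eq_zero_of_field]
    simp
  | succ i ih =>
    intro hi
    obtain ⟨B, hBn, hB, hd⟩ := ih (by omega)
    let x : Fin n := ⟨i, by omega⟩
    obtain ⟨C, hCn, hBC, hxC, hC1, hC2⟩ := dim_range_le B (π (X x))
    refine ⟨C, hCn, ?_, ?_⟩
    · intro j hj
      rcases Nat.lt_succ_iff_lt_or_eq.mp hj with h | h
      · exact hBC (hB j h)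
      · have : j = x := Fin.ext h
        rwa [this]
    by_cases hx : ∃ k, lvs k = x
    · obtain ⟨k, hk⟩ := hx
      have hC3 := hC2 (exists_poly π B (T k) x (hk ▸ hT.2 k) (fun j hj => hB j hj) (h0 k)
        (hk ▸ hini k))
      have hcard : (Finset.univ.filter (fun k => (lvs k).1 < i + 1)).card =
          (Finset.univ.filter (fun k => (lvs k).1 < i)).card + 1 := by
        have : Finset.univ.filter (fun k => (lvs k).1 < i + 1) =
            insert k (Finset.univ.filter (fun k => (lvs k).1 < i)) := by
          ext l
          simp only [Finset.mem_filter, Finset.mem_univ, true_and, Finset.mem_insert]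
          have hkx : (lvs k).1 = i := by rw [hk]
          constructor
          · intro h
            rcases Nat.lt_succ_iff_lt_or_eq.mp h with h | h
            · exact Or.inr h
            · exact Or.inl (hT.1.injective (Fin.ext (h.trans hkx.symm)))
          · rintro (rfl | h) <;> omega
        rw [this, Finset.card_insert_of_notMem]
        simp [hk, x]
      rw [hcard]
      push_cast
      calc _ = (ringKrullDim C + 1) + ((Finset.univ.filter (fun k => (lvs k).1 < i)).card : ℕ) := by
            abel
        _ ≤ (ringKrullDim B + 1) + ((Finset.univ.filter (fun k => (lvs k).1 < i)).card : ℕ) := by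
            gcongr
        _ = (ringKrullDim B + ((Finset.univ.filter (fun k => (lvs k).1 < i)).card : ℕ)) + 1 := by
            abel
        _ ≤ _ := by gcongr
    · have hcard : (Finset.univ.filter (fun k => (lvs k).1 < i + 1)) =
          (Finset.univ.filter (fun k => (lvs k).1 < i)) := by
        ext l
        simp only [Finset.mem_filter, Finset.mem_univ, true_and]
        have : (lvs l).1 ≠ i := fun h => hx ⟨l, Fin.ext h⟩
        omega
      rw [hcard]
      push_cast
      calc _ ≤ (ringKrullDim B + 1) + ((Finset.univ.filter (fun k => (lvs k).1 < i)).card : ℕ) := by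
            gcongr
        _ = (ringKrullDim B + ((Finset.univ.filter (fun k => (lvs k).1 < i)).card : ℕ)) + 1 := by
            abel
        _ ≤ _ := by gcongr

theorem upper {K : Type*} [Field K] {n r : ℕ} (T : Fin r → MvPolynomial (Fin n) K)
    (lvs : Fin r → Fin n) (hT : IsTriangular T lvs)
    (p : Ideal (MvPolynomial (Fin n) K)) [p.IsPrime] (h0 : ∀ k, T k ∈ p)
    (hini : ∀ k, initial (T k) (lvs k) ∉ p) :
    ringKrullDim (MvPolynomial (Fin n) K ⧸ p) + (r : WithBot ℕ∞) ≤ (n : WithBot ℕ∞) := by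
  obtain ⟨B, hBn, hB, hd⟩ := upper_chain (Ideal.Quotient.mkₐ K p) T lvs hT
    (fun k => Ideal.Quotient.eq_zero_iff_mem.mpr (h0 k))
    (fun k hk => hini k (Ideal.Quotient.eq_zero_iff_mem.mp hk)) n le_rfl
  have hcard : (Finset.univ.filter (fun k => (lvs k).1 < n)).card = r := by
    simp
  rw [hcard] at hd
  have htop : B = ⊤ := by
    rw [eq_top_iff]
    rintro y -
    obtain ⟨f, rfl⟩ := Ideal.Quotient.mkₐ_surjective K p y
    have : (Ideal.Quotient.mkₐ K p) f ∈ (B.comap (Ideal.Quotient.mkₐ K p)).map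
      (Ideal.Quotient.mkₐ K p) := by
      refine ⟨f, ?_, rfl⟩
      have h2 : (⊤ : Subalgebra K (MvPolynomial (Fin n) K)) ≤ B.comap (Ideal.Quotient.mkₐ K p) := by
        rw [← MvPolynomial.adjoin_range_X, Algebra.adjoin_le_iff]
        rintro _ ⟨j, rfl⟩
        exact hB j j.2
      exact h2 trivial
    obtain ⟨g, hg, hgf⟩ := this
    rw [← hgf]
    exact hg
  subst htop
  rwa [ringKrullDim_eq_of_ringEquiv
    (Subalgebra.topEquiv (R := K) (A := MvPolynomial (Fin n) K ⧸ p)).toRingEquiv] at hd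

end TriProof

open Tri in
/-- Every irreducible component of `Zero(sat(A))`, for `A` a regular triangular set of `r`
polynomials in `n` variables, has dimension `n - r`; in particular, if `r > k` then every
irreducible component has dimension strictly less than `n - k`. -/
theorem dim_components_satIdeal
    {K : Type*} [Field K] [CharZero K] {n r : ℕ}
    (T : Fin r → MvPolynomial (Fin n) K) (lvs : Fin r → Fin n)
    (hT : IsRegular T lvs) :
    ∀ p ∈ (satIdeal T lvs).minimalPrimes,
      ringKrullDim (MvPolynomial (Fin n) K ⧸ p) = ((n - r : ℕ) : WithBot ℕ∞) ∧
      ∀ k : ℕ, k < r → ringKrullDim (MvPolynomial (Fin n) K ⧸ p) < ((n - k : ℕ) : WithBot ℕ∞) := by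
  intro p hp
  have hpp : p.IsPrime := hp.1.1
  have ha := TriProof.notMem_of_minimal _ _ p hp
  have hmin := TriProof.minimal_of_sat _ _ p hp
  have hl := TriProof.lower T p hmin
  have hu := TriProof.upper T lvs hT.1 p
    (fun k => hmin.1.2 (Ideal.subset_span (Set.mem_range_self k)))
    (fun k hk => ha (Ideal.mem_of_dvd p (Finset.dvd_prod_of_mem _ (Finset.mem_univ k)) hk))
  have hrn : r ≤ n := by
    simpa using Fintype.card_le_of_injective lvs hT.1.1.injective
  have heq : ringKrullDim (MvPolynomial (Fin n) K ⧸ p) = ((n - r : ℕ) : WithBot ℕ∞) := by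
    have h := le_antisymm hu hl
    generalize ringKrullDim (MvPolynomial (Fin n) K ⧸ p) = d at h
    induction d using WithBot.recBotCoe with
    | bot =>
      exact absurd h (by rw [WithBot.bot_add]; exact (WithBot.coe_ne_bot (a := (n : ℕ∞))).symm)
    | coe d =>
      induction d using ENat.recTopCoe with
      | top =>
        have h' : ((⊤ + (r : ℕ∞) : ℕ∞) : WithBot ℕ∞) = ((n : ℕ∞) : WithBot ℕ∞) := h
        rw [WithBot.coe_inj, top_add] at h'
        exact absurd h'.symm (ENat.natCast_ne_top n)
      | coe d =>
        have h' : (((d + r : ℕ) : ℕ∞) : WithBot ℕ∞) = ((n : ℕ∞) : WithBot ℕ∞) := by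
          refine Eq.trans ?_ h; push_cast; rfl
        rw [WithBot.coe_inj, Nat.cast_inj] at h'
        have : d = n - r := by omega
        rw [this]; rfl
  refine ⟨heq, fun k hk => ?_⟩
  rw [heq]
  exact_mod_cast (by omega : n - r < n - k)
end
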